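/- arXiv:2402.04428 — 2 statements merged into one kernel-verified Lean document; each statement's English description precedes it below -/
import Mathlib

section
/- Let a ≥ 2 and b ≥ 2 be coprime integers and let r be a positive integer coprime to a and b. If r > b^{2·a·log a} (as real numbers, with log the natural logarithm), then there is at most one pair (x,y) of positive integers with a^x − b^y = r. -/
theorem abs_det_le_factorial_mul_prod {ι : Type*} [Fintype ι] [DecidableEq ι]
    (A : Matrix ι ι ℝ) (u : ι → ℝ) (h : ∀ i j, |A i j| ≤ u i) :
    |A.det| ≤ (Fintype.card ι).factorial * ∏ i, u i := by
  rw [← Matrix.det_transpose, Matrix.det_apply]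
  refine (Finset.abs_sum_le_sum_abs _ _).trans ?_
  have : ∀ σ ∈ (Finset.univ : Finset (Equiv.Perm ι)),
      |Equiv.Perm.sign σ • ∏ i, A.transpose (σ i) i| ≤ ∏ i, u i := by
    intro σ _
    have h1 : |Equiv.Perm.sign σ • ∏ i, A.transpose (σ i) i| = |∏ i, A.transpose (σ i) i| := by
      rcases Int.units_eq_one_or (Equiv.Perm.sign σ) with h | h <;> simp [h]
    rw [h1, Finset.abs_prod]
    exact Finset.prod_le_prod (fun _ _ => abs_nonneg _) (fun i _ => h i (σ i))
  refine (Finset.sum_le_sum this).trans ?_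
  simp [Fintype.card_perm]

theorem sum_range_le_sum_of_injOn (s : Finset ℕ) : ∑ i ∈ Finset.range s.card, i ≤ ∑ i ∈ s, i := by
  induction s using Finset.induction_on_max with
  | empty => simp
  | insert a s hs ih =>
    have ha : a ∉ s := fun h => lt_irrefl _ (hs a h)
    rw [Finset.card_insert_of_notMem ha, Finset.sum_range_succ, Finset.sum_insert ha]
    have hc : s.card ≤ a := by
      have : s ⊆ Finset.range a := fun i hi => Finset.mem_range.2 (hs i hi)
      simpa using Finset.card_le_card this
    omega

/-- Exponents bounded by the number of indices, in which only the maximal value may be repeated,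
have at least the sum `0 + 1 + ⋯ + (N - 1)`. -/
theorem sum_range_card_le_sum {ι : Type*} [Fintype ι] [DecidableEq ι] (g : ι → ℕ)
    (hinj : ∀ i j, g i = g j → g i < Fintype.card ι → i = j) :
    ∑ i ∈ Finset.range (Fintype.card ι), i ≤ ∑ i, g i := by
  set N := Fintype.card ι
  set T := Finset.univ.filter (fun i => g i < N)
  set U := Finset.univ.filter (fun i => ¬ g i < N)
  have hTU : T.card + U.card = N :=
    Finset.card_filter_add_card_filter_not (s := Finset.univ) (fun i => g i < N)
  have h1 : ∑ i, g i = ∑ i ∈ T, g i + ∑ i ∈ U, g i :=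
    (Finset.sum_filter_add_sum_filter_not _ _ _).symm
  have h2 : U.card * N ≤ ∑ i ∈ U, g i := by
    rw [← smul_eq_mul]
    refine Finset.card_nsmul_le_sum _ _ _ ?_
    intro i hi
    simpa [U] using hi
  have hinjT : Set.InjOn g T := by
    intro i hi j hj hij
    exact hinj i j hij (by simpa [T] using hi)
  have h3 : ∑ i ∈ Finset.range T.card, i ≤ ∑ i ∈ T, g i := by
    have := sum_range_le_sum_of_injOn (T.image g)
    rwa [Finset.card_image_of_injOn hinjT, Finset.sum_image hinjT] at this
  have h4 : ∑ i ∈ Finset.range N, i ≤ ∑ i ∈ Finset.range T.card, i + U.card * N := by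
    rw [← hTU, Finset.sum_range_add, hTU]
    gcongr
    refine (Finset.sum_le_card_nsmul _ _ N ?_).trans (by simp)
    intro i hi
    simp only [Finset.mem_range] at hi
    omega
  omega

/-- A Schwarz lemma for interpolation determinants: functions given by power series truncated
at the order of the matrix, up to an error term. -/
theorem abs_det_mul_pow_le {ι : Type*} [Fintype ι] [DecidableEq ι]
    (A : Matrix ι ι ℝ) (z : ι → ℝ) (c : ι → ℕ → ℝ) (e : ι → ι → ℝ) (E B : ι → ℝ) (ζ ρ : ℝ)
    (hρ : 1 ≤ ρ) (hz : ∀ j, |z j| ≤ ζ) (he : ∀ i j, |e i j| ≤ E i)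
    (hA : ∀ i j, A i j = ∑ n ∈ Finset.range (Fintype.card ι), c i n * z j ^ n + e i j)
    (hB : ∀ i, ∑ n ∈ Finset.range (Fintype.card ι), |c i n| * (ρ * ζ) ^ n
      + ρ ^ Fintype.card ι * E i ≤ B i) :
    |A.det| * ρ ^ (∑ i ∈ Finset.range (Fintype.card ι), i)
      ≤ (Fintype.card ι).factorial * ∏ i, B i := by
  set N := Fintype.card ι with hN
  rcases isEmpty_or_nonempty ι with hemp | ⟨⟨j₀⟩⟩
  · have : N = 0 := Fintype.card_eq_zero
    simp [this]
  have hζ : 0 ≤ ζ := (abs_nonneg _).trans (hz j₀)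
  have hE : ∀ i, 0 ≤ E i := fun i => (abs_nonneg _).trans (he i j₀)
  let v : ι → ℕ → ι → ℝ := fun i n j => if n < N then c i n * z j ^ n else e i j
  let u : ι → ℕ → ℝ := fun i n => if n < N then |c i n| * ζ ^ n else E i
  have hvu : ∀ i n j, |v i n j| ≤ u i n := by
    intro i n j
    by_cases h : n < N
    · simp only [v, u, h, if_true, abs_mul, abs_pow]
      gcongr
      exact hz j
    · simpa only [v, u, h, if_false] using he i j
  have hu : ∀ i n, 0 ≤ u i n := fun i n => (abs_nonneg _).trans (hvu i n j₀)
  have hAv : A.det = ∑ g ∈ Fintype.piFinset (fun _ : ι => Finset.range (N + 1)),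
      Matrix.det (fun i => v i (g i)) := by
    have h := (Matrix.detRowAlternating (n := ι) (R := ℝ)).toMultilinearMap.map_sum_finset
      v (fun _ => Finset.range (N + 1))
    have h2 : A = fun i => ∑ n ∈ Finset.range (N + 1), v i n := by
      ext i j
      rw [hA i j, Finset.sum_apply, Finset.sum_range_succ]
      congr 1
      · refine Finset.sum_congr rfl fun n hn => ?_
        simp [v, Finset.mem_range.1 hn]
      · simp [v]
    rw [h2]
    exact h
  have hterm : ∀ g : ι → ℕ, |Matrix.det (fun i => v i (g i))| * ρ ^ (∑ i ∈ Finset.range N, i)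
      ≤ N.factorial * ∏ i, (u i (g i) * ρ ^ g i) := by
    intro g
    by_cases hg : ∀ i j, g i = g j → g i < N → i = j
    · rw [Finset.prod_mul_distrib, Finset.prod_pow_eq_pow_sum, ← mul_assoc]
      have h1 := abs_det_le_factorial_mul_prod (fun i => v i (g i)) (fun i => u i (g i))
        (fun i j => hvu i (g i) j)
      have h2 := sum_range_card_le_sum g hg
      have h3 : 0 ≤ ∏ i, u i (g i) := Finset.prod_nonneg fun i _ => hu _ _
      gcongr
    · push Not at hg
      obtain ⟨i, j, hij, hi, hne⟩ := hg
      have hdet : Matrix.det (fun i => v i (g i)) = 0 := by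
        apply Matrix.det_eq_zero_of_not_linearIndependent_rows
        intro hli
        have hpair : ![v i (g i), v j (g j)] = (fun i => v i (g i)) ∘ ![i, j] := by
          ext p
          fin_cases p <;> rfl
        have hdep := (LinearIndependent.pair_iff.1 (hpair ▸ hli.comp ![i, j] (by
            intro p q hpq
            fin_cases p <;> fin_cases q <;> simp_all))) (c j (g j)) (-(c i (g i))) (by
          ext q
          simp only [v, hij ▸ hi, if_true, Pi.add_apply, Pi.smul_apply, smul_eq_mul,
            Pi.zero_apply, hij]
          ring)
        have hne0 := hli.ne_zero i
        apply hne0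
        ext q
        have hci : c i (g i) = 0 := by linarith [hdep.2]
        simp [v, hi, hci]
      rw [hdet]
      simp only [abs_zero, zero_mul]
      exact mul_nonneg (by positivity) (Finset.prod_nonneg fun i _ =>
        mul_nonneg (hu _ _) (by positivity))
  calc |A.det| * ρ ^ (∑ i ∈ Finset.range N, i)
      ≤ (∑ g ∈ Fintype.piFinset (fun _ : ι => Finset.range (N + 1)),
          |Matrix.det (fun i => v i (g i))|) * ρ ^ (∑ i ∈ Finset.range N, i) := by
        rw [hAv]
        gcongr
        exact Finset.abs_sum_le_sum_abs _ _
    _ ≤ ∑ g ∈ Fintype.piFinset (fun _ : ι => Finset.range (N + 1)),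
          N.factorial * ∏ i, (u i (g i) * ρ ^ g i) := by
        rw [Finset.sum_mul]
        exact Finset.sum_le_sum fun g _ => hterm g
    _ = N.factorial * ∏ i, ∑ n ∈ Finset.range (N + 1), u i n * ρ ^ n := by
        rw [← Finset.mul_sum, Finset.prod_univ_sum]
    _ ≤ N.factorial * ∏ i, B i := by
        gcongr with i
        · intro i _
          exact Finset.sum_nonneg fun n _ => mul_nonneg (hu _ _) (by positivity)
        · refine le_trans (le_of_eq ?_) (hB i)
          rw [Finset.sum_range_succ]
          congr 1
          · refine Finset.sum_congr rfl fun n hn => ?_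
            simp only [u, Finset.mem_range.1 hn, if_true]
            ring
          · simp [u, mul_comm]

theorem exists_submatrix_det_ne_zero {ι κ : Type*} [Fintype ι] [DecidableEq ι] [Fintype κ]
    (A : Matrix ι κ ℝ) (h : LinearIndependent ℝ A.row) :
    ∃ f : ι → κ, (A.submatrix id f).det ≠ 0 := by
  have hr : A.rank = Fintype.card ι := h.rank_matrix
  rw [Matrix.rank_eq_finrank_span_cols] at hr
  obtain ⟨b, hb, hspan, hli⟩ := exists_linearIndependent ℝ (Set.range A.col)
  have hfin : b.Finite := (Set.finite_range _).subset hb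
  have := hfin.fintype
  have hcard : Fintype.card b = Fintype.card ι := by
    rw [← hr, ← hspan]
    have := finrank_span_eq_card hli
    rw [Subtype.range_coe] at this
    exact this.symm
  let e : ι ≃ b := Fintype.equivOfCardEq hcard.symm
  choose f hf using fun i => hb (e i).2
  refine ⟨f, ?_⟩
  have hcol : LinearIndependent ℝ (A.submatrix id f).col := by
    have := hli.comp e e.injective
    have hcomp : (A.submatrix id f).col = Subtype.val ∘ e := by
      ext i j
      simp [← hf, Matrix.col, Matrix.submatrix]
    rwa [hcomp]
  rw [Matrix.linearIndependent_cols_iff_isUnit, Matrix.isUnit_iff_isUnit_det] at hcol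
  exact hcol.ne_zero

section

open Polynomial

theorem coeff_prod_sum {ι : Type*} (s : Finset ι) (f : ι → ℝ[X]) (d : ι → ℕ)
    (h : ∀ i ∈ s, (f i).natDegree ≤ d i) :
    (∏ i ∈ s, f i).coeff (∑ i ∈ s, d i) = ∏ i ∈ s, (f i).coeff (d i) := by
  classical
  induction s using Finset.induction_on with
  | empty => simp
  | insert a s ha ih =>
    rw [Finset.prod_insert ha, Finset.sum_insert ha, Finset.prod_insert ha,
      ← ih fun i hi => h i (Finset.mem_insert_of_mem hi)]
    refine coeff_mul_add_eq_of_natDegree_le (h a (Finset.mem_insert_self _ _)) ?_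
    refine (natDegree_prod_le _ _).trans (Finset.sum_le_sum fun i hi => ?_)
    exact h i (Finset.mem_insert_of_mem hi)

theorem coeff_det_sum {ι : Type*} [Fintype ι] [DecidableEq ι] (M : Matrix ι ι ℝ[X]) (d : ι → ℕ)
    (h : ∀ i j, (M i j).natDegree ≤ d j) :
    M.det.coeff (∑ j, d j) = (Matrix.of fun i j => (M i j).coeff (d j)).det := by
  rw [Matrix.det_apply, Matrix.det_apply, finsetSum_coeff]
  refine Finset.sum_congr rfl fun σ _ => ?_
  rw [coeff_smul, coeff_prod_sum _ _ _ fun i _ => h (σ i) i]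
  rfl

theorem natDegree_det_le_sum {ι : Type*} [Fintype ι] [DecidableEq ι] (M : Matrix ι ι ℝ[X])
    (d : ι → ℕ) (h : ∀ i j, (M i j).natDegree ≤ d j) : M.det.natDegree ≤ ∑ j, d j := by
  rw [Matrix.det_apply]
  refine natDegree_sum_le_of_forall_le _ _ fun σ _ => ?_
  refine (natDegree_smul_le _ _).trans ((natDegree_prod_le _ _).trans ?_)
  exact Finset.sum_le_sum fun i _ => h _ _

/-- Zero estimate: an exponential polynomial in one group variable which vanishes on a large
box is zero. -/
theorem eq_zero_of_vanish_on_box {ι : Type*} [Fintype ι] [DecidableEq ι]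
    (P : ι → ℝ[X]) (D : ℕ) (hP : ∀ l, (P l).natDegree ≤ D)
    (α β : ι → ℝ) (hα : Function.Injective α) (hα0 : ∀ l, α l ≠ 0) (hβ0 : ∀ l, β l ≠ 0)
    (x y : ℝ) (box : Finset (ℤ × ℤ))
    (hinj : Set.InjOn (fun t : ℤ × ℤ => (t.1 : ℝ) * y + t.2 * x) box)
    (hcard : D * Fintype.card ι < box.card)
    (hvan : ∀ t ∈ box, ∀ i : ℕ, i < Fintype.card ι →
      ∑ l, (P l).eval (((t.1 + i : ℤ) : ℝ) * y + t.2 * x) * (α l ^ (t.1 + i) * β l ^ t.2) = 0) :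
    ∀ l, P l = 0 := by
  by_contra! hne
  obtain ⟨l₀, hl₀⟩ := hne
  let T := {l : ι // P l ≠ 0}
  set m := Fintype.card T
  have hm : m ≤ Fintype.card ι := Fintype.card_subtype_le _
  let ε : T ≃ Fin m := Fintype.equivFin T
  let M : Matrix (Fin m) (Fin m) ℝ[X] := fun i j =>
    C (α (ε.symm j) ^ (i : ℕ)) * taylor ((i : ℕ) * y) (P (ε.symm j))
  let d : Fin m → ℕ := fun j => (P (ε.symm j)).natDegree
  have hd : ∀ i j, (M i j).natDegree ≤ d j := fun i j =>
    (natDegree_C_mul_le _ _).trans (natDegree_taylor _ _).le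
  have hdeg : M.det.natDegree ≤ D * Fintype.card ι := by
    refine (natDegree_det_le_sum M d hd).trans ?_
    refine (Finset.sum_le_card_nsmul _ _ D fun j _ => hP _).trans ?_
    simp only [Finset.card_univ, Fintype.card_fin, smul_eq_mul]
    rw [mul_comm]
    gcongr
  have hzero : M.det = 0 := by
    refine eq_zero_of_natDegree_lt_card_of_eval_eq_zero' M.det
      (box.image fun t : ℤ × ℤ => (t.1 : ℝ) * y + t.2 * x) ?_ ?_
    · intro w hw
      obtain ⟨t, ht, rfl⟩ := Finset.mem_image.1 hw
      rw [← coe_evalRingHom, RingHom.map_det, ← Matrix.exists_mulVec_eq_zero_iff]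
      refine ⟨fun j => α (ε.symm j) ^ t.1 * β (ε.symm j) ^ t.2, ?_, ?_⟩
      · intro h0
        have := congrFun h0 (ε ⟨l₀, hl₀⟩)
        simp only [Equiv.symm_apply_apply, Pi.zero_apply, mul_eq_zero] at this
        rcases this with h | h
        · exact zpow_ne_zero _ (hα0 _) h
        · exact zpow_ne_zero _ (hβ0 _) h
      · ext i
        have hv := hvan t ht i (i.2.trans_le hm)
        rw [← Finset.sum_subset (Finset.subset_univ (Finset.univ.filter fun l => P l ≠ 0))
          (by intro l _ hl; simp at hl; simp [hl])] at hv
        rw [Finset.sum_subtype (p := fun l => P l ≠ 0) _ (by simp)] at hv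
        rw [Pi.zero_apply, ← hv, ← ε.symm.sum_comp]
        simp only [Matrix.mulVec, dotProduct]
        refine Finset.sum_congr rfl fun j _ => ?_
        have hent : (evalRingHom ((t.1 : ℝ) * y + t.2 * x)).mapMatrix M i j =
            α (ε.symm j) ^ (i : ℕ) *
              (P (ε.symm j)).eval (((t.1 : ℝ) * y + t.2 * x) + (i : ℕ) * y) := by
          change eval _ (C _ * taylor _ _) = _
          rw [eval_mul, eval_C, taylor_eval]
        rw [hent, zpow_add₀ (hα0 _), zpow_natCast]
        push_cast
        ring_nf
    · rw [Finset.card_image_of_injOn hinj]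
      exact hdeg.trans_lt hcard
  have hcoeff := coeff_det_sum M d hd
  rw [hzero, coeff_zero] at hcoeff
  have hmat : (Matrix.of fun i j => (M i j).coeff (d j)) =
      Matrix.of fun i j => (P (ε.symm j)).leadingCoeff *
        (Matrix.vandermonde fun j => α (ε.symm j)).transpose i j := by
    ext i j
    simp only [Matrix.of_apply, M, coeff_C_mul, d, coeff_taylor_natDegree,
      Matrix.transpose_apply, Matrix.vandermonde_apply]
    ring
  rw [hmat, Matrix.det_mul_row, Matrix.det_transpose] at hcoeff
  refine mul_ne_zero ?_ ?_ hcoeff.symm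
  · exact Finset.prod_ne_zero_iff.2 fun j _ => leadingCoeff_ne_zero.2 (ε.symm j).2
  · rw [Matrix.det_vandermonde_ne_zero_iff]
    exact fun i j hij => ε.symm.injective (Subtype.ext (hα hij))

end

theorem hasSum_pow_mul_exp (k : ℕ) (μ z : ℝ) :
    HasSum (fun n => (if k ≤ n then μ ^ (n - k) / (n - k).factorial else 0) * z ^ n)
      (z ^ k * Real.exp (μ * z)) := by
  have h : HasSum (fun n : ℕ => z ^ k * ((μ * z) ^ n / n.factorial))
      (z ^ k * Real.exp (μ * z)) := by
    rw [Real.exp_eq_exp_ℝ]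
    exact (NormedSpace.expSeries_div_hasSum_exp (μ * z)).mul_left _
  have h0 : ∑ n ∈ Finset.range k,
      (if k ≤ n then μ ^ (n - k) / (n - k).factorial else 0) * z ^ n = 0 :=
    Finset.sum_eq_zero fun n hn => by simp [(Finset.mem_range.1 hn).not_ge]
  have h1 := (hasSum_nat_add_iff (f := fun n =>
    (if k ≤ n then μ ^ (n - k) / (n - k).factorial else 0) * z ^ n) k
    (g := z ^ k * Real.exp (μ * z))).1 (by
      rw [show (fun n : ℕ => (if k ≤ n + k then μ ^ (n + k - k) / (n + k - k).factorial else 0)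
        * z ^ (n + k)) = fun n => z ^ k * ((μ * z) ^ n / n.factorial) from funext fun n => by
          rw [if_pos (Nat.le_add_left k n), Nat.add_sub_cancel]
          ring]
      exact h)
  rwa [h0, add_zero] at h1

theorem pow_mul_abs_sub_sum_le {c : ℕ → ℝ} {z ζ ρ f F : ℝ} (N : ℕ) (hz : |z| ≤ ζ) (hρ : 1 ≤ ρ)
    (hf : HasSum (fun n => c n * z ^ n) f) (hF : HasSum (fun n => |c n| * (ρ * ζ) ^ n) F) :
    ρ ^ N * |f - ∑ n ∈ Finset.range N, c n * z ^ n|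
      ≤ F - ∑ n ∈ Finset.range N, |c n| * (ρ * ζ) ^ n := by
  have hζ : 0 ≤ ζ := (abs_nonneg _).trans hz
  have h1 := (hasSum_nat_add_iff' N).2 hf
  have h2 := (hasSum_nat_add_iff' N).2 hF
  rw [← abs_of_nonneg (show 0 ≤ ρ ^ N by positivity), ← abs_mul]
  have h3 := h1.mul_left (ρ ^ N)
  have hle : ∀ n, |ρ ^ N * (c (n + N) * z ^ (n + N))| ≤ |c (n + N)| * (ρ * ζ) ^ (n + N) := by
    intro n
    rw [abs_mul, abs_mul, abs_of_nonneg (show 0 ≤ ρ ^ N by positivity), abs_pow, mul_pow,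
      mul_left_comm]
    gcongr
    · omega
  have := tsum_of_norm_bounded (f := fun n => ρ ^ N * (c (n + N) * z ^ (n + N))) h2 hle
  rwa [h3.tsum_eq] at this

theorem abs_det_exp_mul_pow_le {ι : Type*} [Fintype ι] [DecidableEq ι]
    (A : Matrix ι ι ℝ) (z : ι → ℝ) (k : ι → ℕ) (μ G : ι → ℝ) (ζ ρ : ℝ) (hρ : 1 ≤ ρ)
    (hG : ∀ i, 0 ≤ G i) (hz : ∀ j, |z j| ≤ ζ)
    (hA : ∀ i j, ρ ^ Fintype.card ι * |A i j - G i * (z j ^ k i * Real.exp (μ i * z j))|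
      ≤ G i * ((ρ * ζ) ^ k i * Real.exp (|μ i| * (ρ * ζ)))) :
    |A.det| * ρ ^ (∑ i ∈ Finset.range (Fintype.card ι), i)
      ≤ (Fintype.card ι).factorial *
        ∏ i, (2 * (G i * ((ρ * ζ) ^ k i * Real.exp (|μ i| * (ρ * ζ))))) := by
  set N := Fintype.card ι with hN
  have hρN : 0 < ρ ^ N := by positivity
  let c : ι → ℕ → ℝ := fun i n =>
    G i * (if k i ≤ n then μ i ^ (n - k i) / (n - k i).factorial else 0)
  set F : ι → ℝ := fun i => G i * ((ρ * ζ) ^ k i * Real.exp (|μ i| * (ρ * ζ)))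
  have hf : ∀ i w, HasSum (fun n => c i n * w ^ n) (G i * (w ^ k i * Real.exp (μ i * w))) := by
    intro i w
    simpa only [c, mul_assoc] using (hasSum_pow_mul_exp (k i) (μ i) w).mul_left (G i)
  have hF : ∀ i, HasSum (fun n => |c i n| * (ρ * ζ) ^ n) (F i) := by
    intro i
    have := (hasSum_pow_mul_exp (k i) |μ i| (ρ * ζ)).mul_left (G i)
    rw [show (fun n => |c i n| * (ρ * ζ) ^ n) = fun n => G i *
      ((if k i ≤ n then |μ i| ^ (n - k i) / (n - k i).factorial else 0) * (ρ * ζ) ^ n) from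
        funext fun n => by
          simp only [c, abs_mul, abs_of_nonneg (hG i), mul_assoc]
          split_ifs <;> simp [abs_div]]
    exact this
  refine abs_det_mul_pow_le A z c
    (fun i j => A i j - ∑ n ∈ Finset.range N, c i n * z j ^ n)
    (fun i => (2 * F i - ∑ n ∈ Finset.range N, |c i n| * (ρ * ζ) ^ n) / ρ ^ N) _ ζ ρ hρ hz ?_ ?_ ?_
  · intro i j
    rw [le_div_iff₀ hρN, mul_comm]
    have h1 := pow_mul_abs_sub_sum_le N (hz j) hρ (hf i (z j)) (hF i)
    have h2 := hA i j
    have h3 := abs_add_le (A i j - G i * (z j ^ k i * Real.exp (μ i * z j)))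
      (G i * (z j ^ k i * Real.exp (μ i * z j)) - ∑ n ∈ Finset.range N, c i n * z j ^ n)
    rw [sub_add_sub_cancel] at h3
    have h4 := mul_le_mul_of_nonneg_left h3 hρN.le
    rw [mul_add] at h4
    linarith
  · intro i j
    ring
  · intro i
    rw [mul_div_cancel₀ _ hρN.ne']
    linarith

/-- Entry of the interpolation matrix attached to the function `z ^ k * a ^ (e * z / y)` and the
point `r * y + s * x`, scaled so as to be an integer for `|r| ≤ R` and `|s| ≤ S`. -/
def interpEntry (a b x y R S k : ℕ) (e : ℤ) (t : ℤ × ℤ) : ℤ :=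
  (t.1 * y + t.2 * x) ^ k *
    (a ^ (|e| * R + e * t.1).toNat * b ^ (|e| * S + e * t.2).toNat)

theorem pow_toNat_abs_mul_add {a : ℕ} (ha : 0 < a) {R : ℕ} {e r : ℤ} (hr : |r| ≤ R) :
    (a : ℝ) ^ (|e| * R + e * r).toNat = (a : ℝ) ^ (|e| * R) * ((a : ℝ) ^ e) ^ r := by
  have h : 0 ≤ |e| * R + e * r := by
    have h1 : -(e * r) ≤ |e| * |r| := by
      rw [← abs_mul]
      exact neg_le_abs _
    have h2 := mul_le_mul_of_nonneg_left hr (abs_nonneg e)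
    linarith
  rw [← zpow_mul, ← zpow_add₀ (by positivity), ← zpow_natCast, Int.toNat_of_nonneg h]

theorem interpEntry_eq_zpow {a b x y R S k : ℕ} (ha : 0 < a) (hb : 0 < b) {e : ℤ} {t : ℤ × ℤ}
    (h1 : |t.1| ≤ R) (h2 : |t.2| ≤ S) :
    (interpEntry a b x y R S k e t : ℝ) = ((t.1 : ℝ) * y + t.2 * x) ^ k *
      ((a : ℝ) ^ (|e| * R) * (b : ℝ) ^ (|e| * S)) *
        (((a : ℝ) ^ e) ^ t.1 * ((b : ℝ) ^ e) ^ t.2) := by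
  rw [interpEntry]
  push_cast
  rw [pow_toNat_abs_mul_add ha h1, pow_toNat_abs_mul_add hb h2]
  ring

theorem interpEntry_eq_exp {a b x y R S k : ℕ} (ha : 0 < a) (hb : 0 < b) (hy : 0 < y) {e : ℤ}
    {t : ℤ × ℤ} (h1 : |t.1| ≤ R) (h2 : |t.2| ≤ S) :
    (interpEntry a b x y R S k e t : ℝ) =
      Real.exp (|(e : ℝ)| * (R * Real.log a + S * Real.log b)) *
      (((t.1 : ℝ) * y + t.2 * x) ^ k *
        Real.exp (e * Real.log a / y * ((t.1 : ℝ) * y + t.2 * x))) *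
      Real.exp (-(e * t.2 * (x * Real.log a - y * Real.log b) / y)) := by
  have ha' : (0 : ℝ) < a := by positivity
  have hb' : (0 : ℝ) < b := by positivity
  have hy' : (y : ℝ) ≠ 0 := by positivity
  rw [interpEntry_eq_zpow ha hb h1 h2, ← zpow_mul, ← zpow_mul]
  simp only [← Real.rpow_intCast, Real.rpow_def_of_pos ha', Real.rpow_def_of_pos hb']
  have : ∀ u v w z Z : ℝ, Z * (Real.exp u * Real.exp v) * (Real.exp w * Real.exp z) =
      Z * Real.exp (u + v + w + z) := by
    intro u v w z Z
    rw [Real.exp_add, Real.exp_add, Real.exp_add]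
    ring
  rw [this]
  have : ∀ u v w Z : ℝ, Real.exp u * (Z * Real.exp v) * Real.exp w = Z * Real.exp (u + v + w) := by
    intro u v w Z
    rw [Real.exp_add, Real.exp_add]
    ring
  rw [this]
  congr 2
  push_cast
  field_simp
  ring

theorem linearIndependent_interpEntry {a b x y K L R S : ℕ} (ha : 2 ≤ a) (hb : 2 ≤ b)
    (hxy : Nat.Coprime x y) (hLR : L ≤ R) (hS : 2 * S < y)
    (hcard : (K - 1) * (2 * L + 1) < (2 * (R - L) + 1) * (2 * S + 1)) :
    LinearIndependent ℝ (Matrix.of fun (i : Fin K × Fin (2 * L + 1))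
      (t : ↥(Finset.Icc (-(R : ℤ)) R ×ˢ Finset.Icc (-(S : ℤ)) S)) =>
        (interpEntry a b x y R S i.1 ((i.2 : ℤ) - L) t : ℝ)).row := by
  have ha' : (1 : ℝ) < a := by exact_mod_cast ha
  have hb' : (1 : ℝ) < b := by exact_mod_cast hb
  have ha0 : (0 : ℝ) < a := by linarith
  have hb0 : (0 : ℝ) < b := by linarith
  rw [Fintype.linearIndependent_iff]
  intro g hg
  let e : Fin (2 * L + 1) → ℤ := fun l => (l : ℤ) - L
  let q : Fin (2 * L + 1) → ℝ := fun l => (a : ℝ) ^ (|e l| * R) * (b : ℝ) ^ (|e l| * S)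
  have hq : ∀ l, q l ≠ 0 := fun l => by positivity
  have key := eq_zero_of_vanish_on_box
    (fun l => ∑ k : Fin K, Polynomial.C (g (k, l) * q l) * Polynomial.X ^ (k : ℕ)) (K - 1)
    (fun l => Polynomial.natDegree_sum_le_of_forall_le _ _ fun k _ =>
      (Polynomial.natDegree_C_mul_X_pow_le _ _).trans (by omega))
    (fun l => (a : ℝ) ^ e l) (fun l => (b : ℝ) ^ e l)
    (fun l m h => by
      have := zpow_right_injective₀ ha0 ha'.ne' h
      simp only [e] at this
      exact Fin.ext (by omega))
    (fun l => by positivity) (fun l => by positivity) x y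
    (Finset.Icc (-(R : ℤ)) (R - 2 * L) ×ˢ Finset.Icc (-(S : ℤ)) S) ?_ ?_ ?_
  · rintro ⟨k, l⟩
    have h := congrArg (fun p => p.coeff (k : ℕ)) (key l)
    simp only [Polynomial.finsetSum_coeff, Polynomial.coeff_C_mul, Polynomial.coeff_X_pow,
      Polynomial.coeff_zero] at h
    rw [Finset.sum_eq_single k (fun j _ hj => by
      rw [if_neg (fun h => hj (Fin.ext h.symm)), mul_zero]) (by simp)] at h
    simpa [hq l] using h
  · rintro ⟨r, s⟩ h1 ⟨r', s'⟩ h2 h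
    simp only [Finset.coe_product, Set.mem_prod, Finset.mem_coe, Finset.mem_Icc] at h1 h2
    have h' : r * y + s * x = r' * y + s' * x := by
      simp only at h
      exact_mod_cast h
    have hdvd : (y : ℤ) ∣ (s - s') * x := ⟨r' - r, by linarith⟩
    have hdvd' : (y : ℤ) ∣ s - s' :=
      IsCoprime.dvd_of_dvd_mul_right (Nat.isCoprime_iff_coprime.2 hxy.symm) hdvd
    have hs : s - s' = 0 := Int.eq_zero_of_abs_lt_dvd hdvd' (by rw [abs_lt]; constructor <;> omega)
    have hs' : s = s' := by omega
    subst hs'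
    have : r * y = r' * (y : ℤ) := by linarith
    have hr : r = r' := mul_right_cancel₀ (by omega) this
    rw [hr]
  · simp only [Finset.card_product, Int.card_Icc, Fintype.card_fin]
    convert hcard using 2 <;> omega
  · rintro ⟨r, s⟩ ht i hi
    simp only [Finset.mem_product, Finset.mem_Icc, Fintype.card_fin] at ht hi
    have hmem : ((r + i : ℤ), s) ∈ Finset.Icc (-(R : ℤ)) R ×ˢ Finset.Icc (-(S : ℤ)) S := by
      simp only [Finset.mem_product, Finset.mem_Icc]
      omega
    have h := congrFun hg ⟨_, hmem⟩
    simp only [Finset.sum_apply, Pi.smul_apply, Matrix.row, Matrix.of_apply, smul_eq_mul,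
      Pi.zero_apply] at h
    rw [Fintype.sum_prod_type_right] at h
    rw [← h]
    refine Finset.sum_congr rfl fun l _ => ?_
    rw [Polynomial.eval_finsetSum, Finset.sum_mul]
    refine Finset.sum_congr rfl fun k _ => ?_
    rw [interpEntry_eq_zpow (by omega) (by omega)
      (by rw [abs_le]; constructor <;> dsimp only <;> omega)
      (by rw [abs_le]; constructor <;> dsimp only <;> omega)]
    simp only [Polynomial.eval_mul, Polynomial.eval_C, Polynomial.eval_pow, Polynomial.eval_X, q, e]
    push_cast
    ring

theorem pow_sum_range_le_of_close {a b x y K L R S : ℕ} {ρ : ℝ} (ha : 2 ≤ a) (hb : 2 ≤ b)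
    (hxy : Nat.Coprime x y) (hLR : L ≤ R) (hS : 2 * S < y)
    (hcard : (K - 1) * (2 * L + 1) < (2 * (R - L) + 1) * (2 * S + 1)) (hρ : 1 ≤ ρ)
    (hΛ : 0 ≤ x * Real.log a - y * Real.log b)
    (hclose : ρ ^ (K * (2 * L + 1)) * (2 * (L * S * (x * Real.log a - y * Real.log b))) ≤ y) :
    ρ ^ (∑ i ∈ Finset.range (K * (2 * L + 1)), i) ≤ (K * (2 * L + 1)).factorial *
      ∏ i : Fin K × Fin (2 * L + 1),
        (2 * (Real.exp (|((i.2 : ℕ) : ℝ) - L| * (R * Real.log a + S * Real.log b)) *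
        ((ρ * (R * y + S * x)) ^ (i.1 : ℕ) *
          Real.exp (|((i.2 : ℕ) : ℝ) - L| * Real.log a / y * (ρ * (R * y + S * x)))))) := by
  have hy : 0 < y := by omega
  have hy' : (0 : ℝ) < y := by exact_mod_cast hy
  obtain ⟨f, hf⟩ := exists_submatrix_det_ne_zero _
    (linearIndependent_interpEntry (K := K) ha hb hxy hLR hS hcard)
  set A := (Matrix.of fun (i : Fin K × Fin (2 * L + 1))
      (t : ↥(Finset.Icc (-(R : ℤ)) R ×ˢ Finset.Icc (-(S : ℤ)) S)) =>
        (interpEntry a b x y R S i.1 ((i.2 : ℤ) - L) t : ℝ)).submatrix id f with hA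
  have hdet : 1 ≤ |A.det| := by
    have : A = (Int.castRingHom ℝ).mapMatrix (Matrix.of fun i j =>
        interpEntry a b x y R S i.1 ((i.2 : ℤ) - L) (f j)) := by
      ext i j
      simp [hA]
    rw [this, ← RingHom.map_det] at hf ⊢
    rw [Int.coe_castRingHom, ← Int.cast_abs]
    rw [Int.coe_castRingHom, Int.cast_ne_zero] at hf
    exact_mod_cast Int.one_le_abs hf
  have hmem : ∀ j, |(f j).1.1| ≤ R ∧ |(f j).1.2| ≤ S := by
    intro j
    have := (f j).2
    simp only [Finset.mem_product, Finset.mem_Icc] at this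
    exact ⟨abs_le.2 this.1, abs_le.2 this.2⟩
  have hmemR : ∀ j, |((f j).1.1 : ℝ)| ≤ R ∧ |((f j).1.2 : ℝ)| ≤ S := by
    intro j
    exact ⟨by exact_mod_cast (hmem j).1, by exact_mod_cast (hmem j).2⟩
  have hloga : 0 ≤ Real.log a := Real.log_natCast_nonneg a
  have hz : ∀ j, |((f j).1.1 : ℝ) * y + (f j).1.2 * x| ≤ R * y + S * x := by
    intro j
    refine (abs_add_le _ _).trans ?_
    rw [abs_mul, abs_mul, abs_of_nonneg hy'.le, abs_of_nonneg (show (0 : ℝ) ≤ x by positivity)]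
    gcongr
    · exact (hmemR j).1
    · exact (hmemR j).2
  have key := abs_det_exp_mul_pow_le A (fun j => ((f j).1.1 : ℝ) * y + (f j).1.2 * x)
    (fun i => i.1) (fun i => (((i.2 : ℕ) : ℝ) - L) * Real.log a / y)
    (fun i => Real.exp (|((i.2 : ℕ) : ℝ) - L| * (R * Real.log a + S * Real.log b)))
    (R * y + S * x) ρ hρ (fun i => by positivity) hz ?_
  · simp only [Fintype.card_prod, Fintype.card_fin, abs_div, abs_mul, abs_of_nonneg hloga,
      abs_of_nonneg hy'.le] at key
    exact (le_mul_of_one_le_left (by positivity) hdet).trans key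
  · intro i j
    simp only [Fintype.card_prod, Fintype.card_fin]
    have hAij : A i j = (interpEntry a b x y R S i.1 ((i.2 : ℤ) - L) (f j) : ℝ) := rfl
    rw [hAij, interpEntry_eq_exp (by omega) (by omega) hy (hmem j).1 (hmem j).2]
    have he : (((i.2 : ℤ) - L : ℤ) : ℝ) = ((i.2 : ℕ) : ℝ) - L := by push_cast; rfl
    rw [he]
    set u := ((i.2 : ℕ) : ℝ) - L with hu
    set G := Real.exp (|u| * (R * Real.log a + S * Real.log b))
    set Z := ((f j).1.1 : ℝ) * y + (f j).1.2 * x with hZ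
    set Λ := x * Real.log a - y * Real.log b with hΛ'
    have huL : |u| ≤ L := by
      have : ((i.2 : ℕ) : ℝ) ≤ 2 * L := by exact_mod_cast Nat.lt_succ_iff.1 i.2.2
      rw [abs_le]
      constructor <;> linarith [(Nat.cast_nonneg (i.2 : ℕ) : (0 : ℝ) ≤ ((i.2 : ℕ) : ℝ))]
    have hτ : |-(u * (f j).1.2 * Λ / y)| ≤ L * S * Λ / y := by
      rw [abs_neg, abs_div, abs_mul, abs_mul, abs_of_nonneg hΛ, abs_of_nonneg hy'.le]
      gcongr
      exact (hmemR j).2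
    have hρN : 1 ≤ ρ ^ (K * (2 * L + 1)) := one_le_pow₀ hρ
    have hsmall : ρ ^ (K * (2 * L + 1)) * (2 * (L * S * Λ / y)) ≤ 1 := by
      rw [show ρ ^ (K * (2 * L + 1)) * (2 * (L * S * Λ / y)) =
        ρ ^ (K * (2 * L + 1)) * (2 * (L * S * Λ)) / y by ring, div_le_one hy']
      exact hclose
    have hnn : 0 ≤ L * S * Λ / y := by positivity
    have hexp : |Real.exp (-(u * (f j).1.2 * Λ / y)) - 1| ≤ 2 * (L * S * Λ / y) := by
      refine (Real.abs_exp_sub_one_le ?_).trans ?_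
      · refine hτ.trans ?_
        nlinarith
      · linarith
    have hZ' : |Z ^ (i.1 : ℕ) * Real.exp (u * Real.log a / y * Z)| ≤
        (ρ * (R * y + S * x)) ^ (i.1 : ℕ) *
          Real.exp (|u * Real.log a / y| * (ρ * (R * y + S * x))) := by
      rw [abs_mul, abs_pow, Real.abs_exp]
      have hle : R * y + S * x ≤ ρ * (R * y + S * x : ℝ) :=
        le_mul_of_one_le_left (by positivity) hρ
      have harg : u * Real.log a / y * Z ≤ |u * Real.log a / y| * (ρ * (R * y + S * x)) := by
        refine (le_abs_self _).trans ?_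
        rw [abs_mul]
        exact mul_le_mul_of_nonneg_left ((hz j).trans hle) (abs_nonneg _)
      exact mul_le_mul (pow_le_pow_left₀ (abs_nonneg _) ((hz j).trans hle) _)
        (Real.exp_le_exp.2 harg) (Real.exp_nonneg _) (by positivity)
    rw [show ∀ X : ℝ, G * X * Real.exp (-(u * (f j).1.2 * Λ / y)) - G * X =
      G * X * (Real.exp (-(u * (f j).1.2 * Λ / y)) - 1) by intro X; ring, abs_mul, abs_mul,
      abs_of_nonneg (Real.exp_nonneg _)]
    calc _ = (ρ ^ (K * (2 * L + 1)) * |Real.exp (-(u * (f j).1.2 * Λ / y)) - 1|) *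
          (G * |Z ^ (i.1 : ℕ) * Real.exp (u * Real.log a / y * Z)|) := by ring
      _ ≤ 1 * (G * |Z ^ (i.1 : ℕ) * Real.exp (u * Real.log a / y * Z)|) := by
          gcongr
          exact (mul_le_mul_of_nonneg_left hexp (by positivity)).trans hsmall
      _ ≤ _ := by
          rw [one_mul]
          gcongr

theorem sum_abs_sub_eq (L : ℕ) :
    ∑ i ∈ Finset.range (2 * L + 1), |(i : ℝ) - L| = L * (L + 1) := by
  induction L with
  | zero => simp
  | succ L ih =>
    rw [show 2 * (L + 1) + 1 = 2 * L + 1 + 1 + 1 by ring, Finset.sum_range_succ,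
      Finset.sum_range_succ']
    have h1 : ∀ i ∈ Finset.range (2 * L + 1),
        |((i + 1 : ℕ) : ℝ) - (L + 1 : ℕ)| = |(i : ℝ) - L| := by
      intro i _
      push_cast
      congr 1
      ring
    rw [Finset.sum_congr rfl h1, ih]
    push_cast
    rw [show (2 * (L : ℝ) + 2 - (L + 1)) = L + 1 by ring,
      abs_of_nonneg (show (0 : ℝ) ≤ L + 1 by positivity),
      zero_sub, abs_neg, abs_of_nonneg (show (0 : ℝ) ≤ L + 1 by positivity)]
    ring

theorem log_interpolation_bound {a b x y K L R S : ℕ} {ρ : ℝ} (ha : 2 ≤ a) (hb : 2 ≤ b)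
    (hxy : Nat.Coprime x y) (hK : 0 < K) (hLR : L ≤ R) (hR : 0 < R) (hS : 2 * S < y)
    (hcard : (K - 1) * (2 * L + 1) < (2 * (R - L) + 1) * (2 * S + 1)) (hρ : 1 ≤ ρ)
    (hΛ : 0 ≤ x * Real.log a - y * Real.log b)
    (hclose : ρ ^ (K * (2 * L + 1)) * (2 * (L * S * (x * Real.log a - y * Real.log b))) ≤ y) :
    Real.log ρ * (((K * (2 * L + 1) : ℕ) : ℝ) - 1) / 2 ≤
      Real.log (2 * ((K * (2 * L + 1) : ℕ) : ℝ)) +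
      ((K : ℝ) - 1) / 2 * Real.log (ρ * (R * y + S * x)) +
      L * (L + 1) / (2 * L + 1) * (R * Real.log a + S * Real.log b +
        Real.log a / y * (ρ * (R * y + S * x))) := by
  have hy : (0 : ℝ) < y := by exact_mod_cast (show 0 < y by omega)
  have hR' : (0 : ℝ) < R := by exact_mod_cast hR
  have hρ0 : 0 < ρ := by linarith
  have hZ : 0 < ρ * (R * y + S * x : ℝ) := by positivity
  have h := Real.log_le_log (by positivity)
    (pow_sum_range_le_of_close (K := K) ha hb hxy hLR hS hcard hρ hΛ hclose)
  set N := K * (2 * L + 1) with hN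
  have hN0 : 0 < N := by positivity
  have hN0' : (0 : ℝ) < N := by exact_mod_cast hN0
  rw [Real.log_pow, Real.log_mul (by positivity) (by positivity), Real.log_prod
    (fun i _ => by positivity)] at h
  have hfact : Real.log (N.factorial) ≤ N * Real.log N := by
    rw [← Real.log_pow]
    exact Real.log_le_log (by positivity) (by exact_mod_cast Nat.factorial_le_pow N)
  have hterm : ∀ i : Fin K × Fin (2 * L + 1),
      Real.log (2 * (Real.exp (|((i.2 : ℕ) : ℝ) - L| * (R * Real.log a + S * Real.log b)) *
        ((ρ * (R * y + S * x)) ^ (i.1 : ℕ) *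
          Real.exp (|((i.2 : ℕ) : ℝ) - L| * Real.log a / y * (ρ * (R * y + S * x)))))) =
      Real.log 2 + ((i.1 : ℕ) : ℝ) * Real.log (ρ * (R * y + S * x)) +
        |((i.2 : ℕ) : ℝ) - L| * (R * Real.log a + S * Real.log b +
        Real.log a / y * (ρ * (R * y + S * x))) := by
    intro i
    rw [Real.log_mul (by norm_num) (by positivity), Real.log_mul (by positivity) (by positivity),
      Real.log_mul (by positivity) (by positivity), Real.log_exp, Real.log_exp, Real.log_pow]
    ring
  have hsumk : ∑ i ∈ Finset.range K, (i : ℝ) = K * ((K : ℝ) - 1) / 2 := by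
    have := Finset.sum_range_id_mul_two K
    have h2 : ((∑ i ∈ Finset.range K, i : ℕ) : ℝ) * 2 = K * ((K : ℝ) - 1) := by
      rw [← Nat.cast_pred hK]
      exact_mod_cast this
    rw [← Nat.cast_sum]
    linarith
  have hsumN : ((∑ i ∈ Finset.range N, i : ℕ) : ℝ) = N * ((N : ℝ) - 1) / 2 := by
    have := Finset.sum_range_id_mul_two N
    have h2 : ((∑ i ∈ Finset.range N, i : ℕ) : ℝ) * 2 = N * ((N : ℝ) - 1) := by
      rw [← Nat.cast_pred hN0]
      exact_mod_cast this
    linarith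
  simp only [hterm] at h
  rw [Fintype.sum_prod_type] at h
  simp only [Finset.sum_add_distrib, ← Finset.sum_mul, Finset.sum_const, Finset.card_univ,
    Fintype.card_fin, nsmul_eq_mul, ← Finset.mul_sum] at h
  rw [Fin.sum_univ_eq_sum_range (fun i => (i : ℝ)), hsumk,
    Fin.sum_univ_eq_sum_range (fun i => |(i : ℝ) - L|), sum_abs_sub_eq, hsumN] at h
  rw [Real.log_mul (by norm_num) hN0'.ne']
  have hM : (N : ℝ) = K * (2 * L + 1) := by rw [hN]; push_cast; ring
  have hL : (0 : ℝ) < 2 * L + 1 := by positivity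
  have hcomb := h.trans (add_le_add_left hfact _)
  refine le_of_mul_le_mul_left ?_ hN0'
  calc _ = N * ((N : ℝ) - 1) / 2 * Real.log ρ := by ring
    _ ≤ _ := hcomb
    _ = _ := by
      push_cast
      rw [hM]
      field_simp
      ring

theorem exp_two_lt : Real.exp 2 < 7.39 := by
  rw [show (2 : ℝ) = 1 + 1 by norm_num, Real.exp_add]
  nlinarith [Real.exp_one_lt_d9, Real.exp_pos 1]

theorem eighty_eight_mul_sq_le_exp {v : ℝ} (hv : 11 ≤ v) : 88 * v ^ 2 ≤ Real.exp v := by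
  have h1 : (2.7 : ℝ) ^ 11 ≤ Real.exp 11 := by
    rw [show (11 : ℝ) = (11 : ℕ) * 1 by norm_num, Real.exp_nat_mul]
    exact pow_le_pow_left₀ (by norm_num) (by linarith [Real.exp_one_gt_d9]) _
  have h2 := Real.quadratic_le_exp_of_nonneg (show 0 ≤ v - 11 by linarith)
  rw [show v = 11 + (v - 11) by ring, Real.exp_add]
  have h3 := mul_le_mul h1 h2 (by nlinarith) (Real.exp_nonneg _)
  norm_num at h3
  nlinarith

theorem interpolation_radius_le_exp {t p q M y R S x Λ : ℝ} (ht : 10 ≤ t) (hp : 0.6931 ≤ p)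
    (hq : 0.6931 ≤ q) (hqt : q ≤ t) (hM : 2 * t + 1 ≤ M) (hy : y = Real.exp t)
    (hR : R ≤ 2.5 * M * q + (M + 1) / 2) (hS : S ≤ 2.5 * M * p + 1)
    (hΛ : x * p = y * q + Λ) (hSΛ : S * Λ ≤ y / 100) :
    Real.exp 2 * (R * y + S * x) ≤ Real.exp M := by
  have hy0 : 0 < y := hy ▸ Real.exp_pos t
  have hp0 : 0 < p := by linarith
  have hM0 : 21 ≤ M := by linarith
  have hSx : S * x ≤ y * (2.5 * M * q + 1.443 * q + 0.02) := by
    refine le_of_mul_le_mul_right ?_ hp0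
    have h1 : S * x * p = S * q * y + S * Λ := by
      rw [mul_assoc, hΛ]
      ring
    have h2 : S * q * y ≤ (2.5 * M * p + 1) * q * y := by gcongr
    have h3 : q * y ≤ q * y * (1.443 * p) := le_mul_of_one_le_right (by positivity) (by linarith)
    have h4 : y / 100 ≤ 0.02 * y * p := by nlinarith
    linarith
  have hZ : R * y + S * x ≤ y * (5.9 * M * q) := by
    have h1 : R * y ≤ (2.5 * M * q + (M + 1) / 2) * y := by gcongr
    have h2 : (M + 1) / 2 + 1.443 * q + 0.02 ≤ 0.9 * (M * q) := by nlinarith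
    have h3 := mul_le_mul_of_nonneg_left h2 hy0.le
    linarith
  have hexp := eighty_eight_mul_sq_le_exp (v := (M + 1) / 2) (by linarith)
  calc Real.exp 2 * (R * y + S * x) ≤ 7.39 * (y * (5.9 * M * q)) := by
        refine (mul_le_mul_of_nonneg_left hZ (Real.exp_nonneg _)).trans ?_
        exact mul_le_mul_of_nonneg_right exp_two_lt.le (by positivity)
    _ ≤ 7.39 * (Real.exp ((M - 1) / 2) * (5.9 * M * ((M - 1) / 2))) := by
        rw [hy]
        gcongr <;> linarith
    _ ≤ Real.exp ((M - 1) / 2) * Real.exp ((M + 1) / 2) := by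
        rw [mul_left_comm]
        refine mul_le_mul_of_nonneg_left (le_trans ?_ hexp) (Real.exp_nonneg _)
        nlinarith
    _ = Real.exp M := by
        rw [← Real.exp_add]
        ring_nf

theorem log_two_mul_le {N V : ℝ} (hN : 0 < N) (hNV : N ≤ 25.1 * V) :
    Real.log (2 * N) ≤ V / 16 + 6 := by
  have hV : 0 < V := by linarith
  have h1 : Real.log (2 * N) ≤ Real.log (804 * (V / 16)) :=
    Real.log_le_log (by positivity) (by linarith)
  rw [Real.log_mul (x := 804) (by norm_num) (by positivity)] at h1
  have h2 := Real.log_le_sub_one_of_pos (show 0 < V / 16 by positivity)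
  have h3 : Real.log 804 ≤ 7 := by
    rw [Real.log_le_iff_le_exp (by norm_num), show (7 : ℝ) = (7 : ℕ) * 1 by norm_num,
      Real.exp_nat_mul]
    refine le_trans ?_ (pow_le_pow_left₀ (by norm_num) Real.exp_one_gt_d9.le 7)
    norm_num
  linarith

theorem exponent_term_le {p q M : ℝ} (hp : 0.6931 ≤ p) (hq : 0.6931 ≤ q) (hM : 21 ≤ M)
    (hpq : 15 * M ≤ M * M * (p * q)) :
    M / 4 * (8.39 * (5 * M * (p * q) + p * (M + 1) / 2 + q) + 0.08) ≤
      12.25 * (M * M * (p * q)) := by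
  have hp0 : 0 < p := by linarith
  have hq0 : 0 < q := by linarith
  have h1 := mul_le_mul_of_nonneg_left hq (show 0 ≤ p * (M * M) by positivity)
  have h2 := mul_le_mul_of_nonneg_left hp (show 0 ≤ q * (M * M) by positivity)
  have h3 := mul_le_mul_of_nonneg_left hM (show 0 ≤ p * M by positivity)
  have h4 := mul_le_mul_of_nonneg_left hM (show 0 ≤ q * M by positivity)
  linarith

theorem not_interpolation_bound {t p q L K y R S x Λ : ℝ} (ht : 10 ≤ t) (hp : 0.6931 ≤ p)
    (hq : 0.6931 ≤ q) (hpq : 0.76 ≤ p * q) (hqt : q ≤ t) (hL : t ≤ L) (hy : y = Real.exp t)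
    (hR0 : 0 ≤ R) (hx : 0 ≤ x)
    (hR : R ≤ 2.5 * (2 * L + 1) * q + 1 + L) (hS0 : 0 ≤ S)
    (hS : S ≤ 2.5 * (2 * L + 1) * p + 1)
    (hK : 25 * (2 * L + 1) * (p * q) ≤ K) (hK' : K ≤ 25 * (2 * L + 1) * (p * q) + 1)
    (hΛ : x * p = y * q + Λ) (hΛ0 : 0 ≤ Λ) (hSΛ : S * Λ ≤ y / 100) :
    Real.log (2 * (K * (2 * L + 1))) + (K - 1) / 2 * Real.log (Real.exp 2 * (R * y + S * x)) +
      L * (L + 1) / (2 * L + 1) * (R * p + S * q + p / y * (Real.exp 2 * (R * y + S * x))) <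
      2 * (K * (2 * L + 1) - 1) / 2 := by
  have hy0 : 0 < y := hy ▸ Real.exp_pos t
  obtain ⟨M, hM⟩ : ∃ M, M = 2 * L + 1 := ⟨_, rfl⟩
  rw [← hM] at hR hS hK hK' ⊢
  have hM0 : 21 ≤ M := by linarith
  have hp0 : 0 < p := by linarith
  have hq0 : 0 < q := by linarith
  have hMpq : 0.76 * M ≤ M * (p * q) := by nlinarith
  have hK1 : 1 ≤ K := by nlinarith
  have hK0 : 0 < K := by linarith
  have h0 : Real.log (Real.exp 2 * (R * y + S * x)) ≤ M := by
    have hle := interpolation_radius_le_exp (R := R) ht hp hq hqt (by linarith) hy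
      (by linarith) hS hΛ hSΛ
    by_cases hz : 0 < R * y + S * x
    · exact (Real.log_le_iff_le_exp (by positivity)).2 hle
    · have : R * y + S * x = 0 := le_antisymm (not_lt.1 hz) (by positivity)
      rw [this, mul_zero, Real.log_zero]
      linarith
  have h1 : (K - 1) / 2 * Real.log (Real.exp 2 * (R * y + S * x)) ≤ (K - 1) / 2 * M :=
    mul_le_mul_of_nonneg_left h0 (by linarith)
  obtain ⟨V, hV⟩ : ∃ V, V = M * M * (p * q) := ⟨_, rfl⟩
  have hMV : 15 * M ≤ V := by
    have := mul_le_mul_of_nonneg_left hMpq (show 0 ≤ M by linarith)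
    have := mul_le_mul_of_nonneg_right hM0 (show 0 ≤ M by linarith)
    linarith
  have h2 : R * p + S * q + p / y * (Real.exp 2 * (R * y + S * x)) ≤
      8.39 * (5 * M * (p * q) + p * (M + 1) / 2 + q) + 0.08 := by
    have e1 : p / y * (Real.exp 2 * (R * y + S * x)) =
        Real.exp 2 * (R * p + S * q + S * Λ / y) := by
      have : p * (R * y + S * x) = (R * p + S * q) * y + S * Λ := by linear_combination S * hΛ
      calc _ = Real.exp 2 * (p * (R * y + S * x)) / y := by ring
        _ = _ := by
          rw [this]
          field_simp
    have e2 : S * Λ / y ≤ 1 / 100 := by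
      rw [div_le_iff₀ hy0]
      linarith
    have e3 : R * p + S * q ≤ 5 * M * (p * q) + p * (M + 1) / 2 + q := by
      have h1 := mul_le_mul_of_nonneg_right hR hp0.le
      have h2 := mul_le_mul_of_nonneg_right hS hq0.le
      have hL' : L = (M - 1) / 2 := by rw [hM]; ring
      rw [hL'] at h1
      linarith
    have e4 : Real.exp 2 * (R * p + S * q + S * Λ / y) ≤
        7.39 * (5 * M * (p * q) + p * (M + 1) / 2 + q + 1 / 100) :=
      mul_le_mul exp_two_lt.le (by linarith) (by positivity) (by norm_num)
    rw [e1]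
    linarith
  have h3 : L * (L + 1) / M ≤ M / 4 := by
    rw [div_le_iff₀ (by linarith), hM]
    nlinarith
  have h4 : L * (L + 1) / M * (R * p + S * q + p / y * (Real.exp 2 * (R * y + S * x))) ≤
      12.25 * V := by
    have hL0 : 0 ≤ L := by linarith
    refine (mul_le_mul h3 h2 (by positivity) (by linarith)).trans ?_
    exact hV ▸ exponent_term_le hp hq hM0 (hV ▸ hMV)
  have hKM : 25 * V ≤ K * M := by
    have := mul_le_mul_of_nonneg_right hK (show 0 ≤ M by linarith)
    rw [hV]
    linarith
  have hKM' : K * M ≤ 25.1 * V := by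
    have := mul_le_mul_of_nonneg_right hK' (show 0 ≤ M by linarith)
    linarith
  have h5 := log_two_mul_le (show 0 < K * M by positivity) hKM'
  linarith

theorem pow_four_le_two_pow {n : ℕ} (hn : 16 ≤ n) : n ^ 4 ≤ 2 ^ n := by
  induction n, hn using Nat.le_induction with
  | base => norm_num
  | succ n hn ih =>
    rw [pow_succ 2]
    refine le_trans ?_ (Nat.mul_le_mul_right 2 ih)
    have h : 16 * (n + 1) ≤ 17 * n := by omega
    have h2 := Nat.pow_le_pow_left h 4
    rw [mul_pow, mul_pow] at h2
    have : 0 < n ^ 4 := by positivity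
    omega

theorem coprime_exponents_of_close {a b x y r : ℕ} (hb : 2 ≤ b) (h : a ^ x = b ^ y + r)
    (hr : 0 < r) (hry : r < y ^ 2) (hy : 16 ≤ y) : Nat.Coprime x y := by
  by_contra hc
  obtain ⟨l, hl, ⟨x', rfl⟩, ⟨y', rfl⟩⟩ := Nat.Prime.not_coprime_iff_dvd.1 hc
  rw [mul_comm l x', mul_comm l y', pow_mul, pow_mul] at h
  have hlt : b ^ y' < a ^ x' := lt_of_pow_lt_pow_left₀ l (by positivity) (by omega)
  obtain ⟨m, rfl⟩ : ∃ m, l = m + 1 := ⟨l - 1, by have := hl.two_le; omega⟩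
  have hm : 1 ≤ m := by have := hl.two_le; omega
  have h1 : (b ^ y') ^ m ≤ r := by
    have h2 : (b ^ y') ^ m * (b ^ y' + 1) ≤ (a ^ x') ^ m * a ^ x' :=
      Nat.mul_le_mul (Nat.pow_le_pow_left hlt.le m) hlt
    rw [← pow_succ, h, mul_add, ← pow_succ] at h2
    omega
  have h3 : 2 ^ ((m + 1) * y') ≤ r ^ 2 := by
    calc 2 ^ ((m + 1) * y') ≤ b ^ ((m + 1) * y') := Nat.pow_le_pow_left hb _
      _ ≤ b ^ (y' * m * 2) := Nat.pow_le_pow_right (by omega) (by nlinarith)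
      _ = ((b ^ y') ^ m) ^ 2 := by rw [pow_mul, pow_mul]
      _ ≤ r ^ 2 := Nat.pow_le_pow_left h1 2
  have h4 := pow_four_le_two_pow hy
  have h5 := Nat.pow_lt_pow_left hry (n := 2) (by norm_num)
  rw [← pow_mul, show 2 * 2 = 4 from rfl] at h5
  omega

theorem exp_mul_le_of_close {t p q L M K S y Λ N : ℝ} (ht : 10 ≤ t) (hp : 0.6931 ≤ p)
    (hq : 0.6931 ≤ q) (hpq : 0.76 ≤ p * q) (hL : t ≤ L) (hM : M = 2 * L + 1)
    (hS0 : 0 ≤ S) (hS : S ≤ 2.5 * M * p + 1) (hy : y = Real.exp t)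
    (hK : K ≤ 25 * M * (p * q) + 1) (hyM : 52 * (M * M) * p ≤ y) (hΛ0 : 0 ≤ Λ)
    (hΛ : Λ ≤ y * y * Real.exp (-(y * q))) (hN : N = K * M) :
    Real.exp (2 * N) * (2 * (L * S * Λ)) ≤ y := by
  have hM0 : 21 ≤ M := by linarith
  have hp0 : 0 < p := by linarith
  have hq0 : 0 < q := by linarith
  have hL0 : 0 < L := by linarith
  have hy0 : 0 ≤ y := hy ▸ Real.exp_nonneg t
  have hMp : 1 ≤ M * p := by nlinarith
  have h1 : 2 * (L * S) ≤ y := by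
    calc 2 * (L * S) ≤ M * (2.5 * M * p + 1) := by
          rw [← mul_assoc]
          exact mul_le_mul (by linarith) hS hS0 (by linarith)
      _ ≤ 52 * (M * M) * p := by nlinarith
      _ ≤ y := hyM
  have hNle : 2 * N ≤ 50 * (M * M * (p * q)) + 2 * M := by
    rw [hN]
    nlinarith
  have hyq : 52 * (M * M * (p * q)) ≤ y * q := by
    have := mul_le_mul_of_nonneg_right hyM hq0.le
    linarith
  have hMM : 15 * M ≤ M * M * (p * q) := by
    have := mul_le_mul_of_nonneg_left hpq (show 0 ≤ M * M by positivity)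
    nlinarith
  have hexp : 2 * N + 2 * t - y * q ≤ 0 := by linarith
  have hyy : y * y = Real.exp (2 * t) := by
    rw [hy, ← Real.exp_add]
    ring_nf
  calc Real.exp (2 * N) * (2 * (L * S * Λ)) = 2 * (L * S) * (Real.exp (2 * N) * Λ) := by ring
    _ ≤ y * (Real.exp (2 * N) * (Real.exp (2 * t) * Real.exp (-(y * q)))) := by
        rw [← hyy]
        exact mul_le_mul h1 (mul_le_mul_of_nonneg_left hΛ (Real.exp_nonneg _)) (by positivity) hy0
    _ = y * Real.exp (2 * N + 2 * t - y * q) := by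
        rw [← Real.exp_add, ← Real.exp_add]
        ring_nf
    _ ≤ y * 1 := by
        exact mul_le_mul_of_nonneg_left (Real.exp_le_one_iff.2 hexp) hy0
    _ = y := mul_one y

theorem le_log_of_two_le {n : ℕ} (hn : 2 ≤ n) : 0.6931 ≤ Real.log n := by
  have := Real.log_le_log (by norm_num) (show (2 : ℝ) ≤ n by exact_mod_cast hn)
  linarith [Real.log_two_gt_d9]

theorem le_log_of_three_le {n : ℕ} (hn : 3 ≤ n) : 1.0973 ≤ Real.log n := by
  have h1 : Real.log (2 ^ 19) ≤ Real.log ((3 : ℝ) ^ 12) :=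
    Real.log_le_log (by norm_num) (by norm_num)
  rw [Real.log_pow, Real.log_pow] at h1
  push_cast at h1
  have h2 := Real.log_le_log (by norm_num) (show (3 : ℝ) ≤ n by exact_mod_cast hn)
  linarith [Real.log_two_gt_d9]

theorem le_log_mul_log {a b : ℕ} (ha : 2 ≤ a) (hb : 2 ≤ b) (hab : Nat.Coprime a b) :
    0.76 ≤ Real.log a * Real.log b := by
  rcases Nat.lt_or_ge a 3 with h3 | h3
  · have hb3 : 3 ≤ b := by
      by_contra hb3
      obtain rfl : a = 2 := by omega
      obtain rfl : b = 2 := by omega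
      norm_num at hab
    have := mul_le_mul (le_log_of_two_le ha) (le_log_of_three_le hb3) (by norm_num)
      (Real.log_natCast_nonneg a)
    linarith
  · have := mul_le_mul (le_log_of_three_le h3) (le_log_of_two_le hb) (by norm_num)
      (Real.log_natCast_nonneg a)
    linarith

theorem linear_form_bounds {a b x y r : ℕ} (ha : 0 < a) (hb : 0 < b) (h : a ^ x = b ^ y + r)
    (hry : r < y ^ 2) : 0 ≤ x * Real.log a - y * Real.log b ∧
      x * Real.log a - y * Real.log b ≤ y * y * Real.exp (-(y * Real.log b)) := by
  have hby0 : (0 : ℝ) < (b : ℝ) ^ y := by positivity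
  have hfrac : 0 ≤ r / (b : ℝ) ^ y := by positivity
  have hlog : x * Real.log a - y * Real.log b = Real.log (1 + r / (b : ℝ) ^ y) := by
    have h1 : (1 + r / (b : ℝ) ^ y) = (a : ℝ) ^ x / (b : ℝ) ^ y := by
      rw [eq_div_iff hby0.ne', add_mul, div_mul_cancel₀ _ hby0.ne', one_mul]
      exact_mod_cast h.symm
    rw [h1, Real.log_div (by positivity) (by positivity), Real.log_pow, Real.log_pow]
  rw [hlog]
  refine ⟨Real.log_nonneg (by linarith), ?_⟩
  have h1 := Real.log_le_sub_one_of_pos (show 0 < 1 + r / (b : ℝ) ^ y by linarith)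
  rw [Real.exp_neg, ← Real.log_pow, Real.exp_log hby0, ← div_eq_mul_inv]
  refine h1.trans ?_
  rw [add_sub_cancel_left]
  gcongr
  rw [← sq]
  exact_mod_cast hry.le

theorem mul_le_of_exp_mul_le {L S Λ N y : ℝ} (hL : 10 ≤ L) (hN : 10 ≤ N) (hSΛ : 0 ≤ S * Λ)
    (h : Real.exp (2 * N) * (2 * (L * S * Λ)) ≤ y) : S * Λ ≤ y / 100 := by
  have h1 : 7 ≤ Real.exp (2 * N) := by linarith [Real.add_one_le_exp (2 * N)]
  have h3 : 10 * (S * Λ) ≤ L * (S * Λ) := mul_le_mul_of_nonneg_right hL hSΛ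
  have h4 : 7 * (2 * (10 * (S * Λ))) ≤ Real.exp (2 * N) * (2 * (L * S * Λ)) := by
    rw [mul_assoc L]
    exact mul_le_mul h1 (by linarith) (by positivity) (Real.exp_nonneg _)
  linarith

theorem not_close_powers {a b x y r : ℕ} (ha : 2 ≤ a) (hb : 2 ≤ b) (hab : Nat.Coprime a b)
    (h : a ^ x = b ^ y + r) (hr : 0 < r) (hry : r < y ^ 2) (hby : b ≤ y)
    (ht : 10 ≤ Real.log y) (hya : 52 * (2 * Real.log y + 3) ^ 2 * Real.log a ≤ y) : False := by
  have hy0 : (0 : ℝ) < y := by exact_mod_cast (show 0 < y by omega)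
  obtain ⟨t, htdef⟩ : ∃ t, t = Real.log y := ⟨_, rfl⟩
  obtain ⟨p, hpdef⟩ : ∃ p, p = Real.log a := ⟨_, rfl⟩
  obtain ⟨q, hqdef⟩ : ∃ q, q = Real.log b := ⟨_, rfl⟩
  have hyt : (y : ℝ) = Real.exp t := by rw [htdef, Real.exp_log hy0]
  have hp : 0.6931 ≤ p := hpdef ▸ le_log_of_two_le ha
  have hq : 0.6931 ≤ q := hqdef ▸ le_log_of_two_le hb
  have hpq : 0.76 ≤ p * q := hpdef ▸ hqdef ▸ le_log_mul_log ha hb hab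
  have hqt : q ≤ t := by
    rw [hqdef, htdef]
    exact Real.log_le_log (by positivity) (by exact_mod_cast hby)
  rw [← htdef] at ht hya
  rw [← hpdef] at hya
  set L := ⌈t⌉₊ with hL
  have hL1 : t ≤ L := Nat.le_ceil t
  have hL2 : (L : ℝ) ≤ t + 1 := (Nat.ceil_lt_add_one (by linarith)).le
  obtain ⟨M, hM⟩ : ∃ M : ℝ, M = 2 * L + 1 := ⟨_, rfl⟩
  have hM0 : 21 ≤ M := by linarith
  have hp0 : 0 < p := by linarith
  have hq0 : 0 < q := by linarith
  have hyM : 52 * (M * M) * p ≤ y := by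
    refine le_trans ?_ hya
    have h1 : M * M ≤ (2 * t + 3) ^ 2 := by
      rw [sq]
      exact mul_self_le_mul_self (by linarith) (by linarith)
    exact mul_le_mul_of_nonneg_right (by linarith) hp0.le
  set S := ⌈2.5 * M * p⌉₊ with hS
  have hS1 : 2.5 * M * p ≤ S := Nat.le_ceil _
  have hS2 : (S : ℝ) ≤ 2.5 * M * p + 1 := (Nat.ceil_lt_add_one (by positivity)).le
  set T := ⌈2.5 * M * q⌉₊ with hT
  have hT1 : 2.5 * M * q ≤ T := Nat.le_ceil _
  have hT2 : (T : ℝ) ≤ 2.5 * M * q + 1 := (Nat.ceil_lt_add_one (by positivity)).le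
  set k := ⌊25 * M * (p * q)⌋₊ with hk
  have hk1 : (k : ℝ) ≤ 25 * M * (p * q) := Nat.floor_le (by positivity)
  have hk2 : 25 * M * (p * q) < k + 1 := Nat.lt_floor_add_one _
  obtain ⟨Λ, hΛ⟩ : ∃ Λ, Λ = x * p - y * q := ⟨_, rfl⟩
  obtain ⟨hΛ0, hΛ1⟩ := linear_form_bounds (by omega) (by omega) h hry
  rw [← hpdef, ← hqdef, ← hΛ] at hΛ0 hΛ1
  have hN : ((((k + 1) * (2 * L + 1) : ℕ)) : ℝ) = ((k : ℝ) + 1) * M := by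
    rw [hM]; push_cast; ring
  have hclose := exp_mul_le_of_close ht hp hq hpq hL1 hM (Nat.cast_nonneg S) hS2 hyt
    (show ((k : ℝ) + 1) ≤ 25 * M * (p * q) + 1 by linarith) hyM hΛ0 hΛ1 rfl
  have hSΛ := mul_le_of_exp_mul_le (L := L) (S := S) (by linarith)
    (show 10 ≤ ((k : ℝ) + 1) * M by nlinarith [(Nat.cast_nonneg k : (0 : ℝ) ≤ k)])
    (by positivity) hclose
  have hMp : 21 * 0.6931 ≤ M * p := mul_le_mul hM0 hp (by norm_num) (by linarith)
  have hMMp : 21 * (M * p) ≤ M * (M * p) := mul_le_mul_of_nonneg_right hM0 (by positivity)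
  have hy16 : 16 ≤ y := by
    have : (16 : ℝ) ≤ y := by linarith
    exact_mod_cast this
  have h2S : 2 * S < y := by
    have : 2 * (S : ℝ) < y := by linarith
    exact_mod_cast this
  have hcard : (k + 1 - 1) * (2 * L + 1) < (2 * (T + L - L) + 1) * (2 * S + 1) := by
    rw [Nat.add_sub_cancel, Nat.add_sub_cancel]
    have : (k : ℝ) * M < (2 * T + 1) * (2 * S + 1) := by
      calc (k : ℝ) * M ≤ 25 * M * (p * q) * M := by gcongr
        _ = (2 * (2.5 * M * q)) * (2 * (2.5 * M * p)) := by ring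
        _ ≤ (2 * T) * (2 * S) := by gcongr
        _ < (2 * T + 1) * (2 * S + 1) := by
          nlinarith [(Nat.cast_nonneg S : (0 : ℝ) ≤ S), (Nat.cast_nonneg T : (0 : ℝ) ≤ T)]
    rw [hM] at this
    exact_mod_cast this
  have hL0 : 0 < L := Nat.ceil_pos.2 (by linarith)
  have hρN : Real.exp 2 ^ ((k + 1) * (2 * L + 1)) = Real.exp (2 * (((k : ℝ) + 1) * M)) := by
    rw [← Real.exp_nat_mul, hN, mul_comm]
  have hbound := log_interpolation_bound (K := k + 1) (L := L) (R := T + L) (S := S)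
    (ρ := Real.exp 2) ha hb (coprime_exponents_of_close hb h hr hry hy16) (Nat.succ_pos k)
    (Nat.le_add_left L T) (by omega) h2S hcard (Real.one_le_exp (by norm_num))
    (by rw [← hpdef, ← hqdef, ← hΛ]; exact hΛ0)
    (by rw [← hpdef, ← hqdef, ← hΛ, hρN]; exact hclose)
  refine hbound.not_gt ?_
  rw [Real.log_exp, ← hpdef, ← hqdef]
  rw [hM] at hS2 hT2 hk1 hk2
  have := not_interpolation_bound (t := t) (p := p) (q := q) (L := L) (K := k + 1) (y := y)
    (R := T + L) (S := S) (x := x) (Λ := Λ) ht hp hq hpq hqt hL1 hyt (by positivity)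
    (by positivity) (by linarith) (by positivity) hS2 hk2.le (by linarith) (by linarith) hΛ0 hSΛ
  push_cast
  exact this

theorem pow_dvd_mul_of_pow_dvd_pow_sub_one {a B m : ℕ} (k : ℕ) (hB : 1 ≤ B)
    (hrad : ∀ p, p.Prime → p ∣ a → p ∣ B - 1) (hfour : 2 ∣ a → 4 ∣ B - 1)
    (h : a ^ k ∣ B ^ m - 1) : a ^ k ∣ (B - 1) * m := by
  rw [Nat.dvd_iff_prime_pow_dvd_dvd]
  intro p j hp hj
  rcases Nat.eq_zero_or_pos j with rfl | hj0
  · simp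
  have hpa : p ∣ a := hp.dvd_of_dvd_pow ((dvd_pow_self p hj0.ne').trans hj)
  have hpB := hrad p hp hpa
  have hcast : ((B - 1 : ℕ) : ℤ) = (B : ℤ) - 1 := by push_cast [hB]; ring
  have hpB' : (p : ℤ) ∣ (B : ℤ) - 1 := by
    rw [← hcast]
    exact_mod_cast hpB
  have hnp : ¬ (p : ℤ) ∣ (B : ℤ) := by
    intro hd
    have := (Nat.prime_iff_prime_int.1 hp).not_isUnit
    exact this (isUnit_of_dvd_one (by simpa using dvd_sub hd hpB'))
  have hval : emultiplicity (p : ℤ) ((B : ℤ) ^ m - 1 ^ m) =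
      emultiplicity (p : ℤ) ((B : ℤ) - 1) + emultiplicity (p : ℤ) (m : ℤ) := by
    rcases hp.eq_two_or_odd' with rfl | hodd
    · exact Int.two_pow_sub_pow' m (by rw [← hcast]; exact_mod_cast hfour hpa) hnp
    · rw [Int.emultiplicity_pow_sub_pow hp hodd hpB' hnp, Int.natCast_emultiplicity]
  have h1 : (p : ℤ) ^ j ∣ (B : ℤ) ^ m - 1 ^ m := by
    have h2 : ((B ^ m - 1 : ℕ) : ℤ) = (B : ℤ) ^ m - 1 ^ m := by
      push_cast [Nat.one_le_pow m B hB]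
      ring
    rw [← h2]
    exact_mod_cast hj.trans h
  rw [pow_dvd_iff_le_emultiplicity, hval,
    ← emultiplicity_mul (Nat.prime_iff_prime_int.1 hp), ← pow_dvd_iff_le_emultiplicity,
    ← hcast] at h1
  exact_mod_cast h1

theorem pow_dvd_pow_sub_one_of_two_solutions {a b r x₁ y₁ x₂ y₂ : ℕ} (hab : Nat.Coprime a b)
    (h₁ : a ^ x₁ = b ^ y₁ + r) (h₂ : a ^ x₂ = b ^ y₂ + r) (hx : x₁ ≤ x₂) (hy : y₁ ≤ y₂) :
    a ^ x₁ ∣ b ^ (y₂ - y₁) - 1 := by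
  have h : b ^ y₁ * (b ^ (y₂ - y₁) - 1) = a ^ x₁ * (a ^ (x₂ - x₁) - 1) := by
    rw [Nat.mul_sub, Nat.mul_sub, ← pow_add, ← pow_add, Nat.add_sub_cancel' hx,
      Nat.add_sub_cancel' hy]
    omega
  exact Nat.Coprime.dvd_of_dvd_mul_left (Nat.Coprime.pow x₁ y₁ hab) ⟨_, h⟩

theorem four_dvd_sq_sub_one {n : ℕ} (hn : Odd n) : 4 ∣ n ^ 2 - 1 := by
  obtain ⟨m, rfl⟩ := hn
  exact ⟨m * (m + 1), by rw [Nat.sub_eq_of_eq_add]; ring⟩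

theorem pow_le_of_dvd_pow_sub_one {a b m k : ℕ} (ha : 3 ≤ a) (hb : 2 ≤ b)
    (hab : Nat.Coprime a b) (hm : 0 < m) (h : a ^ k ∣ b ^ m - 1) :
    a ^ k ≤ (b ^ a.totient - 1) * m := by
  have hφ : 0 < a.totient := Nat.totient_pos.2 (by omega)
  have hB : 1 < b ^ a.totient := Nat.one_lt_pow hφ.ne' hb
  have haB : a ∣ b ^ a.totient - 1 :=
    (Nat.modEq_iff_dvd' hB.le).1 (Nat.ModEq.pow_totient hab.symm).symm
  refine Nat.le_of_dvd (Nat.mul_pos (by omega) hm)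
    (pow_dvd_mul_of_pow_dvd_pow_sub_one k hB.le (fun p _ hp => hp.trans haB) (fun h2 => ?_)
      (h.trans ?_))
  · obtain ⟨s, hs⟩ := (Nat.totient_even (by omega : 2 < a)).two_dvd
    have hbodd : Odd b := Nat.coprime_two_left.1 (hab.coprime_dvd_left h2)
    rw [hs, mul_comm, pow_mul]
    exact four_dvd_sq_sub_one hbodd.pow
  · rw [← pow_mul, mul_comm, pow_mul]
    simpa using Nat.sub_dvd_pow_sub_pow (b ^ m) 1 a.totient

theorem two_pow_le_of_dvd_pow_sub_one {b m k : ℕ} (hb : Odd b) (hb1 : 1 < b) (hm : 0 < m)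
    (h : 2 ^ k ∣ b ^ m - 1) : 2 ^ k ≤ (b + 1) * m := by
  have hp : ∀ n, Odd n → ∀ p, p.Prime → p ∣ 2 → p ∣ n - 1 := by
    intro n hn p hp hp2
    rw [(Nat.prime_dvd_prime_iff_eq hp Nat.prime_two).1 hp2]
    exact (Nat.Odd.sub_odd hn odd_one).two_dvd
  by_cases h4 : 4 ∣ b - 1
  · have := Nat.le_of_dvd (Nat.mul_pos (by omega) hm)
      (pow_dvd_mul_of_pow_dvd_pow_sub_one k hb1.le (hp b hb) (fun _ => h4) h)
    exact this.trans (Nat.mul_le_mul_right m (by omega))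
  have hb4 : b % 4 = 3 := by
    have := Nat.odd_iff.1 hb
    omega
  rcases Nat.lt_or_ge k 2 with hk | hk
  · calc 2 ^ k ≤ 2 ^ 1 := Nat.pow_le_pow_right (by norm_num) (by omega)
      _ ≤ (b + 1) * m := by nlinarith
  have h4m : 4 ∣ b ^ m - 1 := (pow_dvd_pow 2 hk).trans h
  have hbm : 1 ≤ b ^ m := Nat.one_le_pow _ _ (by omega)
  rcases Nat.even_or_odd' m with ⟨s, rfl | rfl⟩
  · have hd := pow_dvd_mul_of_pow_dvd_pow_sub_one (a := 2) (B := b ^ 2) (m := s) k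
      (Nat.one_le_pow _ _ (by omega)) (hp _ hb.pow) (fun _ => four_dvd_sq_sub_one hb)
      (by rwa [← pow_mul])
    obtain ⟨c, hc⟩ : ∃ c, b = 4 * c + 3 := ⟨b / 4, by omega⟩
    have he : (b ^ 2 - 1) * s = (2 * c + 1) * ((b + 1) * (2 * s)) := by
      have : b ^ 2 - 1 = (2 * c + 1) * ((b + 1) * 2) := by
        rw [hc, Nat.sub_eq_of_eq_add]
        ring
      rw [this]
      ring
    rw [he] at hd
    refine Nat.le_of_dvd (Nat.mul_pos (by omega) hm) (Nat.Coprime.dvd_of_dvd_mul_left ?_ hd)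
    exact Nat.Coprime.pow_left k (Nat.coprime_two_left.2 ⟨c, rfl⟩)
  · exfalso
    have : b ^ (2 * s + 1) % 4 = 3 := by
      rw [Nat.pow_mod, hb4, pow_succ, pow_mul, Nat.mul_mod, Nat.pow_mod]
      norm_num
    omega

/-- Whether the Stern-Brocot neighbours `p / q < log b / log a < P / Q` with `Y < q + Q`, reached
from given neighbours, leave a gap large enough to exclude `b ^ y < a ^ x < b ^ y + D * y` for
`60 ≤ y ≤ Y`. -/
def gapCheck (a b D Y : ℕ) : ℕ → ℕ → ℕ → ℕ → ℕ → Bool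
  | 0, _, _, _, _ => false
  | n + 1, p, q, P, Q =>
    bif Nat.blt Y (q + Q) then
      Nat.ble (D * Q * (10 ^ 9 + 1)) (b ^ 60) &&
        Nat.ble (b ^ Q * (10 ^ 9 + 1)) (a ^ P * 10 ^ 9)
    else bif Nat.blt (a ^ (p + P)) (b ^ (q + Q)) then gapCheck a b D Y n (p + P) (q + Q) P Q
    else gapCheck a b D Y n p q (p + P) (q + Q)

/-- The first term exceeding `B` of the sequence `A, a * A, a ^ 2 * A, …`, searched for at most
`n` steps. -/
def firstExceeding (a B : ℕ) : ℕ → ℕ → ℕ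
  | 0, A => A
  | n + 1, A => bif Nat.blt B A then A else firstExceeding a B n (a * A)

/-- Whether `b ^ y < a ^ x < b ^ y + D * y` is impossible, given `b ^ n < (a ^ x - b ^ y) ^ m`,
for the `k` values of `y` from a given one on, where `B = b ^ y`. -/
def smallCheck (a b D m n : ℕ) : ℕ → ℕ → ℕ → ℕ → Bool
  | 0, _, _, _ => true
  | k + 1, y, B, A =>
    (Nat.ble ((D * y) ^ m) (b ^ n) || Nat.ble (B + D * y) (firstExceeding a B 9 A)) &&
      smallCheck a b D m n k (y + 1) (B * b) (firstExceeding a B 9 A)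

/-- The conjunction of `gapCheck` and `smallCheck`, for `1 ≤ y ≤ Y`. -/
def finiteCheck (a b D m n Y : ℕ) : Bool :=
  gapCheck a b D Y 2000 0 1 1 0 && smallCheck a b D m n 59 1 b 1

theorem finiteCheck_two :
    (List.range 154).all (fun i => finiteCheck 2 (2 * i + 3) (2 * i + 4) 4 11 22100) = true := by
  decide +kernel

theorem finiteCheck_three :
    [2, 4, 5, 7, 8, 10, 11].all (fun b => finiteCheck 3 b (b ^ 2) 2 13 100000) = true := by
  decide +kernel

theorem finiteCheck_four : finiteCheck 4 3 (3 ^ 2) 1 11 100000 = true := by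
  decide +kernel

theorem finiteCheck_five : finiteCheck 5 2 (2 ^ 4) 1 15 100000 = true := by
  decide +kernel

theorem firstExceeding_spec {a B : ℕ} (ha : 2 ≤ a) (n : ℕ) {A : ℕ} (hA : ∃ j, A = a ^ j)
    (hle : ∀ x, B < a ^ x → A ≤ a ^ x) :
    (∃ j, firstExceeding a B n A = a ^ j) ∧
      ∀ x, B < a ^ x → firstExceeding a B n A ≤ a ^ x := by
  induction n generalizing A with
  | zero => exact ⟨hA, hle⟩
  | succ n ih =>
    rw [firstExceeding]
    cases h : Nat.blt B A with
    | true => exact ⟨hA, hle⟩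
    | false =>
      obtain ⟨j, rfl⟩ := hA
      have hB : a ^ j ≤ B := by
        by_contra hc
        rw [Nat.blt_eq.mpr (not_le.1 hc)] at h
        contradiction
      refine ih ⟨j + 1, (pow_succ' a j).symm⟩ fun x hx => ?_
      rw [← pow_succ']
      exact Nat.pow_le_pow_right (by omega)
        ((Nat.pow_lt_pow_iff_right (by omega)).1 (hB.trans_lt hx))

theorem le_of_smallCheck {a b D m n : ℕ} (ha : 2 ≤ a) (hb : 0 < b) (k : ℕ) {y A : ℕ}
    (hA : ∃ j, A = a ^ j) (hle : ∀ x, b ^ y < a ^ x → A ≤ a ^ x)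
    (hcheck : smallCheck a b D m n k y (b ^ y) A = true) {z x r : ℕ} (hyz : y ≤ z)
    (hzk : z < y + k) (h : a ^ x = b ^ z + r) (hr : 0 < r) (hlow : b ^ n < r ^ m) :
    D * z ≤ r := by
  induction k generalizing y A with
  | zero => omega
  | succ k ih =>
    rw [smallCheck, Bool.and_eq_true, Bool.or_eq_true, Nat.ble_eq, Nat.ble_eq, ← pow_succ] at hcheck
    obtain ⟨hj, hle'⟩ := firstExceeding_spec (B := b ^ y) ha 9 hA hle
    rcases hyz.eq_or_lt with rfl | hlt
    · rcases hcheck.1 with h1 | h1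
      · exact (lt_of_pow_lt_pow_left₀ m (Nat.zero_le r) (h1.trans_lt hlow)).le
      · have := hle' x (by omega)
        omega
    · refine ih hj (fun w hw => hle' w (lt_of_le_of_lt ?_ hw)) hcheck.2 hlt (by omega)
      exact Nat.pow_le_pow_right hb (Nat.le_succ y)

theorem gapCheck_spec {a b D Y : ℕ} (n : ℕ) {p q P Q : ℕ} (hpq : a ^ p < b ^ q)
    (hdet : P * q = p * Q + 1) (h : gapCheck a b D Y n p q P Q = true) :
    ∃ p q P Q, a ^ p < b ^ q ∧ P * q = p * Q + 1 ∧ Y < q + Q ∧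
      D * Q * (10 ^ 9 + 1) ≤ b ^ 60 ∧ b ^ Q * (10 ^ 9 + 1) ≤ a ^ P * 10 ^ 9 := by
  induction n generalizing p q P Q with
  | zero => simp [gapCheck] at h
  | succ n ih =>
    rw [gapCheck] at h
    cases h1 : Nat.blt Y (q + Q) with
    | true =>
      rw [h1, cond_true, Bool.and_eq_true, Nat.ble_eq, Nat.ble_eq] at h
      exact ⟨p, q, P, Q, hpq, hdet, Nat.blt_eq.mp h1, h.1, h.2⟩
    | false =>
      rw [h1, cond_false] at h
      cases h2 : Nat.blt (a ^ (p + P)) (b ^ (q + Q)) with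
      | true =>
        rw [h2, cond_true] at h
        exact ih (Nat.blt_eq.mp h2) (by linarith) h
      | false =>
        rw [h2, cond_false] at h
        exact ih hpq (by linarith) h

theorem mul_le_mul_of_neighbours {a b p q P Q x y : ℕ} (ha : 2 ≤ a) (hy : 0 < y)
    (hpq : a ^ p < b ^ q) (hdet : P * q = p * Q + 1) (hY : y < q + Q) (h : b ^ y < a ^ x) :
    P * y ≤ x * Q := by
  by_contra! hc
  have h1 : p * y < x * q := by
    rw [← Nat.pow_lt_pow_iff_right (show 1 < a by omega), pow_mul, pow_mul]
    calc (a ^ p) ^ y < (b ^ q) ^ y := Nat.pow_lt_pow_left hpq hy.ne'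
      _ = (b ^ y) ^ q := by rw [← pow_mul, ← pow_mul, mul_comm]
      _ ≤ (a ^ x) ^ q := Nat.pow_le_pow_left h.le q
  obtain ⟨u, hu⟩ := Nat.exists_eq_add_of_lt hc
  obtain ⟨v, hv⟩ := Nat.exists_eq_add_of_lt h1
  have : y = q * (u + 1) + Q * (v + 1) := by nlinarith
  nlinarith

theorem mul_pow_lt_of_gap {a b N P Q x y r : ℕ} (ha : 2 ≤ a) (hb : 2 ≤ b) (hN : 0 < N)
    (hgap : b ^ Q * (N + 1) ≤ a ^ P * N) (hle : P * y ≤ x * Q)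
    (h : a ^ x = b ^ y + r) : y * b ^ y ≤ Q * r * (N + 1) := by
  have ha0 : (0 : ℝ) < a := by exact_mod_cast (show 0 < a by omega)
  have hb0 : (0 : ℝ) < b := by exact_mod_cast (show 0 < b by omega)
  have hN0 : (0 : ℝ) < N := by exact_mod_cast hN
  have hB : (0 : ℝ) < (b : ℝ) ^ y := by positivity
  have hloga : 0 ≤ Real.log a := Real.log_natCast_nonneg a
  have h1 : Q * Real.log b + Real.log (N + 1) ≤ P * Real.log a + Real.log N := by
    rw [← Real.log_pow, ← Real.log_pow, ← Real.log_mul (by positivity) (by positivity),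
      ← Real.log_mul (by positivity) (by positivity)]
    exact Real.log_le_log (by positivity) (by exact_mod_cast hgap)
  have h2 : 1 / ((N : ℝ) + 1) ≤ Real.log (N + 1) - Real.log N := by
    rw [← Real.log_div (by positivity) hN0.ne']
    refine le_trans (le_of_eq ?_) (Real.one_sub_inv_le_log_of_pos (by positivity))
    field_simp
    ring
  have h3 : x * Real.log a - y * Real.log b ≤ r / (b : ℝ) ^ y := by
    rw [← Real.log_pow, ← Real.log_pow, ← Real.log_div (by positivity) (by positivity)]
    refine (Real.log_le_sub_one_of_pos (by positivity)).trans (le_of_eq ?_)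
    have : (a : ℝ) ^ x = (b : ℝ) ^ y + r := by exact_mod_cast h
    rw [this]
    field_simp
    ring
  have h4 : (P : ℝ) * y * Real.log a ≤ x * Q * Real.log a :=
    mul_le_mul_of_nonneg_right (by exact_mod_cast hle) hloga
  have h5 : (y : ℝ) * (1 / ((N : ℝ) + 1)) ≤ Q * (r / (b : ℝ) ^ y) := by
    have e1 := mul_le_mul_of_nonneg_left h1 (Nat.cast_nonneg (α := ℝ) y)
    have e2 := mul_le_mul_of_nonneg_left h2 (Nat.cast_nonneg (α := ℝ) y)
    have e3 := mul_le_mul_of_nonneg_left h3 (Nat.cast_nonneg (α := ℝ) Q)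
    linarith
  rw [mul_one_div, mul_div_assoc', div_le_div_iff₀ (by positivity) hB] at h5
  exact_mod_cast h5

theorem le_of_finiteCheck {a b D m n Y x y r : ℕ} (ha : 2 ≤ a) (hb : 2 ≤ b)
    (hcheck : finiteCheck a b D m n Y = true) (hy : 0 < y) (hyY : y ≤ Y)
    (h : a ^ x = b ^ y + r) (hr : 0 < r) (hlow : b ^ n < r ^ m) : D * y ≤ r := by
  rw [finiteCheck, Bool.and_eq_true] at hcheck
  rcases Nat.lt_or_ge y 60 with h60 | h60
  · refine le_of_smallCheck ha (by omega) 59 ⟨0, (pow_zero a).symm⟩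
      (fun x _ => Nat.one_le_pow x a (by omega)) ?_ (show 1 ≤ y from hy) (by omega) h hr hlow
    rw [pow_one]
    exact hcheck.2
  · obtain ⟨p, q, P, Q, hpq, hdet, hY, hD, hgap⟩ := gapCheck_spec 2000 (by
      rw [pow_zero, pow_one]; omega) (by norm_num) hcheck.1
    have h1 := mul_pow_lt_of_gap ha hb (by norm_num) hgap
      (mul_le_mul_of_neighbours ha hy hpq hdet (by omega) (by omega)) h
    by_contra! hc
    have h2 : D * Q * (10 ^ 9 + 1) ≤ b ^ y :=
      hD.trans (Nat.pow_le_pow_right (by omega) h60)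
    rcases Nat.eq_zero_or_pos Q with rfl | hQ
    · have : 0 < y * b ^ y := by positivity
      omega
    · have h3 : Q * r * (10 ^ 9 + 1) < Q * (D * y) * (10 ^ 9 + 1) := by gcongr
      have h4 : y * (D * Q * (10 ^ 9 + 1)) ≤ y * b ^ y := Nat.mul_le_mul_left y h2
      linarith

theorem log_six_le : Real.log 6 ≤ 1.8 := by
  have h : Real.log ((6 : ℝ) ^ 5) ≤ 9 := by
    rw [Real.log_le_iff_le_exp (by norm_num), show (9 : ℝ) = (9 : ℕ) * 1 by norm_num,
      Real.exp_nat_mul]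
    exact le_trans (by norm_num) (pow_le_pow_left₀ (by norm_num) Real.exp_one_gt_d9.le 9)
  rw [Real.log_pow] at h
  push_cast at h
  linarith

theorem le_log_of_exp_bound {k : ℕ} {z : ℝ} (h : (2.7182818286 : ℝ) ^ k ≤ z) :
    (k : ℝ) ≤ Real.log z := by
  have hz : 0 < z := lt_of_lt_of_le (by positivity) h
  rw [Real.le_log_iff_exp_le hz, ← mul_one (k : ℝ), Real.exp_nat_mul]
  exact (pow_le_pow_left₀ (Real.exp_pos 1).le Real.exp_one_lt_d9.le k).trans h

theorem exp_natCast_mul_le_exp {k : ℕ} {t : ℝ} (ht : k ≤ t) :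
    (2.7182818283 : ℝ) ^ k *
      (1 + (t - k) + (t - k) ^ 2 / 2 + (t - k) ^ 3 / 6) ≤ Real.exp t := by
  have hs : 0 ≤ t - k := sub_nonneg.2 ht
  have h1 := Real.sum_le_exp_of_nonneg hs 4
  have h2 : (2.7182818283 : ℝ) ^ k ≤ Real.exp k := by
    rw [← mul_one (k : ℝ), Real.exp_nat_mul]
    exact pow_le_pow_left₀ (by norm_num) Real.exp_one_gt_d9.le k
  have h3 : Real.exp t = Real.exp k * Real.exp (t - k) := by
    rw [← Real.exp_add]
    congr 1
    ring
  rw [h3]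
  refine mul_le_mul h2 (le_trans (le_of_eq ?_) h1) (by positivity) (Real.exp_pos _).le
  simp [Finset.sum_range_succ, Nat.factorial]

theorem sq_le_exp_of_ten_le {t : ℝ} (ht : 10 ≤ t) :
    52 * (2 * t + 3) ^ 2 * 0.6932 ≤ Real.exp t := by
  refine le_trans ?_ (exp_natCast_mul_le_exp (k := 10) (by exact_mod_cast ht))
  obtain ⟨s, rfl⟩ : ∃ s, t = 10 + s := ⟨t - 10, by ring⟩
  have hs : 0 ≤ s := by linarith
  have : 0 ≤ s ^ 2 := by positivity
  have : 0 ≤ s ^ 3 := by positivity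
  norm_num
  nlinarith

theorem sq_le_exp_of_eleven_le {t : ℝ} (ht : 11 ≤ t) :
    52 * (2 * t + 3) ^ 2 * 1.8 ≤ Real.exp t := by
  refine le_trans ?_ (exp_natCast_mul_le_exp (k := 11) (by exact_mod_cast ht))
  obtain ⟨s, rfl⟩ : ∃ s, t = 11 + s := ⟨t - 11, by ring⟩
  have hs : 0 ≤ s := by linarith
  have : 0 ≤ s ^ 2 := by positivity
  have : 0 ≤ s ^ 3 := by positivity
  norm_num
  nlinarith

theorem cube_le_exp_of_thirteen_le {t : ℝ} (ht : 13 ≤ t) :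
    52 * (2 * t + 3) ^ 2 * (t / 2) ≤ Real.exp t := by
  refine le_trans ?_ (exp_natCast_mul_le_exp (k := 13) (by exact_mod_cast ht))
  obtain ⟨s, rfl⟩ : ∃ s, t = 13 + s := ⟨t - 13, by ring⟩
  have hs : 0 ≤ s := by linarith
  have : 0 ≤ s ^ 2 := by positivity
  have : 0 ≤ s ^ 3 := by positivity
  norm_num
  nlinarith

theorem not_close_powers_of_le_exp {a b x y r : ℕ} {c : ℝ} (ha : 2 ≤ a) (hb : 2 ≤ b)
    (hab : Nat.Coprime a b) (h : a ^ x = b ^ y + r) (hr : 0 < r) (hry : r < y ^ 2) (hby : b ≤ y)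
    (hc : Real.log a ≤ c) (ht : 10 ≤ Real.log y)
    (hexp : 52 * (2 * Real.log y + 3) ^ 2 * c ≤ Real.exp (Real.log y)) : False := by
  have hy0 : (0 : ℝ) < y := by exact_mod_cast (show 0 < y by omega)
  rw [Real.exp_log hy0] at hexp
  exact not_close_powers ha hb hab h hr hry hby ht
    (le_trans (mul_le_mul_of_nonneg_left hc (by positivity)) hexp)

theorem not_close_powers_of_le_six {a b x y r : ℕ} (ha : 2 ≤ a) (ha6 : a ≤ 6) (hb : 2 ≤ b)
    (hab : Nat.Coprime a b) (h : a ^ x = b ^ y + r) (hr : 0 < r) (hry : r < y ^ 2) (hby : b ≤ y)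
    (hy : 100000 ≤ y) : False := by
  have ht : (11 : ℕ) ≤ Real.log y :=
    le_log_of_exp_bound (le_trans (by norm_num) (show (100000 : ℝ) ≤ y by exact_mod_cast hy))
  push_cast at ht
  refine not_close_powers_of_le_exp (c := 1.8) ha hb hab h hr hry hby (le_trans ?_ log_six_le)
    (by linarith) (sq_le_exp_of_eleven_le ht)
  exact Real.log_le_log (by exact_mod_cast (show 0 < a by omega)) (by exact_mod_cast ha6)

theorem pow_lt_pow_of_rpow_lt {b r m n : ℕ} {e : ℝ} (hb : 2 ≤ b) (hm : m ≠ 0)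
    (hbig : (b : ℝ) ^ e < r) (hn : (n : ℝ) ≤ m * e) : b ^ n < r ^ m := by
  have hb1 : (1 : ℝ) ≤ b := by exact_mod_cast (show 1 ≤ b by omega)
  have h1 : (b : ℝ) ^ (n : ℝ) ≤ ((b : ℝ) ^ e) ^ m := by
    rw [← Real.rpow_mul_natCast (by positivity)]
    exact Real.rpow_le_rpow_of_exponent_le hb1 (by linarith)
  rw [Real.rpow_natCast] at h1
  exact_mod_cast h1.trans_lt (pow_lt_pow_left₀ hbig (by positivity) hm)

theorem pow_lt_of_pow_add_lt {b i j y : ℕ} (h : b ^ (i + j) < b ^ i * y) : b ^ j < y := by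
  rw [pow_add] at h
  exact lt_of_mul_lt_mul_left h (Nat.zero_le _)

theorem le_exponent_two {b x y r : ℕ} (hab : Nat.Coprime 2 b) (hb : 2 ≤ b) (hy : 0 < y)
    (hbig : (b : ℝ) ^ (2 * (2 : ℝ) * Real.log 2) < r) (h : 2 ^ x = b ^ y + r) (hr : 0 < r) :
    (b + 1) * y ≤ r := by
  by_contra! hc
  have hlow : b ^ 11 < r ^ 4 := pow_lt_pow_of_rpow_lt hb (by norm_num) hbig (by
    have := Real.log_two_gt_d9
    push_cast
    linarith)
  obtain ⟨i, hi⟩ := Nat.coprime_two_left.1 hab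
  rcases Nat.lt_or_ge y 22100 with hlt | hge
  · refine hc.not_ge ?_
    have hi154 : i - 1 < 154 := by
      by_contra! hi2
      have h311 : 311 ≤ b := by omega
      have h1 : b ^ 11 < ((b + 1) * 22100) ^ 4 :=
        hlow.trans (Nat.pow_lt_pow_left (hc.trans_le (Nat.mul_le_mul_left _ hlt.le)) (by norm_num))
      have h2 : (311 * (b + 1)) ^ 4 ≤ (312 * b) ^ 4 := Nat.pow_le_pow_left (by omega) 4
      have h3 : 311 ^ 7 * b ^ 4 ≤ b ^ 11 := by
        rw [show b ^ 11 = b ^ 7 * b ^ 4 by ring]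
        exact Nat.mul_le_mul_right _ (Nat.pow_le_pow_left h311 7)
      rw [mul_pow] at h1 h2
      rw [mul_pow] at h2
      have : 0 < b ^ 4 := by positivity
      omega
    have hcheck := List.all_eq_true.1 finiteCheck_two (i - 1) (List.mem_range.2 hi154)
    rw [show 2 * (i - 1) + 3 = b by omega, show 2 * (i - 1) + 4 = b + 1 by omega] at hcheck
    exact le_of_finiteCheck le_rfl hb hcheck hy hlt.le h hr hlow
  · have hby : b + 1 ≤ y := by
      by_contra! hyb
      have h1 : r < (b + 1) ^ 2 := by nlinarith
      have h2 := hlow.trans (Nat.pow_lt_pow_left h1 (by norm_num : 4 ≠ 0))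
      have h3 : (100 * (b + 1)) ^ 8 ≤ (101 * b) ^ 8 := Nat.pow_le_pow_left (by omega) 8
      have h4 : 22000 ^ 3 * b ^ 8 ≤ b ^ 11 := by
        rw [show b ^ 11 = b ^ 3 * b ^ 8 by ring]
        exact Nat.mul_le_mul_right _ (Nat.pow_le_pow_left (by omega) 3)
      rw [← pow_mul, show 2 * 4 = 8 by norm_num] at h2
      rw [mul_pow, mul_pow] at h3
      have : 0 < b ^ 8 := by positivity
      omega
    have ht : (10 : ℕ) ≤ Real.log y :=
      le_log_of_exp_bound (le_trans (by norm_num) (show (22100 : ℝ) ≤ y by exact_mod_cast hge))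
    push_cast at ht
    refine not_close_powers_of_le_exp (c := 0.6932) le_rfl hb hab h hr (by nlinarith) (by omega)
      ?_ ht (sq_le_exp_of_ten_le ht)
    have := Real.log_two_lt_d9
    push_cast
    linarith

theorem le_exponent_three {b x y r : ℕ} (hab : Nat.Coprime 3 b) (hb : 2 ≤ b) (hy : 0 < y)
    (hbig : (b : ℝ) ^ (2 * (3 : ℝ) * Real.log 3) < r) (h : 3 ^ x = b ^ y + r) (hr : 0 < r) :
    b ^ 2 * y ≤ r := by
  by_contra! hc
  have hlow : b ^ 13 < r ^ 2 := pow_lt_pow_of_rpow_lt hb (by norm_num) hbig (by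
    have := le_log_of_three_le (le_refl 3)
    push_cast at this ⊢
    linarith)
  have hby : b ^ 9 < y ^ 2 := by
    refine pow_lt_of_pow_add_lt (i := 4) (hlow.trans ?_)
    calc r ^ 2 < (b ^ 2 * y) ^ 2 := Nat.pow_lt_pow_left hc (by norm_num)
      _ = b ^ 4 * y ^ 2 := by ring
  have hb2y : b ^ 2 < y := lt_of_pow_lt_pow_left₀ 2 (Nat.zero_le y) (by
    rw [← pow_mul]
    exact (Nat.pow_le_pow_right (by omega) (by norm_num)).trans_lt hby)
  rcases Nat.lt_or_ge y 100000 with hlt | hge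
  · have hb13 : b < 13 := by
      by_contra! hb13
      have h1 := Nat.pow_le_pow_left hb13 9
      have h2 := Nat.pow_lt_pow_left hlt (by norm_num : 2 ≠ 0)
      omega
    have hmem : b ∈ [2, 4, 5, 7, 8, 10, 11] := by
      clear h hbig hc hlow hby hb2y
      revert hab
      interval_cases b <;> decide
    exact hc.not_ge (le_of_finiteCheck (by norm_num) hb
      (List.all_eq_true.1 finiteCheck_three b hmem) hy hlt.le h hr hlow)
  · exact not_close_powers_of_le_six (by norm_num) (by norm_num) hb hab h hr (by nlinarith)
      (by nlinarith) hge

theorem lt_sq_of_pow_lt {b i j y r : ℕ} (hb : 2 ≤ b) (hij : i ≤ j) (hj : j ≠ 0)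
    (hc : r < b ^ i * y) (hby : b ^ j < y) : r < y ^ 2 ∧ b ≤ y := by
  constructor
  · have : b ^ i ≤ y := (Nat.pow_le_pow_right (by omega) hij).trans hby.le
    nlinarith
  · exact (Nat.le_self_pow hj b).trans hby.le

theorem le_exponent_four {b x y r : ℕ} (hab : Nat.Coprime 4 b) (hb : 2 ≤ b) (hy : 0 < y)
    (hbig : (b : ℝ) ^ (2 * (4 : ℝ) * Real.log 4) < r) (h : 4 ^ x = b ^ y + r) (hr : 0 < r) :
    b ^ 2 * y ≤ r := by
  by_contra! hc
  have hlow : b ^ 11 < r ^ 1 := pow_lt_pow_of_rpow_lt hb (by norm_num) hbig (by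
    rw [show (4 : ℝ) = 2 ^ 2 by norm_num, Real.log_pow]
    have := Real.log_two_gt_d9
    push_cast
    linarith)
  have hby : b ^ 9 < y := pow_lt_of_pow_add_lt (i := 2) (hlow.trans (by rwa [pow_one]))
  rcases Nat.lt_or_ge y 100000 with hlt | hge
  · have hb4 : b < 4 := by
      by_contra! hb4
      have := Nat.pow_le_pow_left hb4 9
      omega
    obtain rfl : b = 3 := by
      obtain rfl | rfl : b = 2 ∨ b = 3 := by omega
      · exact absurd hab (by decide)
      · rfl
    exact hc.not_ge (le_of_finiteCheck (by norm_num) hb finiteCheck_four hy hlt.le h hr hlow)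
  · obtain ⟨h1, h2⟩ := lt_sq_of_pow_lt hb (by norm_num) (by norm_num) hc hby
    exact not_close_powers_of_le_six (by norm_num) (by norm_num) hb hab h hr h1 h2 hge

theorem le_exponent_five {b x y r : ℕ} (hab : Nat.Coprime 5 b) (hb : 2 ≤ b) (hy : 0 < y)
    (hbig : (b : ℝ) ^ (2 * (5 : ℝ) * Real.log 5) < r) (h : 5 ^ x = b ^ y + r) (hr : 0 < r) :
    b ^ 4 * y ≤ r := by
  by_contra! hc
  have hlow : b ^ 15 < r ^ 1 := pow_lt_pow_of_rpow_lt hb (by norm_num) hbig (by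
    have := le_log_of_exp_bound (k := 3) (z := 5 ^ 2) (by norm_num)
    rw [Real.log_pow] at this
    push_cast at this ⊢
    linarith)
  have hby : b ^ 11 < y := pow_lt_of_pow_add_lt (i := 4) (hlow.trans (by rwa [pow_one]))
  rcases Nat.lt_or_ge y 100000 with hlt | hge
  · have hb3 : b < 3 := by
      by_contra! hb3
      have := Nat.pow_le_pow_left hb3 11
      omega
    obtain rfl : b = 2 := by omega
    exact hc.not_ge (le_of_finiteCheck (by norm_num) hb finiteCheck_five hy hlt.le h hr hlow)
  · obtain ⟨h1, h2⟩ := lt_sq_of_pow_lt hb (by norm_num) (by norm_num) hc hby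
    exact not_close_powers_of_le_six (by norm_num) (by norm_num) hb hab h hr h1 h2 hge

theorem le_exponent_six {b x y r : ℕ} (hab : Nat.Coprime 6 b) (hb : 2 ≤ b)
    (hbig : (b : ℝ) ^ (2 * (6 : ℝ) * Real.log 6) < r) (h : 6 ^ x = b ^ y + r) (hr : 0 < r) :
    b ^ 2 * y ≤ r := by
  by_contra! hc
  have hlow : b ^ 20 < r ^ 1 := pow_lt_pow_of_rpow_lt hb (by norm_num) hbig (by
    have := le_log_of_exp_bound (k := 7) (z := 6 ^ 4) (by norm_num)
    rw [Real.log_pow] at this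
    push_cast at this ⊢
    linarith)
  have hby : b ^ 18 < y := pow_lt_of_pow_add_lt (i := 2) (hlow.trans (by rwa [pow_one]))
  have hge : 100000 ≤ y := le_trans (by norm_num) ((Nat.pow_le_pow_left hb 18).trans hby.le)
  obtain ⟨h1, h2⟩ := lt_sq_of_pow_lt hb (by norm_num) (by norm_num) hc hby
  exact not_close_powers_of_le_six (by norm_num) (by norm_num) hb hab h hr h1 h2 hge

theorem le_exponent_of_seven_le {a b x y r : ℕ} (ha : 7 ≤ a) (hab : Nat.Coprime a b)
    (hb : 2 ≤ b) (hbig : (b : ℝ) ^ (2 * (a : ℝ) * Real.log a) < r) (h : a ^ x = b ^ y + r)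
    (hr : 0 < r) : b ^ a * y ≤ r := by
  by_contra! hc
  have hb0 : (0 : ℝ) < b := by exact_mod_cast (show 0 < b by omega)
  have ha7 : (7 : ℝ) ≤ a := by exact_mod_cast ha
  have hloga : 1.9 ≤ Real.log a := by
    have h7 := le_log_of_exp_bound (k := 19) (z := (a : ℝ) ^ 10)
      (le_trans (by norm_num) (pow_le_pow_left₀ (by norm_num) ha7 10))
    rw [Real.log_pow] at h7
    push_cast at h7
    linarith
  have hylog : (2 * a * Real.log a - a) * Real.log b < Real.log y := by
    rw [← Real.log_rpow hb0]
    refine Real.log_lt_log (by positivity) ?_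
    rw [Real.rpow_sub hb0, Real.rpow_natCast, div_lt_iff₀ (by positivity), mul_comm (y : ℝ)]
    exact hbig.trans (by exact_mod_cast hc)
  have hlogb := le_log_of_two_le hb
  have hexp : (a : ℝ) * (2 * Real.log a - 1) ≤ 2 * a * Real.log a - a := by linarith
  have hby : b ^ a < y := by
    have hy0 : (0 : ℝ) < y := by
      have : y ≠ 0 := by
        rintro rfl
        omega
      exact_mod_cast Nat.pos_of_ne_zero this
    have : (b : ℝ) ^ a < y := by
      rw [← Real.log_lt_log_iff (by positivity) hy0, Real.log_pow]
      refine lt_of_le_of_lt (mul_le_mul_of_nonneg_right ?_ (by linarith)) hylog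
      nlinarith
    exact_mod_cast this
  have h69 : (a * (2 * Real.log a - 1)) * 0.6931 ≤ Real.log y :=
    le_trans (mul_le_mul hexp hlogb (by norm_num) (by nlinarith)) hylog.le
  have h7a : 7 * (2 * Real.log a - 1) ≤ a * (2 * Real.log a - 1) :=
    mul_le_mul_of_nonneg_right ha7 (by linarith)
  have ht : 13 ≤ Real.log y := by linarith
  obtain ⟨h1, h2⟩ := lt_sq_of_pow_lt hb le_rfl (by omega) hc hby
  exact not_close_powers_of_le_exp (by omega) hb hab h hr h1 h2
    (by linarith : Real.log a ≤ Real.log y / 2) (by linarith) (cube_le_exp_of_thirteen_le ht)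

theorem pow_totient_mul_le {a b x y r : ℕ} (ha : 3 ≤ a) (hab : Nat.Coprime a b)
    (hb : 2 ≤ b) (hy : 0 < y) (hbig : (b : ℝ) ^ (2 * (a : ℝ) * Real.log a) < r)
    (h : a ^ x = b ^ y + r) (hr : 0 < r) : b ^ a.totient * y ≤ r := by
  rcases Nat.lt_or_ge a 7 with ha7 | ha7
  · interval_cases a
    · exact le_exponent_three hab hb hy (by exact_mod_cast hbig) h hr
    · exact le_exponent_four hab hb hy (by exact_mod_cast hbig) h hr
    · exact le_exponent_five hab hb hy (by exact_mod_cast hbig) h hr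
    · exact le_exponent_six hab hb (by exact_mod_cast hbig) h hr
  · refine le_trans (Nat.mul_le_mul_right y ?_) (le_exponent_of_seven_le ha7 hab hb hbig h hr)
    exact Nat.pow_le_pow_right (by omega) (Nat.totient_le a)

theorem not_lt_of_two_solutions {a b r x₁ y₁ x₂ y₂ : ℕ} (ha : 2 ≤ a) (hb : 2 ≤ b)
    (hab : Nat.Coprime a b) (hr : 0 < r)
    (hbig : (b : ℝ) ^ (2 * (a : ℝ) * Real.log a) < r)
    (h₁ : a ^ x₁ = b ^ y₁ + r) (h₂ : a ^ x₂ = b ^ y₂ + r) : ¬ x₁ < x₂ := by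
  intro hx
  have hy : y₁ < y₂ := by
    have := Nat.pow_lt_pow_right (show 1 < a by omega) hx
    exact (Nat.pow_lt_pow_iff_right (show 1 < b by omega)).1 (by omega)
  have hdvd := pow_dvd_pow_sub_one_of_two_solutions hab h₁ h₂ hx.le hy.le
  have hb1 : 0 < b ^ y₁ := by positivity
  rcases Nat.lt_or_ge 2 a with ha3 | ha2
  · have h1 := pow_le_of_dvd_pow_sub_one ha3 hb hab (Nat.sub_pos_of_lt hy) hdvd
    have h2 := pow_totient_mul_le ha3 hab hb (by omega) hbig h₂ hr
    have h3 : (b ^ a.totient - 1) * (y₂ - y₁) ≤ b ^ a.totient * y₂ :=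
      Nat.mul_le_mul (Nat.sub_le _ _) (Nat.sub_le _ _)
    omega
  · obtain rfl : a = 2 := by omega
    have h1 := two_pow_le_of_dvd_pow_sub_one (Nat.coprime_two_left.1 hab) (by omega)
      (Nat.sub_pos_of_lt hy) hdvd
    have h2 := le_exponent_two hab hb (by omega) (by exact_mod_cast hbig) h₂ hr
    have h3 : (b + 1) * (y₂ - y₁) ≤ (b + 1) * y₂ := Nat.mul_le_mul_left _ (Nat.sub_le _ _)
    omega

theorem pillai_large_r
    (a b : ℕ) (ha : 2 ≤ a) (hb : 2 ≤ b) (hab : Nat.Coprime a b)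
    (r : ℕ) (hr : 0 < r) (hra : Nat.Coprime r a) (hrb : Nat.Coprime r b)
    (hbig : (b : ℝ) ^ (2 * (a : ℝ) * Real.log a) < (r : ℝ)) :
    ∀ x₁ y₁ x₂ y₂ : ℕ, 0 < x₁ → 0 < y₁ → 0 < x₂ → 0 < y₂ →
      a ^ x₁ = b ^ y₁ + r → a ^ x₂ = b ^ y₂ + r → (x₁, y₁) = (x₂, y₂) := by
  intro x₁ y₁ x₂ y₂ _ _ _ _ h₁ h₂
  obtain rfl : x₁ = x₂ := le_antisymm
    (not_lt.1 (not_lt_of_two_solutions ha hb hab hr hbig h₂ h₁))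
    (not_lt.1 (not_lt_of_two_solutions ha hb hab hr hbig h₁ h₂))
  rw [Nat.pow_right_injective hb (show b ^ y₁ = b ^ y₂ by omega)]
end

section
/- Let a be a prime, let b ≥ 2 be an integer coprime to a, and let r be a positive integer coprime to a and b with (a,b,r) ≠ (2,3,13). If r > b^a, then there is at most one pair (x,y) of positive integers with a^x − b^y = r. -/
namespace PillaiCheck

/-- `f x`, arranged so that the kernel evaluates `x` to a literal first. -/
def forced (x : ℕ) (f : ℕ → Bool) : Bool := Nat.rec (f 0) (fun n _ => f (Nat.succ n)) x

theorem forced_eq (x : ℕ) (f : ℕ → Bool) : forced x f = f x := by cases x <;> rfl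

/-- `k`-fold iteration of `s`, starting from `z`. -/
def fuel {α : Type} (z : α) (s : α → α) (k : ℕ) : α := Nat.rec z (fun _ ih => s ih) k

/-- Boolean conditional with immediate reduction. -/
def ifte (b x y : Bool) : Bool := Bool.rec y x b

theorem ifte_eq (b x y : Bool) : ifte b x y = if b then x else y := by cases b <;> rfl

/-- Binary search for the largest `e` with `2 ^ (120 + e) ≤ y`. -/
def searchExp (y : ℕ) (c : ℕ → Bool) : ℕ → ℕ → ℕ → Bool :=
  fuel (fun _ e => c e) fun ih s e =>
    forced (Nat.add e s) fun t => forced (Nat.div s 2) fun s' =>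
      ifte (Nat.ble (Nat.shiftLeft 1329227995784915872903807060280344576 t) y) (ih s' t) (ih s' e)

/-- One step of the interval computation of `b ^ 256 ^ k`: the interval `[lo, hi] * 2 ^ n` is raised
to the power `256`. -/
def powStep (k s e₀ : ℕ) (c : ℕ → ℕ → ℕ → Bool) (n lo hi : ℕ) : Bool :=
  forced (Nat.pow lo 256) fun y =>
    searchExp y (fun e =>
      forced (Nat.add (Nat.mul 256 n) e) fun n' => forced (Nat.shiftRight y e) fun lo' =>
        forced (Nat.add (Nat.shiftRight (Nat.pow hi 256) e) 1) fun hi' => c n' lo' hi') k s e₀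

/-- Passes to `c` exponents `l`, `u` with `2 ^ l ≤ b ^ 256 ^ 10 ≤ 2 ^ u`. -/
def withLog (b : ℕ) (c : ℕ → ℕ → Bool) : Bool :=
  powStep 13 4096 0 (fuel (fun n lo hi =>
    forced (Nat.add n 120) fun l => forced (Nat.add n 121) fun u =>
      ifte (Nat.ble 1329227995784915872903807060280344576 lo)
        (ifte (Nat.ble hi 2658455991569831745807614120560689152) (c l u) false) false)
    (powStep 8 128 30600) 9) 0 b b

/-- Euclid's algorithm on `(u, v)`, passing to `c` two consecutive convergents `p / q < p' / q'` as
soon as one of the denominators is at least `B`. -/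
def convergents (B : ℕ) (c : ℕ → ℕ → ℕ → ℕ → Bool) :
    ℕ → ℕ → ℕ → ℕ → ℕ → ℕ → ℕ → Bool → Bool :=
  fuel (fun _ _ _ _ _ _ _ => false) fun ih u v p₀ q₀ p₁ q₁ o =>
    ifte (Nat.ble B q₁) (ifte o (c p₀ q₀ p₁ q₁) (c p₁ q₁ p₀ q₀))
      (forced (Nat.div u v) fun t => forced (Nat.mod u v) fun v' =>
        forced (Nat.add (Nat.mul t p₁) p₀) fun p => forced (Nat.add (Nat.mul t q₁) q₀) fun q =>
          ih v v' p₁ q₁ p q (ifte o false true))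

/-- `p / q` and `p' / q'` are Farey neighbours around the interval from `lb / ua` to
`(ub + 2) / la`. -/
def farey (B la ua lb ub p q p' q' : ℕ) : Bool :=
  ifte (Nat.beq (Nat.mul p' q) (Nat.add (Nat.mul p q') 1))
    (ifte (Nat.ble (Nat.mul p ua) (Nat.mul lb q))
      (ifte (Nat.ble (Nat.mul (Nat.add ub 2) q') (Nat.mul p' la)) (Nat.ble B (Nat.add q q'))
        false) false) false

/-- Certifies that no fraction with denominator below `2 ^ 21` is a very good upper approximation
to `log b / log a`, given the bounds `la`, `ua` for `log a`. -/
def isolated (la ua b : ℕ) : Bool :=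
  withLog b fun lb ub => convergents 2097152 (farey 2097152 la ua lb ub) 60 lb ua 0 1 1 0 true

def loop (P : ℕ → Bool) : ℕ → ℕ → Bool :=
  fuel (fun _ => true) fun ih i => ifte (P i) (forced (Nat.add i 1) ih) false

/-- `isolated` for `b` prime to `a` unless `a ^ n ≤ b ^ a + b`. -/
def isolatedBelow (a n la ua b : ℕ) : Bool :=
  ifte (Nat.ble (Nat.pow a n) (Nat.add (Nat.pow b a) b)) true (isolated la ua b)

/-- `isolatedBelow` for `b = a ^ h * c ± 1` with `a ∤ c`, where `h₀ ≤ h < h₀ + H` and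
`1 ≤ c < C + 1`. -/
def isolatedNear (a E h₀ H C : ℕ) : Bool :=
  withLog a fun la ua => loop (fun h => forced (Nat.pow a h) fun ah =>
    loop (fun c => ifte (Nat.beq (Nat.mod c a) 0) true
      (forced (Nat.mul ah c) fun m =>
        ifte (forced (Nat.sub m 1) (isolatedBelow a (Nat.add h E) la ua))
          (forced (Nat.add m 1) (isolatedBelow a (Nat.add h E) la ua)) false)) C 1) H h₀

/-- `isolated` for `2 ≤ b < 131` prime to `a = 2 * w + 1` with `b ^ (w + 1) < 2 ^ 21 + b`. -/
def isolatedFar (w : ℕ) : Bool :=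
  withLog (Nat.add (Nat.mul 2 w) 1) fun la ua => loop (fun b =>
    ifte (Nat.beq (Nat.mod b (Nat.add (Nat.mul 2 w) 1)) 0) true
      (ifte (Nat.ble (Nat.add 2097152 b) (Nat.pow b (Nat.add w 1))) true (isolated la ua b))) 129 2

theorem ifte_false (b x : Bool) : ifte b x false = (b && x) := by cases b <;> rfl

theorem ifte_true (b x : Bool) : ifte b true x = (b || x) := by cases b <;> rfl

theorem fuel_zero {α : Type} (z : α) (s : α → α) : fuel z s 0 = z := rfl

theorem fuel_succ {α : Type} (z : α) (s : α → α) (k : ℕ) :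
    fuel z s (k + 1) = s (fuel z s k) := rfl

theorem loop_spec {P : ℕ → Bool} {k i j : ℕ} (h : loop P k i = true) (hi : i ≤ j)
    (hj : j < i + k) : P j = true := by
  induction k generalizing i with
  | zero => omega
  | succ k ih =>
    rw [loop, fuel_succ, ifte_false, forced_eq, Bool.and_eq_true] at h
    rcases hi.eq_or_lt with rfl | hlt
    · exact h.1
    · exact ih (i := i + 1) h.2 hlt (by omega)

theorem searchExp_spec {y : ℕ} {c : ℕ → Bool} {k s e : ℕ} (h : searchExp y c k s e = true) :
    ∃ e', c e' = true := by
  induction k generalizing s e with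
  | zero => exact ⟨e, h⟩
  | succ k ih =>
    rw [searchExp, fuel_succ, forced_eq, forced_eq, ifte_eq] at h
    split_ifs at h
    · exact ih h
    · exact ih h

theorem powStep_spec {k s e₀ n lo hi x : ℕ} {c : ℕ → ℕ → ℕ → Bool}
    (h : powStep k s e₀ c n lo hi = true) (hlo : lo * 2 ^ n ≤ x) (hhi : x ≤ hi * 2 ^ n) :
    ∃ n' lo' hi', lo' * 2 ^ n' ≤ x ^ 256 ∧ x ^ 256 ≤ hi' * 2 ^ n' ∧ c n' lo' hi' = true := by
  rw [powStep, forced_eq] at h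
  obtain ⟨e, he⟩ := searchExp_spec h
  rw [forced_eq, forced_eq, forced_eq] at he
  refine ⟨_, _, _, ?_, ?_, he⟩
  · have h1 : (lo * 2 ^ n) ^ 256 ≤ x ^ 256 := Nat.pow_le_pow_left hlo 256
    refine le_trans ?_ h1
    have h2 : lo ^ 256 >>> e * 2 ^ e ≤ lo ^ 256 := by
      rw [Nat.shiftRight_eq_div_pow]; exact Nat.div_mul_le_self _ _
    calc lo ^ 256 >>> e * 2 ^ (256 * n + e) = lo ^ 256 >>> e * 2 ^ e * 2 ^ (256 * n) := by
          rw [pow_add]; ring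
      _ ≤ lo ^ 256 * 2 ^ (256 * n) := Nat.mul_le_mul_right _ h2
      _ = (lo * 2 ^ n) ^ 256 := by rw [mul_pow, ← pow_mul, mul_comm n]
  · have h1 : x ^ 256 ≤ (hi * 2 ^ n) ^ 256 := Nat.pow_le_pow_left hhi 256
    refine h1.trans ?_
    have h2 : hi ^ 256 ≤ (hi ^ 256 >>> e + 1) * 2 ^ e := by
      rw [Nat.shiftRight_eq_div_pow]
      exact (Nat.lt_div_mul_add (Nat.two_pow_pos e)).le.trans (by rw [add_mul, one_mul])
    calc (hi * 2 ^ n) ^ 256 = hi ^ 256 * 2 ^ (256 * n) := by rw [mul_pow, ← pow_mul, mul_comm n]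
      _ ≤ (hi ^ 256 >>> e + 1) * 2 ^ e * 2 ^ (256 * n) := Nat.mul_le_mul_right _ h2
      _ = (hi ^ 256 >>> e + 1) * 2 ^ (256 * n + e) := by rw [pow_add]; ring

theorem fuel_powStep_spec {k s e₀ m n lo hi x : ℕ} {c : ℕ → ℕ → ℕ → Bool}
    (h : fuel c (powStep k s e₀) m n lo hi = true) (hlo : lo * 2 ^ n ≤ x) (hhi : x ≤ hi * 2 ^ n) :
    ∃ n' lo' hi', lo' * 2 ^ n' ≤ x ^ 256 ^ m ∧ x ^ 256 ^ m ≤ hi' * 2 ^ n' ∧ c n' lo' hi' = true := by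
  induction m generalizing n lo hi x with
  | zero => exact ⟨n, lo, hi, by simpa using hlo, by simpa using hhi, h⟩
  | succ m ih =>
    rw [fuel_succ] at h
    obtain ⟨n', lo', hi', h1, h2, h3⟩ := powStep_spec h hlo hhi
    obtain ⟨n'', lo'', hi'', h4, h5, h6⟩ := ih h3 h1 h2
    rw [← pow_mul, ← pow_succ'] at h4 h5
    exact ⟨n'', lo'', hi'', h4, h5, h6⟩

/-- The scale to which logarithms are computed by `withLog`. -/
def logScale : ℕ := 256 ^ 10

theorem withLog_spec {b : ℕ} {c : ℕ → ℕ → Bool} (h : withLog b c = true) :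
    ∃ l u, 2 ^ l ≤ b ^ logScale ∧ b ^ logScale ≤ 2 ^ u ∧ c l u = true := by
  obtain ⟨n, lo, hi, h1, h2, h3⟩ :=
    powStep_spec (x := b) h (by simp) (by simp)
  obtain ⟨n, lo, hi, h1, h2, h3⟩ := fuel_powStep_spec h3 h1 h2
  rw [forced_eq, forced_eq, ifte_false, ifte_false, Bool.and_eq_true, Bool.and_eq_true,
    Nat.ble_eq, Nat.ble_eq] at h3
  obtain ⟨h3, h4, h5⟩ := h3
  rw [← pow_mul, ← pow_succ'] at h1 h2
  refine ⟨_, _, ?_, ?_, h5⟩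
  · refine le_trans ?_ h1
    rw [Nat.add_eq, pow_add, mul_comm]
    exact Nat.mul_le_mul_right _ (le_trans (by norm_num) h3)
  · refine h2.trans ?_
    rw [Nat.add_eq, pow_add, mul_comm]
    exact Nat.mul_le_mul_left _ (h4.trans (by norm_num))

theorem convergents_spec {B : ℕ} {c : ℕ → ℕ → ℕ → ℕ → Bool} {k u v p₀ q₀ p₁ q₁ : ℕ} {o : Bool}
    (h : convergents B c k u v p₀ q₀ p₁ q₁ o = true) : ∃ p q p' q', c p q p' q' = true := by
  induction k generalizing u v p₀ q₀ p₁ q₁ o with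
  | zero => exact absurd h (by simp [convergents, fuel_zero])
  | succ k ih =>
    rw [convergents, fuel_succ, ifte_eq, ifte_eq] at h
    split_ifs at h
    · exact ⟨_, _, _, _, h⟩
    · exact ⟨_, _, _, _, h⟩
    · rw [forced_eq, forced_eq, forced_eq, forced_eq] at h
      exact ih h

/-- The quotient `log b / log a` lies between Farey neighbours of large denominators. -/
def FareyGap (la ua b : ℕ) : Prop :=
  ∃ lb ub p q p' q' : ℕ, 2 ^ lb ≤ b ^ logScale ∧ b ^ logScale ≤ 2 ^ ub ∧ p' * q = p * q' + 1 ∧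
    p * ua ≤ lb * q ∧ (ub + 2) * q' ≤ p' * la ∧ 2 ^ 21 ≤ q + q'

theorem isolated_spec {la ua b : ℕ} (h : isolated la ua b = true) : FareyGap la ua b := by
  obtain ⟨lb, ub, h1, h2, h⟩ := withLog_spec h
  obtain ⟨p, q, p', q', h⟩ := convergents_spec h
  rw [farey, ifte_false, ifte_false, ifte_false, Bool.and_eq_true, Bool.and_eq_true,
    Bool.and_eq_true, Nat.ble_eq, Nat.ble_eq, Nat.ble_eq, Nat.beq_eq] at h
  exact ⟨lb, ub, p, q, p', q', h1, h2, h.1, h.2.1, h.2.2.1, h.2.2.2⟩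

theorem isolatedBelow_spec {a n la ua b : ℕ} (h : isolatedBelow a n la ua b = true)
    (hb : b ^ a + b < a ^ n) : FareyGap la ua b := by
  rw [isolatedBelow, ifte_true, Bool.or_eq_true, Nat.ble_eq] at h
  rcases h with h | h
  · exact absurd h (not_le.2 hb)
  · exact isolated_spec h

theorem isolatedNear_spec {a E h₀ H C : ℕ} (hc : isolatedNear a E h₀ H C = true) :
    ∃ la ua, 2 ^ la ≤ a ^ logScale ∧ a ^ logScale ≤ 2 ^ ua ∧ ∀ b h c, h₀ ≤ h → h < h₀ + H →
      1 ≤ c → c < 1 + C → ¬ a ∣ c → (b + 1 = a ^ h * c ∨ b = a ^ h * c + 1) →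
      b ^ a + b < a ^ (h + E) → FareyGap la ua b := by
  obtain ⟨la, ua, h1, h2, hc⟩ := withLog_spec hc
  refine ⟨la, ua, h1, h2, fun b h c hh hh' hc1 hc2 hac hb hlt => ?_⟩
  have h3 := loop_spec hc hh hh'
  rw [forced_eq] at h3
  have h4 := loop_spec h3 hc1 hc2
  rw [ifte_true, Bool.or_eq_true, Nat.beq_eq, forced_eq, ifte_false, Bool.and_eq_true, forced_eq,
    forced_eq] at h4
  rcases h4 with h4 | ⟨h4, h5⟩
  · exact absurd (Nat.dvd_of_mod_eq_zero h4) hac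
  · rcases hb with hb | hb
    · have : b = Nat.sub (Nat.mul (Nat.pow a h) c) 1 := Nat.eq_sub_of_add_eq hb
      rw [← this] at h4
      exact isolatedBelow_spec h4 hlt
    · have : b = Nat.add (Nat.mul (Nat.pow a h) c) 1 := hb
      rw [← this] at h5
      exact isolatedBelow_spec h5 hlt

theorem isolatedFar_spec {w : ℕ} (hc : isolatedFar w = true) :
    ∃ la ua, 2 ^ la ≤ (2 * w + 1) ^ logScale ∧ (2 * w + 1) ^ logScale ≤ 2 ^ ua ∧
      ∀ b, 2 ≤ b → b < 131 → ¬ 2 * w + 1 ∣ b → b ^ (w + 1) < 2 ^ 21 + b → FareyGap la ua b := by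
  obtain ⟨la, ua, h1, h2, hc⟩ := withLog_spec hc
  refine ⟨la, ua, h1, h2, fun b hb hb' hab hlt => ?_⟩
  have h3 := loop_spec hc hb hb'
  rw [ifte_true, ifte_true, Bool.or_eq_true, Bool.or_eq_true, Nat.beq_eq, Nat.ble_eq] at h3
  rcases h3 with h3 | h3 | h3
  · exact absurd (Nat.dvd_of_mod_eq_zero h3) hab
  · exact absurd h3 (not_le.2 hlt)
  · exact isolated_spec h3


theorem pow_le_two_mul_pow {B r m : ℕ} (h : r * (2 * m) ≤ B) : (B + r) ^ m ≤ 2 * B ^ m := by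
  rcases Nat.eq_zero_or_pos B with rfl | hB
  · rcases Nat.eq_zero_or_pos m with rfl | hm
    · simp
    · have : r = 0 := by
        rcases Nat.eq_zero_or_pos r with hr | hr
        · exact hr
        · have : 0 < r * (2 * m) := by positivity
          omega
      simp [this, hm.ne']
  have hB' : (0 : ℝ) < B := by exact_mod_cast hB
  have h1 : (1 + r / B : ℝ) ^ m ≤ 2 := by
    have h2 : (1 + r / B : ℝ) ≤ Real.exp (r / B) := by
      rw [add_comm]; exact Real.add_one_le_exp _
    refine (pow_le_pow_left₀ (by positivity) h2 m).trans ?_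
    rw [← Real.exp_nat_mul, ← Real.le_log_iff_exp_le two_pos]
    refine le_trans ?_ (le_trans (by norm_num) Real.log_two_gt_d9.le : (1 / 2 : ℝ) ≤ _)
    rw [← mul_div_assoc, div_le_div_iff₀ hB' two_pos]
    have : ((r * (2 * m) : ℕ) : ℝ) ≤ B := by exact_mod_cast h
    push_cast at this
    linarith
  have h3 : ((B + r : ℕ) : ℝ) ^ m = (1 + r / B : ℝ) ^ m * (B : ℝ) ^ m := by
    rw [← mul_pow]; congr 1; push_cast; field_simp
  have h4 : ((B + r : ℕ) : ℝ) ^ m ≤ 2 * (B : ℝ) ^ m := by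
    rw [h3]; exact mul_le_mul_of_nonneg_right h1 (by positivity)
  exact_mod_cast h4

theorem sq_mul_two_pow_le {n : ℕ} (hn : 100 ≤ n) : n ^ 2 * 2 ^ 81 ≤ 2 ^ n := by
  induction n, hn using Nat.le_induction with
  | base => norm_num
  | succ n hn ih =>
    have : (n + 1) ^ 2 ≤ 2 * n ^ 2 := by nlinarith
    calc (n + 1) ^ 2 * 2 ^ 81 ≤ 2 * n ^ 2 * 2 ^ 81 := Nat.mul_le_mul_right _ this
      _ = 2 * (n ^ 2 * 2 ^ 81) := by ring
      _ ≤ 2 * 2 ^ n := Nat.mul_le_mul_left _ ih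
      _ = 2 ^ (n + 1) := by ring

theorem FareyGap.elim {a b la ua X Y r : ℕ} (h : FareyGap la ua b) (hla : 2 ^ la ≤ a ^ logScale)
    (hua : a ^ logScale ≤ 2 ^ ua) (hb : 2 ≤ b) (hr : 0 < r) (hrY : r < Y ^ 2) (hY : 100 ≤ Y)
    (hY' : Y < 2 ^ 21) (heq : a ^ X = b ^ Y + r) : False := by
  obtain ⟨lb, ub, p, q, p', q', hlb, hub, hdet, h1, h2, h3⟩ := h
  have hM : logScale ≤ 2 ^ 80 := by rw [logScale]; norm_num
  have hM0 : logScale ≠ 0 := by rw [logScale]; norm_num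
  generalize logScale = M at *
  have hA : lb * Y < ua * X := by
    rw [← Nat.pow_lt_pow_iff_right one_lt_two]
    calc 2 ^ (lb * Y) ≤ (b ^ M) ^ Y := by rw [pow_mul]; exact Nat.pow_le_pow_left hlb _
      _ = (b ^ Y) ^ M := by rw [← pow_mul, ← pow_mul, mul_comm]
      _ < (a ^ X) ^ M := Nat.pow_lt_pow_left (by omega) hM0
      _ = (a ^ M) ^ X := by rw [← pow_mul, ← pow_mul, mul_comm]
      _ ≤ 2 ^ (ua * X) := by rw [pow_mul]; exact Nat.pow_le_pow_left hua _
  have hB : la * X ≤ ub * Y + 1 := by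
    rw [← Nat.pow_le_pow_iff_right one_lt_two]
    have hsmall : r * (2 * M) ≤ b ^ Y :=
      calc r * (2 * M) ≤ Y ^ 2 * (2 * 2 ^ 80) := by gcongr
        _ = Y ^ 2 * 2 ^ 81 := by norm_num
        _ ≤ 2 ^ Y := sq_mul_two_pow_le hY
        _ ≤ b ^ Y := Nat.pow_le_pow_left hb _
    calc 2 ^ (la * X) ≤ (a ^ M) ^ X := by rw [pow_mul]; exact Nat.pow_le_pow_left hla _
      _ = (b ^ Y + r) ^ M := by rw [← heq, ← pow_mul, ← pow_mul, mul_comm]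
      _ ≤ 2 * (b ^ Y) ^ M := pow_le_two_mul_pow hsmall
      _ = 2 * (b ^ M) ^ Y := by rw [← pow_mul, ← pow_mul, mul_comm Y]
      _ ≤ 2 * (2 ^ ub) ^ Y := by gcongr
      _ = 2 ^ (ub * Y + 1) := by rw [← pow_mul]; ring
  have hC : p * Y < X * q := by
    rcases Nat.eq_zero_or_pos q with rfl | hq
    · omega
    · have h4 : lb * Y * q < ua * X * q := Nat.mul_lt_mul_of_pos_right hA hq
      have h5 : p * ua * Y ≤ lb * q * Y := Nat.mul_le_mul_right _ h1
      by_contra! hcon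
      have h6 : ua * (X * q) ≤ ua * (p * Y) := Nat.mul_le_mul_left _ hcon
      nlinarith
  have hD : X * q' < p' * Y := by
    rcases Nat.eq_zero_or_pos q' with rfl | hq
    · have : 0 < p' := by
        rcases Nat.eq_zero_or_pos p' with rfl | hp
        · omega
        · exact hp
      have : 0 < p' * Y := by positivity
      omega
    · have h4 : la * X * q' < (ub + 2) * Y * q' := by
        refine Nat.mul_lt_mul_of_pos_right ?_ hq
        nlinarith
      have h5 : (ub + 2) * q' * Y ≤ p' * la * Y := Nat.mul_le_mul_right _ h2
      by_contra! hcon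
      have h6 : la * (p' * Y) ≤ la * (X * q') := Nat.mul_le_mul_left _ hcon
      nlinarith
  have hE : q + q' ≤ Y := by
    zify at hC hD hdet ⊢
    have h4 : (Y : ℤ) = q' * (X * q - p * Y) + q * (p' * Y - X * q') := by
      linear_combination (-(Y : ℤ)) * hdet
    nlinarith
  omega

/-- No `Y > y` in the range satisfies `b ^ Y + r ∣ a ^ 700`, where `r = a ^ x - b ^ y > b ^ a` is
small, unless `a = 2`, `b = 3`, `r = 13`. -/
def smallCheck (a : ℕ) : Bool :=
  forced (Nat.pow a 700) fun A => loop (fun b => ifte (Nat.beq (Nat.mod b a) 0) true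
    (loop (fun x => forced (Nat.pow a x) fun ax => ifte (Nat.ble 10000 ax) true
      (loop (fun y => forced (Nat.pow b y) fun z =>
        ifte (Nat.ble ax (Nat.add (Nat.pow b a) z)) true (forced (Nat.sub ax z) fun r =>
          loop (fun Y => ifte (Nat.beq (Nat.mod A (Nat.add (Nat.pow b Y) r)) 0)
              (ifte (Nat.beq a 2) (ifte (Nat.beq b 3) (Nat.beq r 13) false) false) true)
            (Nat.sub 99 y) (Nat.add y 1)))
        13 1)) 13 1)) 98 2

theorem smallCheck_spec {a b x y X Y r : ℕ} (h : smallCheck a = true) (hb : 2 ≤ b) (hb' : b < 100)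
    (hab : ¬ a ∣ b) (hx : 1 ≤ x) (hx' : x < 14) (hax : a ^ x < 10000) (hy : 1 ≤ y) (hy' : y < 14)
    (hr : a ^ x = b ^ y + r) (hbig : b ^ a < r) (hyY : y < Y) (hY : Y < 100) (hX : X ≤ 700)
    (heq : a ^ X = b ^ Y + r) : a = 2 ∧ b = 3 ∧ r = 13 := by
  rw [smallCheck, forced_eq] at h
  have h1 := loop_spec h hb hb'
  rw [ifte_true, Bool.or_eq_true, Nat.beq_eq] at h1
  replace h1 := h1.resolve_left fun h => hab (Nat.dvd_of_mod_eq_zero h)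
  have h2 := loop_spec h1 hx hx'
  rw [forced_eq, ifte_true, Bool.or_eq_true, Nat.ble_eq] at h2
  replace h2 := h2.resolve_left (not_le.2 hax)
  have h3 := loop_spec h2 hy hy'
  rw [forced_eq, ifte_true, Bool.or_eq_true, Nat.ble_eq, forced_eq] at h3
  replace h3 := h3.resolve_left
    (not_le.2 (show b ^ a + b ^ y < a ^ x by omega))
  have hr' : Nat.sub (Nat.pow a x) (Nat.pow b y) = r :=
    (Nat.sub_eq_iff_eq_add' (show b ^ y ≤ a ^ x by omega)).2 hr
  rw [hr'] at h3
  have h4 := loop_spec h3 (j := Y) hyY (show Y < y + 1 + (99 - y) by omega)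
  have h5 : Nat.mod (Nat.pow a 700) (Nat.add (Nat.pow b Y) r) = 0 := by
    have : b ^ Y + r ∣ a ^ 700 := heq ▸ pow_dvd_pow a hX
    exact Nat.mod_eq_zero_of_dvd this
  rw [ifte_eq, if_pos (by rw [Nat.beq_eq]; exact h5), ifte_false, ifte_false, Bool.and_eq_true,
    Bool.and_eq_true, Nat.beq_eq, Nat.beq_eq, Nat.beq_eq] at h4
  exact h4

set_option maxRecDepth 100000 in
theorem smallCheck_all : [2, 3, 5, 7, 11, 13].all smallCheck = true := by decide +kernel
set_option maxRecDepth 100000 in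
theorem isolatedNear_two : isolatedNear 2 20 2 19 512 = true := by decide +kernel

set_option maxRecDepth 100000 in
theorem isolatedNear_three : isolatedNear 3 13 1 6 57 = true := by decide +kernel

set_option maxRecDepth 100000 in
theorem isolatedFar_all : [2, 3, 5, 6, 8, 9, 11, 14, 15, 18].all isolatedFar = true := by
  decide +kernel

theorem padicValNat_pow_mul {p h c : ℕ} [hp : Fact p.Prime] (hc : ¬ p ∣ c) :
    padicValNat p (p ^ h * c) = h := by
  have hc0 : c ≠ 0 := by rintro rfl; simp at hc
  rw [padicValNat.mul (pow_ne_zero _ hp.out.ne_zero) hc0, padicValNat.prime_pow,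
    padicValNat.eq_zero_of_not_dvd hc, add_zero]

theorem pow_le_of_padicValNat_le {p n h d m : ℕ} [hp : Fact p.Prime] (hd : d ≠ 0) (hm : m ≠ 0)
    (hval : padicValNat p m ≤ h + padicValNat p d) (hn : p ^ n ∣ m) : p ^ n ≤ p ^ h * d := by
  have h1 : n ≤ h + padicValNat p d := ((padicValNat_dvd_iff_le hm).1 hn).trans hval
  calc p ^ n ≤ p ^ (h + padicValNat p d) := Nat.pow_le_pow_right hp.out.pos h1
    _ = p ^ h * p ^ padicValNat p d := pow_add _ _ _
    _ ≤ p ^ h * d := Nat.mul_le_mul_left _ (Nat.le_of_dvd (Nat.pos_of_ne_zero hd)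
      pow_padicValNat_dvd)

theorem exists_pow_le_of_odd {a b w : ℕ} (ha : a.Prime) (haw : a = 2 * w + 1) (hb : 2 ≤ b)
    (hab : Nat.Coprime a b) : ∃ h c, 1 ≤ h ∧ ¬ a ∣ c ∧ (b ^ w + 1 = a ^ h * c ∨ b ^ w = a ^ h * c + 1) ∧
      ∀ d n, d ≠ 0 → a ^ n ∣ b ^ d - 1 → a ^ n ≤ a ^ h * d := by
  have : Fact a.Prime := ⟨ha⟩
  have hw : 1 ≤ w := by have := ha.two_le; omega
  have hodd : Odd a := ⟨w, haw⟩
  have hbw : 2 ≤ b ^ w := hb.trans (Nat.le_self_pow (by omega) b)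
  have hfac : b ^ (2 * w) - 1 = (b ^ w + 1) * (b ^ w - 1) := by
    rw [← Nat.sq_sub_sq, ← pow_mul, mul_comm w, one_pow]
  have hdvd : a ∣ b ^ (2 * w) - 1 := by
    have h1 : b ^ Nat.totient a ≡ 1 [MOD a] := Nat.ModEq.pow_totient hab.symm
    rw [Nat.totient_prime ha, haw, Nat.add_sub_cancel] at h1
    rw [haw]
    exact (Nat.modEq_iff_dvd' (Nat.one_le_pow _ _ (by omega))).1 h1.symm
  have key : ∃ u v, b ^ (2 * w) - 1 = u * v ∧ 0 < u ∧ a ∣ u ∧ ¬ a ∣ v ∧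
      (b ^ w + 1 = u ∨ b ^ w = u + 1) := by
    have h2 : ¬ (a ∣ b ^ w + 1 ∧ a ∣ b ^ w - 1) := by
      rintro ⟨h3, h4⟩
      have h5 := Nat.dvd_sub h3 h4
      have h6 : b ^ w + 1 - (b ^ w - 1) = 2 := by omega
      rw [h6] at h5
      have := Nat.le_of_dvd two_pos h5
      omega
    rcases (ha.dvd_mul).1 (hfac ▸ hdvd) with h3 | h3
    · exact ⟨_, _, hfac, by omega, h3, fun h4 => h2 ⟨h3, h4⟩, Or.inl rfl⟩
    · exact ⟨_, _, by rw [hfac, mul_comm], by omega, h3, fun h4 => h2 ⟨h4, h3⟩, Or.inr (by omega)⟩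
  obtain ⟨u, v, huv, hu, hau, hav, hbu⟩ := key
  obtain ⟨h, c, hc, rfl⟩ := Nat.exists_eq_pow_mul_and_not_dvd hu.ne' a ha.ne_one
  refine ⟨h, c, ?_, hc, hbu, fun d n hd hn => ?_⟩
  · rcases Nat.eq_zero_or_pos h with rfl | h1
    · simp only [pow_zero, one_mul] at hau
      exact absurd hau hc
    · exact h1
  have hb2 : 1 < b ^ (2 * w) := Nat.one_lt_pow (by omega) (by omega)
  have hnb : ¬ a ∣ b ^ (2 * w) := fun h1 =>
    (Nat.Prime.coprime_iff_not_dvd ha).1 hab (ha.dvd_of_dvd_pow h1)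
  have hval := padicValNat.pow_sub_pow hodd hb2 hdvd hnb hd
  have hv0 : v ≠ 0 := by rintro rfl; simp at hav
  rw [one_pow, huv, mul_assoc, padicValNat_pow_mul (fun h1 => (ha.dvd_mul.1 h1).elim hc hav)]
    at hval
  refine pow_le_of_padicValNat_le hd ?_ hval.le (hn.trans ?_)
  · have : 1 < (b ^ (2 * w)) ^ d := Nat.one_lt_pow hd hb2
    omega
  · rw [← pow_mul, mul_comm, pow_mul]
    simpa using Nat.sub_dvd_pow_sub_pow (b ^ d) 1 (2 * w)

theorem exists_pow_le_two {b : ℕ} (hb : 2 ≤ b) (hab : Nat.Coprime 2 b) :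
    ∃ h c, 2 ≤ h ∧ ¬ 2 ∣ c ∧ (b + 1 = 2 ^ h * c ∨ b = 2 ^ h * c + 1) ∧
      ∀ d n, d ≠ 0 → 2 ^ n ∣ b ^ d - 1 → 2 ^ n ≤ 2 ^ h * d := by
  have hbodd : b % 2 = 1 := Nat.odd_iff.1 (Nat.coprime_two_left.1 hab)
  have key : ∃ u v, 0 < u ∧ 4 ∣ u ∧ ¬ 2 ∣ v ∧ (b + 1 = u ∨ b = u + 1) ∧
      (b + 1) * (b - 1) = u * (2 ^ 1 * v) := by
    rcases (by omega : b % 4 = 1 ∨ b % 4 = 3) with h1 | h1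
    · exact ⟨b - 1, (b + 1) / 2, by omega, by omega, by omega, by omega,
        by rw [pow_one, Nat.mul_div_cancel' (by omega), mul_comm]⟩
    · exact ⟨b + 1, (b - 1) / 2, by omega, by omega, by omega, by omega,
        by rw [pow_one, Nat.mul_div_cancel' (by omega)]⟩
  obtain ⟨u, v, hu, hau, hav, hbu, huv⟩ := key
  obtain ⟨h, c, hc, rfl⟩ := Nat.exists_eq_pow_mul_and_not_dvd hu.ne' 2 (by norm_num)
  refine ⟨h, c, ?_, hc, hbu, fun d n hd hn => ?_⟩
  · by_contra! h1
    interval_cases h <;> omega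
  have hc0 : c ≠ 0 := by rintro rfl; simp at hc
  have hv0 : v ≠ 0 := by rintro rfl; simp at hav
  have hval := padicValNat.pow_two_sub_pow (x := b) (y := 1) (n := 2 * d) (by omega) (by omega) (by omega)
    (by omega) (even_two_mul d)
  rw [← padicValNat.mul (by omega) (by omega), huv,
    padicValNat.mul (by positivity) (by positivity), padicValNat_pow_mul hc,
    padicValNat_pow_mul hav, padicValNat.mul two_ne_zero hd, one_pow] at hval
  have h1 : padicValNat 2 2 = 1 := padicValNat.self (by norm_num)
  have hbd : 1 < b ^ d := Nat.one_lt_pow hd (by omega)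
  have hodd : b ^ d % 2 = 1 := Nat.odd_iff.1 ((Nat.odd_iff.2 hbodd).pow)
  have h2 : b ^ (2 * d) - 1 = (b ^ d + 1) * (b ^ d - 1) := by
    rw [← Nat.sq_sub_sq, ← pow_mul, mul_comm d, one_pow]
  rw [h2, padicValNat.mul (by omega) (by omega)] at hval
  have h3 : 1 ≤ padicValNat 2 (b ^ d + 1) := one_le_padicValNat_of_dvd (by omega) (by omega)
  exact pow_le_of_padicValNat_le hd (by omega) (by omega) hn

section ZeroEstimate

open Polynomial

theorem injOn_mul_add_mul {X Y T : ℕ} (hXY : Nat.Coprime X Y) (hT : T ≤ Y) (S : ℕ) :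
    Set.InjOn (fun p : ℕ × ℕ => ((p.1 * Y + p.2 * X : ℕ) : ℤ))
      (Finset.range S ×ˢ Finset.range T : Finset (ℕ × ℕ)) := by
  rintro ⟨s, t⟩ h ⟨s', t'⟩ h' heq
  simp only [Finset.coe_product, Finset.coe_range, Set.mem_prod, Set.mem_Iio] at h h'
  simp only [Nat.cast_inj] at heq
  have h1 : t * X ≡ t' * X [MOD Y] := by
    have : s * Y + t * X ≡ s' * Y + t' * X [MOD Y] := by rw [heq]
    simpa [Nat.ModEq] using this
  have h2 : t = t' :=
    (Nat.ModEq.cancel_right_of_coprime hXY.symm h1).eq_of_lt_of_lt (by omega) (by omega)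
  subst h2
  have h3 : s * Y = s' * Y := by omega
  rw [Nat.eq_of_mul_eq_mul_right (by omega) h3]

/-- The coefficient of the determinant of shifted exponential polynomials in the top degree. -/
theorem coeff_det_shift {m : ℕ} (P : Fin m → ℤ[X]) (hP : ∀ k, P k ≠ 0) (v : Fin m → ℤ)
    (hv : ∀ k, v k ≠ 0) (y : ℤ) :
    (Matrix.det (Matrix.of fun ν k : Fin m =>
      (P k).comp (X + C (ν * y)) * C (v k ^ (ν : ℕ)))).coeff (∑ k, (P k).natDegree) =
      (∏ k, (P k).leadingCoeff) * (Matrix.vandermonde v).det ∧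
    (Matrix.det (Matrix.of fun ν k : Fin m =>
      (P k).comp (X + C (ν * y)) * C (v k ^ (ν : ℕ)))).natDegree ≤ ∑ k, (P k).natDegree := by
  have hdeg : ∀ (k : Fin m) (ν : Fin m),
      ((P k).comp (X + C (ν * y)) * C (v k ^ (ν : ℕ))).natDegree = (P k).natDegree := fun k ν => by
    rw [natDegree_mul_C (pow_ne_zero _ (hv k)), natDegree_comp, natDegree_X_add_C, mul_one]
  have hlead : ∀ (k : Fin m) (ν : Fin m),
      ((P k).comp (X + C (ν * y)) * C (v k ^ (ν : ℕ))).leadingCoeff =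
        (P k).leadingCoeff * v k ^ (ν : ℕ) := fun k ν => by
    rw [leadingCoeff_mul, leadingCoeff_C, leadingCoeff_comp (by rw [natDegree_X_add_C]; simp),
      leadingCoeff_X_add_C, one_pow, mul_one]
  have hne : ∀ (k : Fin m) (ν : Fin m),
      (P k).comp (X + C (ν * y)) * C (v k ^ (ν : ℕ)) ≠ 0 := fun k ν => by
    rw [← leadingCoeff_ne_zero, hlead]
    exact mul_ne_zero (leadingCoeff_ne_zero.2 (hP k)) (pow_ne_zero _ (hv k))
  have hnat : ∀ σ : Equiv.Perm (Fin m),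
      (∏ k, (P k).comp (X + C ((σ k : ℕ) * y)) * C (v k ^ (σ k : ℕ))).natDegree =
        ∑ k, (P k).natDegree := fun σ => by
    rw [natDegree_prod _ _ fun k _ => hne k (σ k)]
    exact Finset.sum_congr rfl fun k _ => hdeg k (σ k)
  have hcoeff : ∀ σ : Equiv.Perm (Fin m),
      (∏ k, (P k).comp (X + C ((σ k : ℕ) * y)) * C (v k ^ (σ k : ℕ))).coeff
        (∑ k, (P k).natDegree) = (∏ k, (P k).leadingCoeff) * ∏ k, v k ^ (σ k : ℕ) := fun σ => by
    rw [← hnat σ, coeff_natDegree, leadingCoeff_prod, ← Finset.prod_mul_distrib]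
    exact Finset.prod_congr rfl fun k _ => hlead k (σ k)
  constructor
  · rw [← Matrix.det_transpose (Matrix.vandermonde v), Matrix.det_apply, Matrix.det_apply,
      finsetSum_coeff, Finset.mul_sum]
    refine Finset.sum_congr rfl fun σ _ => ?_
    simp only [Matrix.of_apply, Matrix.transpose_apply, Matrix.vandermonde_apply]
    rw [coeff_smul, hcoeff σ, mul_smul_comm]
  · rw [Matrix.det_apply]
    refine natDegree_sum_le_of_forall_le _ _ fun σ _ => ?_
    simp only [Matrix.of_apply]
    exact (natDegree_smul_le _ _).trans (hnat σ).le

/-- An exponential polynomial with few terms does not vanish on a large set of the shape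
`s * Y + t * X`. -/
theorem zero_estimate {a b X Y K L S T : ℕ} (ha : 2 ≤ a) (hb : 2 ≤ b) (hXY : Nat.Coprime X Y)
    (hT : T ≤ Y) (hKL : K * L ≤ S * T) (P : ℕ → ℤ[X]) (hdeg : ∀ j < L, (P j).natDegree < K)
    (hvan : ∀ s < S + L, ∀ t < T,
      ∑ j ∈ Finset.range L, (P j).eval ((s * Y + t * X : ℕ) : ℤ) * ((a : ℤ) ^ s * (b : ℤ) ^ t) ^ j
        = 0) :
    ∀ j < L, P j = 0 := by
  classical
  by_contra! hcon
  obtain ⟨j₀, hj₀, hPj₀⟩ := hcon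
  set J := (Finset.range L).filter fun j => P j ≠ 0 with hJ
  have hj₀J : j₀ ∈ J := by simp [hJ, hj₀, hPj₀]
  set m := J.card with hm
  have hm0 : 0 < m := Finset.card_pos.2 ⟨j₀, hj₀J⟩
  have hmL : m ≤ L := (Finset.card_filter_le _ _).trans (by simp)
  let e : Fin m ↪o ℕ := J.orderEmbOfFin hm.symm
  have heJ : ∀ k, e k ∈ J := fun k => J.orderEmbOfFin_mem hm.symm k
  have he : ∀ k, e k < L ∧ P (e k) ≠ 0 := fun k => by
    have := heJ k
    simpa [hJ] using this
  have hsum : ∀ F : ℕ → ℤ, (∀ j < L, P j = 0 → F j = 0) →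
      ∑ k, F (e k) = ∑ j ∈ Finset.range L, F j := fun F hF => by
    rw [← Finset.sum_filter_of_ne (p := fun j => P j ≠ 0)
      (fun j hj hFj hPj => hFj (hF j (Finset.mem_range.1 hj) hPj)), ← hJ]
    have himg : Finset.univ.map e.toEmbedding = J := J.map_orderEmbOfFin_univ hm.symm
    rw [← himg, Finset.sum_map]
    rfl
  have ha0 : (a : ℤ) ≠ 0 := by positivity
  have hb0 : (b : ℤ) ≠ 0 := by positivity
  let v : Fin m → ℤ := fun k => (a : ℤ) ^ e k
  obtain ⟨hc, hd⟩ := coeff_det_shift (fun k => P (e k)) (fun k => (he k).2) v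
    (fun k => pow_ne_zero _ ha0) Y
  set D := Matrix.det (Matrix.of fun ν k : Fin m =>
      (P (e k)).comp (Polynomial.X + C ((ν : ℤ) * Y)) * C (v k ^ (ν : ℕ))) with hD
  have hdegD : D.natDegree < S * T := by
    refine (hd.trans_lt ?_).trans_le hKL
    calc ∑ k, (P (e k)).natDegree < ∑ _k : Fin m, K :=
          Finset.sum_lt_sum_of_nonempty ⟨⟨0, hm0⟩, Finset.mem_univ _⟩
            fun k _ => hdeg _ (he k).1
      _ = m * K := by simp
      _ ≤ K * L := by rw [mul_comm]; exact Nat.mul_le_mul_left _ hmL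
  have hD0 : D = 0 := by
    refine eq_zero_of_natDegree_lt_card_of_eval_eq_zero' D
      ((Finset.range S ×ˢ Finset.range T).image
        fun p : ℕ × ℕ => ((p.1 * Y + p.2 * X : ℕ) : ℤ)) ?_ ?_
    · intro u hu
      obtain ⟨⟨s, t⟩, hst, rfl⟩ := Finset.mem_image.1 hu
      simp only [Finset.mem_product, Finset.mem_range] at hst
      rw [hD, ← coe_evalRingHom, RingHom.map_det, ← Matrix.exists_mulVec_eq_zero_iff]
      refine ⟨fun k => ((a : ℤ) ^ s * (b : ℤ) ^ t) ^ e k, ?_, ?_⟩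
      · intro h
        exact pow_ne_zero _ (mul_ne_zero (pow_ne_zero _ ha0) (pow_ne_zero _ hb0))
          (congrFun h ⟨0, hm0⟩)
      · ext ν
        have h1 := hvan (s + ν) (by have := ν.2; omega) t hst.2
        rw [← hsum _ (fun j _ hj => by rw [hj, eval_zero, zero_mul])] at h1
        rw [Pi.zero_apply, ← h1]
        simp only [Matrix.mulVec, dotProduct]
        refine Finset.sum_congr rfl fun k _ => ?_
        simp only [RingHom.mapMatrix_apply, Matrix.map_apply, Matrix.of_apply, coe_evalRingHom,
          eval_mul, eval_C, eval_comp, eval_add, eval_X, v]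
        have h2 : ((s * Y + t * X : ℕ) : ℤ) + (ν : ℕ) * Y = (((s + ν) * Y + t * X : ℕ) : ℤ) := by
          push_cast; ring
        rw [h2]
        ring
    · rw [Finset.card_image_of_injOn (injOn_mul_add_mul hXY hT S)]
      simpa using hdegD
  rw [hD0, coeff_zero] at hc
  refine mul_ne_zero (Finset.prod_ne_zero_iff.2 fun k _ => leadingCoeff_ne_zero.2 (he k).2)
    (Matrix.det_vandermonde_ne_zero_iff.2 fun k l hkl => ?_) hc.symm
  have h1 : (a : ℤ) ^ e k = (a : ℤ) ^ e l := hkl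
  norm_cast at h1
  exact e.injective (Nat.pow_right_injective ha h1)

end ZeroEstimate

/-- A variant of Siegel's lemma: `N` small linear forms in `N` unknowns, where the `n`-th form has
coefficients of size `4 ^ (-n)`. -/
theorem exists_small_linear_forms {ι : Type*} [Fintype ι] {N Q : ℕ} (hι : Fintype.card ι = N)
    (hN : 0 < N) (h G : ι → ℕ) (hG : ∀ p, h p + G p = Q) (hQ : 4 * N ^ 2 * 2 ^ Q ≤ 4 ^ N)
    (φ : ι → Fin N → ℝ) (hφ₀ : ∀ p n, 0 ≤ φ p n) (hφ : ∀ p n, φ p n ≤ 2 ^ G p / 4 ^ (n : ℕ))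
    (hsum : N * (N + 1) < ∑ p, h p) :
    ∃ c : ι → ℤ, c ≠ 0 ∧ (∀ p, |(c p : ℝ)| ≤ 2 ^ h p) ∧
      ∀ n, |∑ p, (c p : ℝ) * φ p n| ≤ 1 / (4 * N) := by
  classical
  have : Nonempty ι := Fintype.card_pos_iff.1 (hι ▸ hN)
  have hN' : (0 : ℝ) < N := by exact_mod_cast hN
  let V : (∀ p, Fin (2 ^ h p)) → Fin N → ℝ := fun x n => ∑ p, ((x p : ℕ) : ℝ) * φ p n
  have hV0 : ∀ x n, 0 ≤ V x n := fun x n =>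
    Finset.sum_nonneg fun p _ => mul_nonneg (Nat.cast_nonneg _) (hφ₀ p n)
  have hV : ∀ x n, 4 * N * V x n < 4 ^ (N - n : ℕ) := fun x n => by
    have h1 : V x n < ∑ _p : ι, (2 : ℝ) ^ Q / 4 ^ (n : ℕ) := by
      refine Finset.sum_lt_sum_of_nonempty Finset.univ_nonempty fun p _ => ?_
      have h2 : ((x p : ℕ) : ℝ) < 2 ^ h p := by exact_mod_cast (x p).2
      calc ((x p : ℕ) : ℝ) * φ p n ≤ (x p : ℕ) * (2 ^ G p / 4 ^ (n : ℕ)) := by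
            gcongr; exact hφ p n
        _ < 2 ^ h p * (2 ^ G p / 4 ^ (n : ℕ)) := by gcongr
        _ = 2 ^ Q / 4 ^ (n : ℕ) := by rw [← hG p, pow_add]; ring
    rw [Finset.sum_const, Finset.card_univ, hι, nsmul_eq_mul] at h1
    have h3 : (4 : ℝ) * N ^ 2 * 2 ^ Q ≤ 4 ^ N := by exact_mod_cast hQ
    calc 4 * N * V x n < 4 * N * (N * (2 ^ Q / 4 ^ (n : ℕ))) := by gcongr
      _ = 4 * N ^ 2 * 2 ^ Q / 4 ^ (n : ℕ) := by ring
      _ ≤ 4 ^ N / 4 ^ (n : ℕ) := by gcongr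
      _ = 4 ^ (N - n : ℕ) := by rw [pow_sub₀ _ (by norm_num) n.2.le]; rfl
  let f : (∀ p, Fin (2 ^ h p)) → ∀ n : Fin N, Fin (4 ^ (N - n : ℕ)) := fun x n =>
    ⟨⌊4 * N * V x n⌋₊, (Nat.floor_lt (mul_nonneg (by positivity) (hV0 x n))).2
      (by exact_mod_cast hV x n)⟩
  have hcard : Fintype.card (∀ n : Fin N, Fin (4 ^ (N - n : ℕ))) <
      Fintype.card (∀ p, Fin (2 ^ h p)) := by
    simp only [Fintype.card_pi, Fintype.card_fin]
    rw [Finset.prod_pow_eq_pow_sum, Finset.prod_pow_eq_pow_sum,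
      Fin.sum_univ_eq_sum_range (fun n => N - n)]
    have h1 : ∑ n ∈ Finset.range N, (N - n) = ∑ n ∈ Finset.range (N + 1), n := by
      have h2 := Finset.sum_range_reflect (fun n => n) (N + 1)
      rw [← h2, Finset.sum_range_succ]
      simp
    rw [h1, show (4 : ℕ) = 2 ^ 2 from rfl, ← pow_mul, mul_comm, Finset.sum_range_id_mul_two]
    refine Nat.pow_lt_pow_right one_lt_two (lt_of_eq_of_lt ?_ hsum)
    simp [mul_comm]
  obtain ⟨x, x', hne, hxx⟩ := Fintype.exists_ne_map_eq_of_card_lt f hcard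
  refine ⟨fun p => (x p : ℕ) - (x' p : ℕ), ?_, fun p => ?_, fun n => ?_⟩
  · intro h0
    refine hne (funext fun p => Fin.ext ?_)
    have := congrFun h0 p
    simp only [Pi.zero_apply] at this
    omega
  · have h1 : ((x p : ℕ) : ℝ) < 2 ^ h p := by exact_mod_cast (x p).2
    have h2 : ((x' p : ℕ) : ℝ) < 2 ^ h p := by exact_mod_cast (x' p).2
    have h3 : (0 : ℝ) ≤ (x p : ℕ) := Nat.cast_nonneg _
    have h4 : (0 : ℝ) ≤ (x' p : ℕ) := Nat.cast_nonneg _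
    push_cast
    rw [abs_le]
    constructor <;> linarith
  · have h1 : ∑ p, (((x p : ℕ) - (x' p : ℕ) : ℤ) : ℝ) * φ p n = V x n - V x' n := by
      simp only [V]
      rw [← Finset.sum_sub_distrib]
      refine Finset.sum_congr rfl fun p _ => ?_
      push_cast
      ring
    have h2 : ⌊4 * N * V x n⌋₊ = ⌊4 * N * V x' n⌋₊ := congrArg Fin.val (congrFun hxx n)
    have h3 := Nat.floor_le (mul_nonneg (by positivity : (0 : ℝ) ≤ 4 * N) (hV0 x n))
    have h4 := Nat.lt_floor_add_one (4 * N * V x n)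
    have h5 := Nat.floor_le (mul_nonneg (by positivity : (0 : ℝ) ≤ 4 * N) (hV0 x' n))
    have h6 := Nat.lt_floor_add_one (4 * N * V x' n)
    rw [h2] at h3 h4
    rw [h1, le_div_iff₀ (by positivity), mul_comm, ← abs_of_pos (by positivity : (0 : ℝ) < 4 * N),
      ← abs_mul, mul_sub, abs_le]
    constructor <;> linarith

theorem pow_div_factorial_le_exp {x : ℝ} (hx : 0 ≤ x) (n : ℕ) :
    x ^ n / n.factorial ≤ Real.exp (4 * x) / 4 ^ n := by
  rw [le_div_iff₀ (by positivity), div_mul_eq_mul_div, ← mul_pow, mul_comm x]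
  exact Real.pow_div_factorial_le_exp _ (by positivity) n

theorem exp_sub_sum_le {x : ℝ} (hx : 0 ≤ x) (q : ℕ) :
    Real.exp x - ∑ k ∈ Finset.range q, x ^ k / k.factorial ≤ Real.exp (4 * x) / 4 ^ q := by
  have hs : ∀ y : ℝ, HasSum (fun k : ℕ => y ^ k / k.factorial) (Real.exp y) := fun y => by
    rw [Real.exp_eq_exp_ℝ]; exact NormedSpace.expSeries_div_hasSum_exp y
  have hsx := (hasSum_nat_add_iff' q).2 (hs x)
  have hs4 := ((hasSum_nat_add_iff' q).2 (hs (4 * x))).div_const (4 ^ q)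
  refine (hasSum_le (fun k => ?_) hsx hs4).trans ?_
  · have h1 : (4 * x) ^ (k + q) / (k + q).factorial / 4 ^ q =
        4 ^ k * (x ^ (k + q) / (k + q).factorial) := by
      rw [mul_pow, pow_add 4 k q]
      field_simp
    rw [h1]
    exact le_mul_of_one_le_left (by positivity) (one_le_pow₀ (by norm_num))
  · gcongr
    exact sub_le_self _ (Finset.sum_nonneg fun k _ => by positivity)

/-- The coefficient of `(u / R) ^ n` in the power series of `u ^ i * exp (j * η * u)`. -/
noncomputable def expCoeff (R η : ℝ) (i j n : ℕ) : ℝ :=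
  if i ≤ n then R ^ i * ((j * (η * R)) ^ (n - i) / (n - i).factorial) else 0

theorem expCoeff_nonneg {R η : ℝ} (hR : 0 ≤ R) (hη : 0 ≤ η) (i j n : ℕ) :
    0 ≤ expCoeff R η i j n := by
  rw [expCoeff]
  split_ifs
  · positivity
  · rfl

theorem expCoeff_le {R η : ℝ} {f g : ℕ} (hR : 0 ≤ R) (hη : 0 ≤ η) (hRg : 4 * R ≤ 2 ^ g)
    (hf : Real.exp (4 * (η * R)) ≤ 2 ^ f) (i j n : ℕ) :
    expCoeff R η i j n ≤ 2 ^ (g * i + f * j) / 4 ^ n := by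
  rw [expCoeff]
  split_ifs with h
  · have h1 : R ^ i ≤ 2 ^ (g * i) / 4 ^ i := by
      rw [le_div_iff₀ (by positivity), ← mul_pow, pow_mul, mul_comm]
      exact pow_le_pow_left₀ (by positivity) hRg i
    have h2 : (j * (η * R)) ^ (n - i) / (n - i).factorial ≤ 2 ^ (f * j) / 4 ^ (n - i) := by
      refine (pow_div_factorial_le_exp (by positivity) _).trans ?_
      gcongr
      rw [pow_mul, show 4 * ((j : ℝ) * (η * R)) = j * (4 * (η * R)) by ring, Real.exp_nat_mul]
      exact pow_le_pow_left₀ (Real.exp_nonneg _) hf j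
    calc _ ≤ 2 ^ (g * i) / 4 ^ i * (2 ^ (f * j) / 4 ^ (n - i) : ℝ) :=
          mul_le_mul h1 h2 (by positivity) (by positivity)
      _ = 2 ^ (g * i + f * j) / 4 ^ n := by
          rw [div_mul_div_comm, ← pow_add, ← pow_add, Nat.add_sub_cancel' h]
  · positivity

theorem abs_sub_sum_expCoeff_le {R η u : ℝ} {f g : ℕ} (hη : 0 ≤ η) (hRg : 4 * R ≤ 2 ^ g)
    (hf : Real.exp (4 * (η * R)) ≤ 2 ^ f) (hu : 0 ≤ u) (huR : u ≤ R) (hR : 0 < R) {i N : ℕ}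
    (hi : i ≤ N) (j : ℕ) :
    |u ^ i * Real.exp (j * (η * u)) - ∑ n ∈ Finset.range N, expCoeff R η i j n * (u / R) ^ n| ≤
      2 ^ (g * i + f * j) / 4 ^ N := by
  set x : ℝ := j * (η * u) with hx
  have hx0 : 0 ≤ x := by positivity
  have hsum : ∑ n ∈ Finset.range N, expCoeff R η i j n * (u / R) ^ n =
      u ^ i * ∑ k ∈ Finset.range (N - i), x ^ k / k.factorial := by
    obtain ⟨q, rfl⟩ := Nat.exists_eq_add_of_le hi
    rw [Finset.sum_range_add, Finset.sum_eq_zero, zero_add, Nat.add_sub_cancel_left,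
      Finset.mul_sum]
    · refine Finset.sum_congr rfl fun k _ => ?_
      rw [expCoeff, if_pos (Nat.le_add_right _ _), Nat.add_sub_cancel_left, pow_add (u / R), hx,
        show (j : ℝ) * (η * u) = j * (η * R) * (u / R) by field_simp, mul_pow _ (u / R), div_pow u R i]
      field_simp
    · intro n hn
      rw [expCoeff, if_neg (not_le.2 (Finset.mem_range.1 hn)), zero_mul]
  rw [hsum, ← mul_sub, abs_of_nonneg
    (mul_nonneg (by positivity) (sub_nonneg.2 (Real.sum_le_exp_of_nonneg hx0 _)))]
  have h1 : u ^ i ≤ 2 ^ (g * i) / 4 ^ i := by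
    rw [le_div_iff₀ (by positivity), ← mul_pow, pow_mul, mul_comm]
    exact pow_le_pow_left₀ (by positivity) (le_trans (by gcongr) hRg) i
  have h2 : Real.exp (4 * x) ≤ 2 ^ (f * j) := by
    rw [pow_mul, show 4 * x = j * (4 * (η * u)) by rw [hx]; ring, Real.exp_nat_mul]
    refine pow_le_pow_left₀ (Real.exp_nonneg _) (le_trans ?_ hf) j
    gcongr
  calc _ ≤ 2 ^ (g * i) / 4 ^ i * (2 ^ (f * j) / 4 ^ (N - i) : ℝ) := by
        refine mul_le_mul h1 ((exp_sub_sum_le hx0 _).trans ?_)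
          (sub_nonneg.2 (Real.sum_le_exp_of_nonneg hx0 _)) (by positivity)
        gcongr
    _ = 2 ^ (g * i + f * j) / 4 ^ N := by
        rw [div_mul_div_comm, ← pow_add, ← pow_add, Nat.add_sub_cancel' hi]

theorem abs_pow_mul_sub_sum_expCoeff_le {R η u A τ : ℝ} {f g : ℕ} (hη : 0 ≤ η)
    (hRg : 4 * R ≤ 2 ^ g) (hf : Real.exp (4 * (η * R)) ≤ 2 ^ f) (hu : 0 ≤ u) (huR : u ≤ R)
    (hR : 0 < R) (hAτ : Real.exp (η * u) = A * Real.exp τ) {i j N : ℕ}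
    (hi : i ≤ N) (hτ : 0 ≤ τ) (hjτ : j * τ ≤ N / 4 ^ N) :
    |u ^ i * A ^ j - ∑ n ∈ Finset.range N, expCoeff R η i j n * (u / R) ^ n| ≤
      2 ^ (g * i + f * j) * (N + 1) / 4 ^ N := by
  have h1 := abs_sub_sum_expCoeff_le hη hRg hf hu huR hR hi j
  have h2 : u ^ i * Real.exp (j * (η * u)) ≤ 2 ^ (g * i + f * j) := by
    rw [Real.exp_nat_mul, pow_add, pow_mul, pow_mul]
    have h3 : u ≤ 2 ^ g := by linarith
    have h4 : Real.exp (η * u) ≤ 2 ^ f := by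
      refine le_trans (Real.exp_le_exp.2 ?_) hf
      have : η * u ≤ η * R := by gcongr
      have : 0 ≤ η * R := by positivity
      linarith
    gcongr
  have h3 : |u ^ i * A ^ j - u ^ i * Real.exp (j * (η * u))| ≤
      2 ^ (g * i + f * j) * (N / 4 ^ N) := by
    have h4 : A ^ j = Real.exp (j * (η * u)) * Real.exp (-(j * τ)) := by
      rw [Real.exp_nat_mul, hAτ, mul_pow, ← Real.exp_nat_mul, mul_assoc, ← Real.exp_add]
      simp
    have h5 := Real.add_one_le_exp (-(j * τ))
    have h6 : Real.exp (-(j * τ)) ≤ 1 := Real.exp_le_one_iff.2 (by simpa using by positivity)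
    rw [abs_sub_comm, h4, ← mul_assoc (u ^ i), ← mul_one_sub, abs_of_nonneg
      (mul_nonneg (by positivity) (by linarith))]
    exact mul_le_mul h2 (by linarith) (by linarith) (by positivity)
  calc _ ≤ _ := abs_sub_le _ (u ^ i * Real.exp (j * (η * u))) _
    _ ≤ 2 ^ (g * i + f * j) * (N / 4 ^ N) + 2 ^ (g * i + f * j) / 4 ^ N := add_le_add h3 h1
    _ = _ := by ring

theorem abs_sum_mul_lt_one {ι : Type*} [Fintype ι] {N Q : ℕ} (hι : Fintype.card ι = N)
    (hN : 0 < N) {h G : ι → ℕ} (hG : ∀ p, h p + G p = Q) (hQ : 4 * N ^ 2 * 2 ^ Q ≤ 4 ^ N)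
    {φ : ι → Fin N → ℝ} {c : ι → ℤ} (hc : ∀ p, |(c p : ℝ)| ≤ 2 ^ h p)
    (hφ : ∀ n, |∑ p, (c p : ℝ) * φ p n| ≤ 1 / (4 * N)) {e : ι → ℝ} {z : ℝ} (hz₀ : 0 ≤ z)
    (hz₁ : z ≤ 1) (he : ∀ p, |e p - ∑ n, φ p n * z ^ (n : ℕ)| ≤ 2 ^ G p * (N + 1) / 4 ^ N) :
    |∑ p, c p * e p| < 1 := by
  have hN' : (1 : ℝ) ≤ N := by exact_mod_cast hN
  have h1 : ∑ p, c p * e p = ∑ p, c p * (e p - ∑ n, φ p n * z ^ (n : ℕ)) +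
      ∑ n, (∑ p, c p * φ p n) * z ^ (n : ℕ) := by
    simp only [mul_sub, Finset.sum_sub_distrib, Finset.mul_sum, Finset.sum_mul]
    rw [Finset.sum_comm (γ := ι)]
    simp only [mul_assoc, sub_add_cancel]
  have h2 : |∑ p, c p * (e p - ∑ n, φ p n * z ^ (n : ℕ))| ≤ 1 / 2 := by
    refine (Finset.abs_sum_le_sum_abs _ _).trans ?_
    have h3 : ∀ p ∈ Finset.univ, |c p * (e p - ∑ n, φ p n * z ^ (n : ℕ))| ≤
        2 ^ Q * (N + 1) / 4 ^ N := fun p _ => by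
      rw [abs_mul, ← hG p, pow_add]
      refine (mul_le_mul (hc p) (he p) (abs_nonneg _) (by positivity)).trans_eq (by ring)
    refine (Finset.sum_le_sum h3).trans ?_
    rw [Finset.sum_const, Finset.card_univ, hι, nsmul_eq_mul, ← mul_div_assoc,
      div_le_iff₀ (by positivity)]
    have h4 : (4 : ℝ) * N ^ 2 * 2 ^ Q ≤ 4 ^ N := by exact_mod_cast hQ
    have h5 : (N : ℝ) * (2 ^ Q * (N + 1)) ≤ N * (2 ^ Q * (N + N)) := by gcongr
    linarith
  have h3 : |∑ n, (∑ p, c p * φ p n) * z ^ (n : ℕ)| ≤ 1 / 4 := by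
    refine (Finset.abs_sum_le_sum_abs _ _).trans ?_
    have h4 : ∀ n ∈ Finset.univ, |(∑ p, c p * φ p n) * z ^ (n : ℕ)| ≤ 1 / (4 * N) := fun n _ => by
      rw [abs_mul, abs_of_nonneg (pow_nonneg hz₀ _)]
      exact (mul_le_of_le_one_right (abs_nonneg _) (pow_le_one₀ hz₀ hz₁)).trans (hφ n)
    refine (Finset.sum_le_sum h4).trans_eq ?_
    rw [Finset.sum_const, Finset.card_univ, Fintype.card_fin, nsmul_eq_mul]
    field_simp
  rw [h1]
  exact (abs_add_le _ _).trans_lt (by linarith)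

/-- Two powers with coprime exponents cannot be too close to each other. -/
theorem not_close_of_coprime {a b r X Y K L S₂ T g f α β Q : ℕ} (ha : 2 ≤ a) (hb : 2 ≤ b)
    (heq : a ^ X = b ^ Y + r) (hrY : r < Y ^ 2) (hXY : Nat.Coprime X Y) (hK : 0 < K)
    (hL : 0 < L) (hKL : K * L ≤ S₂ * T) (hTY : T ≤ Y) (hg : 4 * ((S₂ + L) * Y + T * X) ≤ 2 ^ g)
    (haα : a ≤ 2 ^ α) (hbβ : b ≤ 2 ^ β) (hf : f = 4 * (S₂ + L) * α + 4 * T * β + 1)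
    (hN : 4 ^ (K * L) * Y ≤ b ^ Y) (hLT : L * T ≤ K * L) (hQ : 4 * (K * L) ^ 2 * 2 ^ Q ≤ 4 ^ (K * L))
    (hP : g * (K - 1) + f * (L - 1) ≤ Q)
    (hc : g * (K - 1) + f * (L - 1) + 2 * (K * L + 1) < 2 * Q) : False := by
  have hY : 0 < Y := Nat.pos_of_ne_zero fun h => by simp [h] at hrY
  obtain ⟨N, hNdef⟩ : ∃ N, N = K * L := ⟨_, rfl⟩
  have hN0 : 0 < N := hNdef ▸ Nat.mul_pos hK hL
  have ha' : (0 : ℝ) < a := by exact_mod_cast (by omega : 0 < a)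
  have hb' : (0 : ℝ) < b := by exact_mod_cast (by omega : 0 < b)
  have hY' : (0 : ℝ) < Y := by exact_mod_cast hY
  have hla : 0 < Real.log a := Real.log_pos (by exact_mod_cast ha)
  set η : ℝ := Real.log a / Y with hη
  have hη0 : 0 < η := by positivity
  set δ : ℝ := X * η - Real.log b with hδ
  have hηY : η * Y = Real.log a := by rw [hη]; field_simp
  have hYδ : Real.exp (Y * δ) = 1 + r / (b : ℝ) ^ Y := by
    have h1 : (a : ℝ) ^ X = b ^ Y + r := by exact_mod_cast heq
    rw [hδ, mul_sub, Real.exp_sub, show (Y : ℝ) * (X * η) = X * Real.log a by rw [← hηY]; ring,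
      Real.exp_nat_mul, Real.exp_nat_mul, Real.exp_log ha', Real.exp_log hb', h1]
    field_simp
  have hδ0 : 0 ≤ δ := by
    have h1 : 0 ≤ Y * δ := by
      rw [← Real.one_le_exp_iff, hYδ]
      exact le_add_of_nonneg_right (by positivity)
    exact nonneg_of_mul_nonneg_right h1 hY'
  have hδN : δ ≤ 1 / 4 ^ N := by
    have h1 : Y * δ ≤ r / (b : ℝ) ^ Y := by linarith [Real.add_one_le_exp (Y * δ)]
    have h2 : (r : ℝ) ≤ Y ^ 2 := by exact_mod_cast hrY.le
    have h3 : (4 : ℝ) ^ N * Y ≤ b ^ Y := by rw [hNdef]; exact_mod_cast hN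
    rw [le_div_iff₀ (by positivity)] at h1 ⊢
    have h4 : Y ^ 2 * (δ * 4 ^ N) ≤ Y ^ 2 * 1 := by
      calc Y ^ 2 * (δ * 4 ^ N) = Y * δ * (4 ^ N * Y) := by ring
        _ ≤ Y * δ * b ^ Y := by gcongr
        _ ≤ Y ^ 2 * 1 := by linarith
    exact le_of_mul_le_mul_left h4 (by positivity)
  have hQN : (4 : ℝ) * N ^ 2 * 2 ^ Q ≤ 4 ^ N := by rw [hNdef]; exact_mod_cast hQ
  have hTN : (T : ℝ) ≤ N := by
    rw [hNdef]
    exact_mod_cast (Nat.le_mul_of_pos_left T hL).trans hLT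
  have hTδ : 4 * (T * δ) ≤ Real.log 2 := by
    have h1 : (4 : ℝ) * N * 2 ≤ 4 ^ N := by
      refine le_trans ?_ hQN
      have h2 : (1 : ℝ) ≤ N := by exact_mod_cast hN0
      have h3 : (2 : ℝ) ≤ 2 ^ Q := le_self_pow₀ one_le_two (by omega)
      have h4 : (N : ℝ) ≤ N ^ 2 := le_self_pow₀ h2 two_ne_zero
      gcongr
    have h2 : 4 * (T * δ) ≤ 4 * (N * (1 / 4 ^ N)) := by gcongr
    have h3 : (4 : ℝ) * (N * (1 / 4 ^ N)) ≤ 1 / 2 := by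
      rw [mul_one_div, ← mul_div_assoc, div_le_iff₀ (by positivity)]
      linarith
    linarith [Real.log_two_gt_d9]
  set R : ℝ := (S₂ + L) * Y + T * X with hR
  have hR0 : 0 < R := by
    have : (0 : ℝ) < L := by exact_mod_cast hL
    positivity
  have hRg : 4 * R ≤ 2 ^ g := by rw [hR]; exact_mod_cast hg
  have hηX : η * X = Real.log b + δ := by rw [hδ]; ring
  have hfR : Real.exp (4 * (η * R)) ≤ 2 ^ f := by
    have h1 : Real.log a ≤ α * Real.log 2 := by
      rw [← Real.log_pow]
      exact Real.log_le_log ha' (by exact_mod_cast haα)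
    have h2 : Real.log b ≤ β * Real.log 2 := by
      rw [← Real.log_pow]
      exact Real.log_le_log hb' (by exact_mod_cast hbβ)
    rw [← Real.exp_log (show (0 : ℝ) < 2 ^ f by positivity), Real.exp_le_exp, Real.log_pow, hf]
    calc 4 * (η * R) = 4 * (S₂ + L) * (η * Y) + 4 * T * (η * X) := by rw [hR]; ring
      _ = 4 * (S₂ + L) * Real.log a + 4 * T * Real.log b + 4 * (T * δ) := by rw [hηY, hηX]; ring
      _ ≤ 4 * (S₂ + L) * (α * Real.log 2) + 4 * T * (β * Real.log 2) + Real.log 2 := by gcongr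
      _ = _ := by push_cast; ring
  let G : Fin K × Fin L → ℕ := fun p => g * p.1 + f * p.2
  have hGQ : ∀ p, G p ≤ Q := fun p => le_trans (add_le_add
    (Nat.mul_le_mul_left _ (Nat.le_sub_one_of_lt p.1.2))
    (Nat.mul_le_mul_left _ (Nat.le_sub_one_of_lt p.2.2))) hP
  have hcard : Fintype.card (Fin K × Fin L) = N := by simp [hNdef]
  have hG : ∀ p, Q - G p + G p = Q := fun p => Nat.sub_add_cancel (hGQ p)
  have hsum : N * (N + 1) < ∑ p, (Q - G p) := by
    have h1 : ∑ p, (Q - G p) + ∑ p, G p = N * Q := by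
      rw [← Finset.sum_add_distrib, Finset.sum_congr rfl fun p _ => hG p, Finset.sum_const,
        Finset.card_univ, hcard, smul_eq_mul]
    have hid : ∀ m : ℕ, (∑ i : Fin m, (i : ℕ)) * 2 = m * (m - 1) := fun m => by
      rw [Fin.sum_univ_eq_sum_range (fun i => i), Finset.sum_range_id_mul_two]
    have h2 : (∑ p, G p) * 2 = N * (g * (K - 1) + f * (L - 1)) := by
      simp only [G, Finset.sum_add_distrib, Fintype.sum_prod_type, Finset.sum_const,
        Finset.card_univ, Fintype.card_fin, smul_eq_mul, ← Finset.mul_sum]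
      rw [hNdef]
      linear_combination g * L * hid K + f * K * hid L
    have h3 : N * (g * (K - 1) + f * (L - 1) + 2 * (N + 1)) < N * (2 * Q) :=
      Nat.mul_lt_mul_of_pos_left (hNdef ▸ hc) hN0
    linarith
  obtain ⟨c, hc0, hch, hcφ⟩ := exists_small_linear_forms hcard hN0 (fun p => Q - G p) G hG
    (hNdef ▸ hQ) (fun p n => expCoeff R η p.1 p.2 n)
    (fun p n => expCoeff_nonneg hR0.le hη0.le _ _ _)
    (fun p n => expCoeff_le hR0.le hη0.le hRg hfR _ _ _) hsum
  have hvan : ∀ s < S₂ + L, ∀ t < T, ∑ p : Fin K × Fin L,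
      c p * (((s * Y + t * X : ℕ) : ℤ) ^ (p.1 : ℕ) * ((a : ℤ) ^ s * (b : ℤ) ^ t) ^ (p.2 : ℕ)) = 0 := by
    intro s hs t ht
    have hsR : (s : ℝ) ≤ S₂ + L := by exact_mod_cast hs.le
    have htR : (t : ℝ) ≤ T := by exact_mod_cast ht.le
    have huR : (s * Y + t * X : ℝ) ≤ R := by rw [hR]; gcongr
    rw [← Int.abs_lt_one_iff, ← Int.cast_lt (R := ℝ)]
    push_cast
    refine abs_sum_mul_lt_one hcard hN0 hG (hNdef ▸ hQ) hch hcφ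
      (z := (s * Y + t * X) / R) (by positivity) (div_le_one_of_le₀ huR hR0.le) fun p => ?_
    rw [Fin.sum_univ_eq_sum_range
      (fun n => expCoeff R η p.1 p.2 n * ((s * Y + t * X) / R) ^ n)]
    refine abs_pow_mul_sub_sum_expCoeff_le (τ := t * δ) hη0.le hRg hfR (by positivity) huR hR0
      ?_ ?_ (by positivity) ?_
    · rw [show η * (s * Y + t * X) = s * (η * Y) + t * (η * X) by ring, hηY, hηX, mul_add,
        Real.exp_add, Real.exp_add, Real.exp_nat_mul, Real.exp_nat_mul (Real.log b),
        Real.exp_log ha', Real.exp_log hb', mul_assoc]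
    · exact p.1.2.le.trans (hNdef ▸ Nat.le_mul_of_pos_right K hL)
    · have h1 : ((p.2 : ℕ) : ℝ) * t ≤ N := by
        rw [hNdef]
        exact_mod_cast (Nat.mul_le_mul p.2.2.le ht.le).trans hLT
      rw [← mul_assoc, ← mul_one_div]
      gcongr
  let P : ℕ → Polynomial ℤ := fun j => if hj : j < L then
    ∑ i : Fin K, Polynomial.monomial (i : ℕ) (c (i, ⟨j, hj⟩)) else 0
  have hP0 := zero_estimate ha hb hXY hTY hKL P (fun j hj => ?_) fun s hs t ht => ?_
  · refine hc0 (funext fun p => ?_)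
    have h1 := congrArg (Polynomial.coeff · p.1) (hP0 p.2 p.2.2)
    simpa [P, Polynomial.finsetSum_coeff, Polynomial.coeff_monomial, Fin.val_inj] using h1
  · simp only [P, dif_pos hj]
    refine (Nat.lt_iff_le_pred hK).2 (Polynomial.natDegree_sum_le_of_forall_le _ _ fun i _ => ?_)
    exact (Polynomial.natDegree_monomial_le _).trans (Nat.le_sub_one_of_lt i.2)
  · rw [← hvan s hs t ht, Fintype.sum_prod_type_right, ← Fin.sum_univ_eq_sum_range
      (fun j => (P j).eval ((s * Y + t * X : ℕ) : ℤ) * ((a : ℤ) ^ s * (b : ℤ) ^ t) ^ j)]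
    refine Finset.sum_congr rfl fun j _ => ?_
    simp only [P, dif_pos j.2, Polynomial.eval_finsetSum, Polynomial.eval_monomial,
      Finset.sum_mul, mul_assoc]

theorem coprime_exponents_of_close {a b r X Y : ℕ} (hb : 2 ≤ b) (heq : a ^ X = b ^ Y + r)
    (hr : 0 < r) (hrY : r < Y ^ 2) (hY : 200 ≤ Y) : Nat.Coprime X Y := by
  by_contra hne
  obtain ⟨h, hh⟩ : ∃ h, X.gcd Y = h := ⟨_, rfl⟩
  obtain ⟨X', rfl⟩ : h ∣ X := hh ▸ Nat.gcd_dvd_left X Y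
  obtain ⟨Y', hY'⟩ : h ∣ Y := hh ▸ Nat.gcd_dvd_right _ Y
  have h0 : h ≠ 0 := by rintro rfl; simp at hY'; omega
  obtain ⟨k, rfl⟩ : ∃ k, h = k + 1 := Nat.exists_eq_succ_of_ne_zero h0
  have hk : 1 ≤ k := by
    by_contra hk
    exact hne (hh.trans (by omega))
  have hY2 : Y = Y' * k + Y' := by rw [hY']; ring
  have hYk : Y' ≤ Y' * k := Nat.le_mul_of_pos_right _ hk
  rw [hY', mul_comm (k + 1) X', mul_comm (k + 1) Y', pow_mul, pow_mul] at heq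
  have hlt : b ^ Y' < a ^ X' := lt_of_pow_lt_pow_left₀ (k + 1) (Nat.zero_le _) (by omega)
  have h1 : (b ^ Y') ^ k * (b ^ Y' + 1) ≤ (a ^ X') ^ (k + 1) := by
    rw [pow_succ]
    exact Nat.mul_le_mul (Nat.pow_le_pow_left hlt.le k) hlt
  have h2 : (b ^ Y') ^ k ≤ r := by
    rw [heq, mul_add, ← pow_succ] at h1
    omega
  rw [← pow_mul] at h2
  have h3 : 2 ^ (Y' * k) ≤ r := (Nat.pow_le_pow_left hb _).trans h2
  have h4 := sq_mul_two_pow_le (n := Y' * k) (by omega)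
  have h5 : Y ^ 2 ≤ (2 * (Y' * k)) ^ 2 := Nat.pow_le_pow_left (by omega) 2
  rw [mul_pow] at h5
  omega

theorem mul_le_two_pow_sub_six {l : ℕ} (hl : 21 ≤ l) :
    29 * (2 * l - 3) * (l + 1) ≤ 2 ^ (l - 6) := by
  induction l, hl using Nat.le_induction with
  | base => norm_num
  | succ l hl ih =>
    obtain ⟨m, rfl⟩ := Nat.exists_eq_add_of_le hl
    rw [show 21 + m + 1 - 6 = 21 + m - 6 + 1 by omega, pow_succ]
    rw [show 2 * (21 + m) - 3 = 2 * m + 39 by omega] at ih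
    rw [show 2 * (21 + m + 1) - 3 = 2 * m + 41 by omega]
    nlinarith

theorem cube_le_two_pow {l : ℕ} (hl : 32 ≤ l) : 216 * (2 * l) ^ 2 * l + 2 * (l + 1) ≤ 2 ^ l := by
  induction l, hl using Nat.le_induction with
  | base => norm_num
  | succ l hl ih =>
    have h1 : (l + 1) ^ 3 ≤ 2 * l ^ 3 := by
      obtain ⟨m, rfl⟩ := Nat.exists_eq_add_of_le hl
      nlinarith [Nat.zero_le (m ^ 3), Nat.zero_le (m ^ 2)]
    calc 216 * (2 * (l + 1)) ^ 2 * (l + 1) + 2 * (l + 1 + 1) =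
          864 * (l + 1) ^ 3 + 2 * (l + 1 + 1) := by ring
      _ ≤ 864 * (2 * l ^ 3) + 4 * (l + 1) := by omega
      _ = (216 * (2 * l) ^ 2 * l + 2 * (l + 1)) * 2 := by ring
      _ ≤ 2 ^ (l + 1) := by rw [pow_succ]; exact Nat.mul_le_mul_right 2 ih

theorem sq_mul_add_le_two_pow {l α : ℕ} (hl : 21 ≤ l) (hα : α ≤ l) (hα' : l < 32 → α ≤ 6) :
    216 * (2 * l - 3) ^ 2 * α + 2 * (l + 1) ≤ 2 ^ l := by
  rcases lt_or_ge l 32 with h | h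
  · have h6 := hα' h
    refine le_trans (Nat.add_le_add_right (Nat.mul_le_mul_left _ h6) _) ?_
    interval_cases l <;> norm_num
  · refine le_trans ?_ (cube_le_two_pow h)
    gcongr
    omega

theorem two_pow_clog_mul_three_le {b : ℕ} (hb : 2 ≤ b) : 2 ^ (3 * Nat.clog 2 b) ≤ b ^ 4 := by
  have h1 : 2 ^ (Nat.clog 2 b - 1) < b := Nat.pow_pred_clog_lt_self one_lt_two hb
  obtain ⟨k, hk⟩ : ∃ k, Nat.clog 2 b = k := ⟨_, rfl⟩
  rw [hk] at h1 ⊢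
  rcases lt_or_ge k 4 with h | h
  · have h2 : b < 3 → k ≤ 1 := fun h => hk ▸ Nat.clog_le_of_le_pow (by omega)
    have h3 : 2 ^ (k - 1) + 1 ≤ b := h1
    have h4 := Nat.pow_le_pow_left hb 4
    have h5 := Nat.pow_le_pow_left h3 4
    interval_cases k <;> norm_num at h4 h5 ⊢ <;> omega
  · refine le_trans ?_ (Nat.pow_le_pow_left h1.le 4)
    rw [← pow_mul]
    exact Nat.pow_le_pow_right two_pos (by omega)

theorem degree_gap {g p q : ℕ} (hg : 1 ≤ g) (hgp : g ≤ p) (hpq : p ≤ q) :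
    4 * g + 19 + (g * (81 * q - 1) + (72 * q + 4 * p + 1) * (g - 1)) ≤ 2 * (81 * q * g) := by
  obtain ⟨k, rfl⟩ := Nat.exists_eq_add_of_le' hg
  obtain ⟨e, he⟩ : ∃ e, 81 * q = e + 1 := ⟨81 * q - 1, by omega⟩
  rw [he, Nat.add_sub_cancel, Nat.add_sub_cancel]
  have h1 : p * k ≤ q * k := Nat.mul_le_mul_right k hpq
  have h2 : 81 * q * k = (e + 1) * k := by rw [he]
  have h3 : 1 * k ≤ q * k := Nat.mul_le_mul_right k (by omega)
  linarith

theorem exponent_lt {a b r w X Y : ℕ} (ha : 2 ≤ a) (hb : 2 ≤ b) (heq : a ^ X = b ^ Y + r)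
    (hr : 0 < r) (hrY : r < Y ^ 2) (haw : a ≤ 2 * w + 1) (hw : 1 ≤ w) (hbw : b ^ w < Y) :
    Y < 2 ^ 21 := by
  by_contra! hY
  have hY0 : Y ≠ 0 := by omega
  have hXY := coprime_exponents_of_close hb heq hr hrY (by omega)
  obtain ⟨l, hldef⟩ : ∃ l, l = Nat.log 2 Y := ⟨_, rfl⟩
  have hlY : 2 ^ l ≤ Y := hldef ▸ Nat.pow_log_le_self 2 hY0
  have hYl : Y < 2 ^ (l + 1) := hldef ▸ Nat.lt_pow_succ_log_self one_lt_two Y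
  have hl : 21 ≤ l := by
    have := (Nat.pow_lt_pow_iff_right one_lt_two).1 (hY.trans_lt hYl)
    omega
  have hwl : w ≤ l := by
    have := (Nat.pow_lt_pow_iff_right one_lt_two).1
      (((Nat.pow_le_pow_left hb w).trans_lt hbw).trans hYl)
    omega
  obtain ⟨α, hα⟩ : ∃ α, Nat.clog 2 a = α := ⟨_, rfl⟩
  obtain ⟨β, hβ⟩ : ∃ β, Nat.clog 2 b = β := ⟨_, rfl⟩
  have haα : a ≤ 2 ^ α := hα ▸ Nat.le_pow_clog one_lt_two a
  have hbβ : b ≤ 2 ^ β := hβ ▸ Nat.le_pow_clog one_lt_two b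
  have hα0 : 1 ≤ α := by
    by_contra h
    rw [show α = 0 by omega] at haα
    omega
  have hβ0 : 1 ≤ β := by
    by_contra h
    rw [show β = 0 by omega] at hbβ
    omega
  have hαa : 2 ^ α ≤ a ^ 2 := by
    have h1 : 2 ^ (α - 1) < a := hα ▸ Nat.pow_pred_clog_lt_self one_lt_two ha
    rw [show α = α - 1 + 1 by omega, pow_succ, sq]
    exact Nat.mul_le_mul h1.le ha
  have hβb : 2 ^ (3 * β) ≤ b ^ 4 := hβ ▸ two_pow_clog_mul_three_le hb
  have hβl : β ≤ l + 1 := hβ ▸ Nat.clog_le_of_le_pow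
    ((Nat.le_self_pow (by omega) b).trans (hbw.trans hYl).le)
  have hα6 : l < 32 → α ≤ 6 := fun h => hα ▸ Nat.clog_le_of_le_pow (by omega)
  have hαl : α ≤ l := hα ▸ Nat.clog_le_of_le_pow (by
    have := mul_le_two_pow_sub_six hl
    have h2 : 2 ^ (l - 6) ≤ 2 ^ l := Nat.pow_le_pow_right two_pos (by omega)
    have h3 : 1 * (l + 1) ≤ (2 * l - 3) * (l + 1) := Nat.mul_le_mul_right _ (by omega)
    rw [mul_assoc] at this
    omega)
  have hlα := sq_mul_add_le_two_pow hl hαl hα6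
  have hl6 := mul_le_two_pow_sub_six hl
  obtain ⟨g, hg⟩ : ∃ g, g = 2 * l - 3 := ⟨_, rfl⟩
  rw [← hg] at hlα hl6
  have hg0 : 0 < g := by omega
  obtain ⟨N, hN⟩ : ∃ N, N = 81 * g * α * β * g := ⟨_, rfl⟩
  have hN216 : 216 * N + 2 * (l + 1) * (81 * β) ≤ 2 ^ l * (81 * β) := by
    calc 216 * N + 2 * (l + 1) * (81 * β) = (216 * g ^ 2 * α + 2 * (l + 1)) * (81 * β) := by
          rw [hN]; ring
      _ ≤ _ := Nat.mul_le_mul_right _ hlα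
  have hNl : N ≤ 2 ^ (2 * l) := by
    have h1 : β ≤ 2 ^ l := hβl.trans Nat.lt_two_pow_self
    rw [two_mul, pow_add]
    have h2 : 2 ^ l * β ≤ 2 ^ l * 2 ^ l := Nat.mul_le_mul_left _ h1
    have h3 := Nat.zero_le (2 * (l + 1) * (81 * β))
    linarith
  have hNgap : 4 * g + 19 + (g * (81 * g * α * β - 1) +
      (4 * (9 * g * β + g) * α + 4 * (9 * g * α) * β + 1) * (g - 1)) ≤ 2 * N := by
    have h1 := degree_gap (g := g) (p := g * α) (q := g * α * β) (by omega)
      (Nat.le_mul_of_pos_right g hα0) (Nat.le_mul_of_pos_right _ hβ0)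
    have h2 : 81 * g * α * β = 81 * (g * α * β) := by ring
    have h3 : 4 * (9 * g * β + g) * α + 4 * (9 * g * α) * β + 1 =
        72 * (g * α * β) + 4 * (g * α) + 1 := by ring
    rwa [hN, h2, h3]
  have hrb : r ≤ b ^ Y := by
    have h1 := sq_mul_two_pow_le (n := Y) (by omega)
    have h2 := Nat.pow_le_pow_left hb Y
    omega
  have hαX : α * X ≤ 2 * (β * Y) + 2 := by
    have h1 : 2 ^ (α * X) ≤ 2 ^ (2 * (β * Y) + 2) := by
      calc 2 ^ (α * X) = (2 ^ α) ^ X := pow_mul _ _ _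
        _ ≤ (a ^ 2) ^ X := Nat.pow_le_pow_left hαa X
        _ = (a ^ X) ^ 2 := by rw [← pow_mul, ← pow_mul, mul_comm]
        _ ≤ (2 * (2 ^ β) ^ Y) ^ 2 := by
          refine Nat.pow_le_pow_left ?_ 2
          have := Nat.pow_le_pow_left hbβ Y
          omega
        _ = 2 ^ (2 * (β * Y) + 2) := by rw [← pow_mul]; ring
    exact (Nat.pow_le_pow_iff_right one_lt_two).1 h1
  have hβY : β * Y ≤ (l + 1) * 2 ^ (l + 1) := Nat.mul_le_mul hβl hYl.le
  refine not_close_of_coprime (K := 81 * g * α * β) (L := g) (S₂ := 9 * g * β) (T := 9 * g * α)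
    (g := g) (Q := 2 * N - (4 * l + 2)) ha hb heq hrY hXY
    (Nat.mul_pos (Nat.mul_pos (Nat.mul_pos (by norm_num) hg0) hα0) hβ0) hg0
    (by rw [← hN, hN]; exact le_of_eq (by ring)) ?_ ?_ haα hbβ rfl ?_ ?_ ?_ ?_ ?_
  · refine le_trans ?_ hlY
    have : g * α ≤ g ^ 2 * α := Nat.mul_le_mul_right _ (Nat.le_self_pow two_ne_zero g)
    have h2 : 9 * (g * α) ≤ 216 * (g ^ 2 * α) := Nat.mul_le_mul (by norm_num) this
    linarith
  · have h1 : (9 * g * β + g) * Y + 9 * g * α * X ≤ 29 * g * (β * Y) := by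
      have h2 : 9 * g * (α * X) ≤ 9 * g * (2 * (β * Y) + 2) := Nat.mul_le_mul_left _ hαX
      have h3 : g * Y ≤ g * (β * Y) := Nat.mul_le_mul_left _ (Nat.le_mul_of_pos_left Y hβ0)
      have h4 : g * 18 ≤ g * Y := Nat.mul_le_mul_left _ (by omega)
      linarith
    calc 4 * ((9 * g * β + g) * Y + 9 * g * α * X) ≤ 4 * (29 * g * (β * Y)) :=
          Nat.mul_le_mul_left _ h1
      _ ≤ 4 * (29 * g * ((l + 1) * 2 ^ (l + 1))) := by gcongr
      _ = 4 * (29 * g * (l + 1) * 2 ^ (l + 1)) := by ring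
      _ ≤ 4 * (2 ^ (l - 6) * 2 ^ (l + 1)) := by gcongr
      _ = 2 ^ g := by
        rw [← pow_add, show (4 : ℕ) = 2 ^ 2 from rfl, ← pow_add]
        congr 1
        omega
  · rw [← hN]
    refine (Nat.pow_le_pow_iff_left (n := 4) (by norm_num)).1 ?_
    calc (4 ^ N * Y) ^ 4 ≤ (4 ^ N * 2 ^ (l + 1)) ^ 4 := by gcongr
      _ = 2 ^ (8 * N + 4 * (l + 1)) := by
        rw [show (4 : ℕ) = 2 ^ 2 from rfl, ← pow_mul, ← pow_add, ← pow_mul]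
        congr 1
        ring
      _ ≤ 2 ^ (3 * β * Y) := by
        refine Nat.pow_le_pow_right two_pos ?_
        have h1 : 2 ^ l * β ≤ Y * β := Nat.mul_le_mul_right _ hlY
        have h2 : (l + 1) * 1 ≤ (l + 1) * β := Nat.mul_le_mul_left _ hβ0
        linarith
      _ ≤ (b ^ 4) ^ Y := by rw [pow_mul]; exact Nat.pow_le_pow_left hβb Y
      _ = (b ^ Y) ^ 4 := by rw [← pow_mul, ← pow_mul, mul_comm]
  · rw [← hN, hN]
    calc g * (9 * g * α) ≤ g * (81 * g * α) := by gcongr; norm_num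
      _ ≤ g * (81 * g * α) * β := Nat.le_mul_of_pos_right _ hβ0
      _ = _ := by ring
  · rw [← hN]
    calc 4 * N ^ 2 * 2 ^ (2 * N - (4 * l + 2)) ≤
          4 * (2 ^ (2 * l)) ^ 2 * 2 ^ (2 * N - (4 * l + 2)) := by gcongr
      _ = 4 ^ N := by
        rw [show (4 : ℕ) = 2 ^ 2 from rfl, ← pow_mul, ← pow_mul, ← pow_add, ← pow_add]
        congr 1
        omega
  · omega
  · rw [← hN]
    omega

theorem exists_pow_le {a b : ℕ} (ha : a.Prime) (hb : 2 ≤ b) (hab : Nat.Coprime a b) :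
    ∃ w h c, 1 ≤ w ∧ (a = 2 ∧ w = 1 ∧ 2 ≤ h ∨ a = 2 * w + 1 ∧ 1 ≤ h) ∧ ¬ a ∣ c ∧
      (b ^ w + 1 = a ^ h * c ∨ b ^ w = a ^ h * c + 1) ∧
      ∀ d n, d ≠ 0 → a ^ n ∣ b ^ d - 1 → a ^ n ≤ a ^ h * d := by
  rcases ha.eq_two_or_odd' with rfl | ⟨w, hw⟩
  · obtain ⟨h, c, h1, h2, h3, h4⟩ := exists_pow_le_two hb hab
    exact ⟨1, h, c, le_rfl, Or.inl ⟨rfl, rfl, h1⟩, h2, by simpa using h3, h4⟩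
  · obtain ⟨h, c, h1, h2, h3, h4⟩ := exists_pow_le_of_odd ha hw hb hab
    exact ⟨w, h, c, by have := ha.two_le; omega, Or.inr ⟨hw, h1⟩, h2, h3, h4⟩

theorem pow_dvd_pow_sub_one {a b r x₁ y₁ x₂ y₂ : ℕ} (hab : Nat.Coprime a b) (hx : x₁ ≤ x₂)
    (hy : y₁ ≤ y₂) (h₁ : a ^ x₁ = b ^ y₁ + r) (h₂ : a ^ x₂ = b ^ y₂ + r) :
    a ^ x₁ ∣ b ^ (y₂ - y₁) - 1 := by
  have h3 : a ^ x₂ - a ^ x₁ = b ^ y₁ * (b ^ (y₂ - y₁) - 1) := by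
    rw [Nat.mul_sub, ← pow_add, Nat.add_sub_cancel' hy, mul_one]; omega
  have h4 : a ^ x₁ ∣ a ^ x₂ - a ^ x₁ := Nat.dvd_sub (pow_dvd_pow a hx) dvd_rfl
  rw [h3] at h4
  exact (Nat.Coprime.pow _ _ hab).dvd_of_dvd_mul_left h4

/-- If `a ^ n ≤ a ^ h * d` with `a ^ h` at most `b ^ w + 1`, then `d` is large. -/
theorem lt_of_pow_lt {a b w d : ℕ} (hb : 2 ≤ b) (hw : 1 ≤ w) (haw : a = 2 ∧ w = 1 ∨ a = 2 * w + 1)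
    (h : b ^ a + b < (b ^ w + 1) * d) : b ^ w < d ∧ (a = 2 * w + 1 → b ^ (w + 1) < d + b) := by
  have hbw : 2 ≤ b ^ w := hb.trans (Nat.le_self_pow (by omega) b)
  rcases haw with ⟨rfl, rfl⟩ | rfl
  · refine ⟨?_, fun h => by omega⟩
    rw [pow_one] at h ⊢
    by_contra! hcon
    have := Nat.mul_le_mul_left (b + 1) hcon
    nlinarith
  · have h1 : b ^ (2 * w + 1) = b ^ w * (b ^ w * b) := by ring
    have h3 : b ^ w * b < d + b := by
      by_contra! hcon
      have := Nat.mul_le_mul_left (b ^ w + 1) hcon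
      nlinarith
    refine ⟨?_, fun _ => by rwa [pow_succ]⟩
    nlinarith

theorem fareyGap_two {b h c d x : ℕ} (hh : 2 ≤ h) (hc : ¬ 2 ∣ c)
    (hbc : b + 1 = 2 ^ h * c ∨ b = 2 ^ h * c + 1) (hx : 2 ^ x ≤ 2 ^ h * d) (hd : d < 2 ^ 21)
    (hbx : b ^ 2 + b < 2 ^ x) :
    ∃ la ua, 2 ^ la ≤ 2 ^ logScale ∧ 2 ^ logScale ≤ 2 ^ ua ∧ FareyGap la ua b := by
  obtain ⟨la, ua, h1, h2, H⟩ := isolatedNear_spec isolatedNear_two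
  have hx' : x ≤ h + 20 := by
    have : 2 ^ x < 2 ^ (h + 21) := by
      rw [pow_add]; exact hx.trans_lt (Nat.mul_lt_mul_of_pos_left hd (by positivity))
    have := (Nat.pow_lt_pow_iff_right one_lt_two).1 this
    omega
  have hbx' : b ^ 2 + b < 2 ^ (h + 20) := hbx.trans_le (Nat.pow_le_pow_right two_pos hx')
  have hc0 : 0 < c := Nat.pos_of_ne_zero (by rintro rfl; simp at hc)
  have hb1 : 2 ^ h * c ≤ b + 1 := by omega
  have h4 : c * (2 ^ h * c) < 2 ^ 20 + c := by
    by_contra! hcon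
    have h5 := Nat.mul_le_mul_left (2 ^ h) hcon
    rw [pow_add] at hbx'
    have h7 : 2 ^ h * c * (2 ^ h * c + b) ≤ (b + 1) * (2 ^ h * c + b) := Nat.mul_le_mul_right _ hb1
    linarith
  have h6 : 2 ^ 2 ≤ 2 ^ h := Nat.pow_le_pow_right two_pos hh
  refine ⟨la, ua, h1, h2, H b h c hh ?_ hc0 ?_ hc hbc hbx'⟩
  · by_contra! hcon
    have h7 : 2 ^ 21 ≤ 2 ^ h := Nat.pow_le_pow_right two_pos (by omega)
    have h8 := Nat.mul_le_mul_right (c * c) h7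
    have h9 := Nat.mul_le_mul_right c hc0
    linarith
  · by_contra! hcon
    have h8 := Nat.mul_le_mul_right (c * c) h6
    have h9 := Nat.mul_le_mul_right c hcon
    linarith

theorem fareyGap_three {b h c d x : ℕ} (hh : 1 ≤ h) (hc : ¬ 3 ∣ c)
    (hbc : b + 1 = 3 ^ h * c ∨ b = 3 ^ h * c + 1) (hx : 3 ^ x ≤ 3 ^ h * d) (hd : d < 2 ^ 21)
    (hbx : b ^ 3 + b < 3 ^ x) :
    ∃ la ua, 2 ^ la ≤ 3 ^ logScale ∧ 3 ^ logScale ≤ 2 ^ ua ∧ FareyGap la ua b := by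
  obtain ⟨la, ua, h1, h2, H⟩ := isolatedNear_spec isolatedNear_three
  have hx' : x ≤ h + 13 := by
    have : 3 ^ x < 3 ^ (h + 14) := by
      rw [pow_add]
      exact hx.trans_lt (Nat.mul_lt_mul_of_pos_left (hd.trans (by norm_num)) (by positivity))
    have := (Nat.pow_lt_pow_iff_right (by norm_num)).1 this
    omega
  have hbx' : b ^ 3 + b < 3 ^ (h + 13) := hbx.trans_le (Nat.pow_le_pow_right (by norm_num) hx')
  have hc0 : 0 < c := Nat.pos_of_ne_zero (by rintro rfl; simp at hc)
  have hb1 : 3 ^ h * c ≤ b + 1 := by omega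
  have h6 : 3 ^ 1 ≤ 3 ^ h := Nat.pow_le_pow_right (by norm_num) hh
  rw [pow_add] at hbx'
  refine ⟨la, ua, h1, h2, H b h c hh ?_ hc0 ?_ hc hbc (by rwa [pow_add])⟩
  · by_contra! hcon
    have h7 : 3 ^ 7 ≤ 3 ^ h := Nat.pow_le_pow_right (by norm_num) (by omega)
    have h8 : 3 ^ h ≤ b + 1 := (Nat.le_mul_of_pos_right _ hc0).trans hb1
    have h9 : 2186 ≤ b := by omega
    have h10 : 2186 ^ 2 * b ≤ b ^ 3 := by
      rw [pow_succ b 2]; exact Nat.mul_le_mul_right _ (Nat.pow_le_pow_left h9 2)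
    omega
  · by_contra! hcon
    have h8 : 3 ^ h * 58 ≤ b + 1 := (Nat.mul_le_mul_left _ (by omega)).trans hb1
    have h9 : 173 ≤ b := by omega
    have h10 : 173 ^ 2 * b ≤ b ^ 3 := by
      rw [pow_succ b 2]; exact Nat.mul_le_mul_right _ (Nat.pow_le_pow_left h9 2)
    omega

theorem fareyGap_of_five_le {b w d : ℕ} (ha : (2 * w + 1).Prime) (hb : 2 ≤ b) (hw : 2 ≤ w)
    (hab : Nat.Coprime (2 * w + 1) b) (hd : d + 1 < 2 ^ 21) (hbd : b ^ (w + 1) < d + b) :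
    ∃ la ua, 2 ^ la ≤ (2 * w + 1) ^ logScale ∧ (2 * w + 1) ^ logScale ≤ 2 ^ ua ∧
      FareyGap la ua b := by
  have hw' : w < 20 := by
    by_contra! hcon
    have h1 : b ^ 20 * b ≤ b ^ (w + 1) := by
      rw [← pow_succ]; exact Nat.pow_le_pow_right (by omega) (by omega)
    have h2 : 2 ^ 20 ≤ b ^ 20 := Nat.pow_le_pow_left hb _
    nlinarith
  have hfar : isolatedFar w = true := by
    refine List.all_eq_true.1 isolatedFar_all w ?_
    clear hab hbd
    revert ha
    interval_cases w <;> norm_num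
  obtain ⟨la, ua, h1, h2, H⟩ := isolatedFar_spec hfar
  refine ⟨la, ua, h1, h2, H b hb ?_ ?_ (by omega)⟩
  · by_contra! hcon
    have h3 : b ^ 3 ≤ b ^ (w + 1) := Nat.pow_le_pow_right (by omega) (by omega)
    have h4 : 131 ^ 2 * b ≤ b ^ 3 := by
      rw [pow_succ b 2]; exact Nat.mul_le_mul_right _ (Nat.pow_le_pow_left hcon 2)
    omega
  · exact (Nat.Prime.coprime_iff_not_dvd ha).1 hab

theorem eq_of_lt_hundred {a b r x y X Y : ℕ} (ha : a.Prime) (hb : 2 ≤ b) (hab : Nat.Coprime a b)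
    (hx : 0 < x) (hy : 0 < y) (hbig : b ^ a < r) (hbY : b < Y) (hyY : y < Y) (hY : Y < 100)
    (hax : a ^ x < Y ^ 2) (h₁ : a ^ x = b ^ y + r) (h₂ : a ^ X = b ^ Y + r) :
    a = 2 ∧ b = 3 ∧ r = 13 := by
  have hax' : a ^ x < 10000 := by nlinarith
  have hlt : ∀ {e k : ℕ}, 2 ≤ e → e ^ k < 10000 → k < 14 := by
    intro e k he hk
    have h1 : 2 ^ k < 2 ^ 14 := (Nat.pow_le_pow_left he k).trans_lt (hk.trans (by norm_num))
    exact (Nat.pow_lt_pow_iff_right one_lt_two).1 h1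
  have ha' : a < 14 := hlt hb (by omega)
  have hsmall : smallCheck a = true := by
    refine List.all_eq_true.1 smallCheck_all a ?_
    clear hab hbig hax h₁ h₂ hax'
    revert ha
    interval_cases a <;> norm_num
  refine smallCheck_spec hsmall hb (by omega) ((Nat.Prime.coprime_iff_not_dvd ha).1 hab) hx
    (hlt ha.two_le hax') hax' hy (hlt hb (by omega)) h₁ hbig hyY hY ?_ h₂
  have h3 : a ^ X < 2 ^ 700 := by
    have h4 : b ^ Y ≤ (2 ^ 7) ^ 99 :=
      (Nat.pow_le_pow_left (by omega) _).trans (Nat.pow_le_pow_right (by norm_num) (by omega))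
    rw [← pow_mul] at h4
    have h5 : r < 2 ^ 14 := by omega
    have h6 : 2 ^ 14 ≤ 2 ^ (7 * 99) := Nat.pow_le_pow_right two_pos (by norm_num)
    calc a ^ X < 2 ^ (7 * 99) * 2 := by linarith
      _ = 2 ^ (7 * 99 + 1) := (pow_succ _ _).symm
      _ ≤ 2 ^ 700 := Nat.pow_le_pow_right two_pos (by norm_num)
  exact ((Nat.pow_lt_pow_iff_right one_lt_two).1
    ((Nat.pow_le_pow_left ha.two_le X).trans_lt h3)).le

theorem eq_of_two_solutions {a b r x₁ y₁ x₂ y₂ : ℕ} (ha : a.Prime) (hb : 2 ≤ b)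
    (hab : Nat.Coprime a b) (hbig : b ^ a < r) (hx₁ : 0 < x₁) (hy₁ : 0 < y₁) (hx : x₁ < x₂)
    (h₁ : a ^ x₁ = b ^ y₁ + r) (h₂ : a ^ x₂ = b ^ y₂ + r) : a = 2 ∧ b = 3 ∧ r = 13 := by
  have hy : y₁ < y₂ := by
    rw [← Nat.pow_lt_pow_iff_right (show 1 < b by omega)]
    have := Nat.pow_lt_pow_right ha.one_lt hx
    omega
  obtain ⟨w, h, c, hw, haw, hac, hbc, hle⟩ := exists_pow_le ha hb hab
  have hax := hle (y₂ - y₁) x₁ (by omega) (pow_dvd_pow_sub_one hab hx.le hy.le h₁ h₂)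
  set d := y₂ - y₁ with hd
  have hc0 : 0 < c := Nat.pos_of_ne_zero (by rintro rfl; simp at hac)
  have hah : a ^ h ≤ b ^ w + 1 := (Nat.le_mul_of_pos_right _ hc0).trans (by omega)
  have hax' : a ^ x₁ ≤ (b ^ w + 1) * d := hax.trans (Nat.mul_le_mul_right _ hah)
  have hby : b ≤ b ^ y₁ := Nat.le_self_pow (by omega) b
  have hba : b ^ a + b < a ^ x₁ := by omega
  obtain ⟨hbwd, hbd⟩ := lt_of_pow_lt hb hw (by tauto) (hba.trans_le hax')
  have haxd : a ^ x₁ < y₂ ^ 2 := by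
    have : (b ^ w + 1) * d ≤ d * d := Nat.mul_le_mul_right _ hbwd
    have : d * d < y₂ * y₂ := Nat.mul_lt_mul'' (by omega) (by omega)
    rw [sq]; omega
  have hr : 0 < r := by omega
  have hrY : r < y₂ ^ 2 := by omega
  have hY : y₂ < 2 ^ 21 :=
    exponent_lt ha.two_le hb h₂ hr hrY (by omega) hw (by omega)
  rcases lt_or_ge y₂ 100 with hY' | hY'
  · have : b ≤ b ^ w := Nat.le_self_pow (by omega) b
    exact eq_of_lt_hundred ha hb hab hx₁ hy₁ hbig (by omega) hy hY' haxd h₁ h₂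
  · exfalso
    have hgap : ∃ la ua, 2 ^ la ≤ a ^ logScale ∧ a ^ logScale ≤ 2 ^ ua ∧ FareyGap la ua b := by
      rcases haw with ⟨rfl, rfl, hh⟩ | ⟨haw, hh⟩
      · rw [pow_one] at hbc
        exact fareyGap_two hh hac hbc hax (by omega) hba
      · rcases hw.eq_or_lt with rfl | hw2
        · obtain rfl : a = 3 := haw
          rw [pow_one] at hbc
          exact fareyGap_three hh hac hbc hax (by omega) hba
        · subst haw
          exact fareyGap_of_five_le ha hb hw2 hab (by omega) (hbd rfl)
    obtain ⟨la, ua, hla, hua, hgap⟩ := hgap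
    exact hgap.elim hla hua hb hr hrY hY' hY h₂

end PillaiCheck

theorem pillai_large_r_prime_a
    (a b : ℕ) (ha : a.Prime) (hb : 2 ≤ b) (hab : Nat.Coprime a b)
    (r : ℕ) (hr : 0 < r) (hra : Nat.Coprime r a) (hrb : Nat.Coprime r b)
    (hexc : (a, b, r) ≠ (2, 3, 13))
    (hbig : b ^ a < r) :
    ∀ x₁ y₁ x₂ y₂ : ℕ, 0 < x₁ → 0 < y₁ → 0 < x₂ → 0 < y₂ →
      a ^ x₁ = b ^ y₁ + r → a ^ x₂ = b ^ y₂ + r → (x₁, y₁) = (x₂, y₂) := by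
  intro x₁ y₁ x₂ y₂ hx₁ hy₁ hx₂ hy₂ h₁ h₂
  have hne : ¬ (a = 2 ∧ b = 3 ∧ r = 13) := fun ⟨h1, h2, h3⟩ => hexc (by rw [h1, h2, h3])
  rcases lt_trichotomy x₁ x₂ with h | rfl | h
  · exact absurd (PillaiCheck.eq_of_two_solutions ha hb hab hbig hx₁ hy₁ h h₁ h₂) hne
  · rw [Nat.pow_right_injective hb (show b ^ y₁ = b ^ y₂ by omega)]
  · exact absurd (PillaiCheck.eq_of_two_solutions ha hb hab hbig hx₂ hy₂ h h₂ h₁) hne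
end
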